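/- (Ruelle's theorem.) Let φ be a pair potential satisfying condition (S) with constant B ≥ 0 and, together with an activity z > 0, condition (LA-HT). Then there exists a Gibbs measure μ ∈ G(z,φ) such that: (a) μ admits correlation functions (k_μ^{(n)})_{n≥1} which are translation invariant (k_μ^{(n)}(x_1+a,…,x_n+a) = k_μ^{(n)}(x_1,…,x_n) for all a ∈ ℝ^d) and satisfy the Ruelle bound for some ξ > 0; and (b) for each n ≥ 2 the Ursell function u_μ^{(n)}(0,·,…,·), viewed as a function of n−1 variables, belongs to L¹(ℝ^{d(n−1)}, dx_1⋯dx_{n−1}). -/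

import Mathlib

open MeasureTheory Set Filter
open scoped ENNReal NNReal BigOperators Topology Classical

noncomputable section

abbrev EucSp (d : ℕ) := EuclideanSpace ℝ (Fin d)

/-- The configuration space `Γ` over `ℝ^d`: locally finite subsets. -/
def Config (d : ℕ) : Type :=
  {γ : Set (EucSp d) // ∀ Λ : Set (EucSp d), IsCompact Λ → (γ ∩ Λ).Finite}

/-- The σ-algebra on `Γ` generated by the maps `γ ↦ |γ ∩ B|`, `B` Borel. -/
instance Config.instMS (d : ℕ) : MeasurableSpace (Config d) :=
  ⨆ (B : Set (EucSp d)) (_ : MeasurableSet B),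
    MeasurableSpace.comap (fun γ : Config d => (γ.1 ∩ B).encard) (⊤ : MeasurableSpace ℕ∞)

/-- `γ ∪ {x}`. -/
def Config.ins {d : ℕ} (γ : Config d) (x : EucSp d) : Config d :=
  ⟨insert x γ.1, fun Λ hΛ => ((γ.2 Λ hΛ).insert x).subset fun y hy => by
    rcases hy with ⟨h1, h2⟩
    rcases h1 with rfl | h1
    · exact Set.mem_insert _ _
    · exact Set.mem_insert_of_mem _ ⟨h1, h2⟩⟩

/-- `γ ∖ {x}`. -/
def Config.del {d : ℕ} (γ : Config d) (x : EucSp d) : Config d :=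
  ⟨γ.1 \ {x}, fun Λ hΛ => (γ.2 Λ hΛ).subset fun y hy => ⟨hy.1.1, hy.2⟩⟩

/-- The pairing `⟨f, γ⟩ = ∑_{x ∈ γ} f x`. -/
def cpair {d : ℕ} (f : EucSp d → ℝ) (γ : Config d) : ℝ := ∑' x : γ.1, f x.1

/-- `exp : [-∞,∞] → [0,∞]`. -/
def eexp (x : EReal) : ℝ≥0∞ :=
  if x = ⊤ then ⊤ else if x = ⊥ then 0 else ENNReal.ofReal (Real.exp x.toReal)

/-- real-valued exponential of an extended real (with `exp(±∞)` sent to junk value `0`). -/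
def rexp (x : EReal) : ℝ := (eexp x).toReal

/-- The relative energy `E(x,γ) = ∑_{y ∈ γ} φ(x-y)` if absolutely convergent, `+∞` otherwise. -/
def energy {d : ℕ} (φ : EucSp d → EReal) (x : EucSp d) (γ : Set (EucSp d)) : EReal :=
  if (∀ y ∈ γ, φ (x - y) ≠ ⊤) ∧ Summable (fun y : γ => (φ (x - y.1)).toReal)
  then (((∑' y : γ, (φ (x - y.1)).toReal) : ℝ) : EReal)
  else ⊤

/-- `∑_{u ∈ γ} φ(u)` if absolutely convergent, `+∞` otherwise. -/
def totPhi {d : ℕ} (φ : EucSp d → EReal) (γ : Set (EucSp d)) : EReal :=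
  if (∀ y ∈ γ, φ y ≠ ⊤) ∧ Summable (fun y : γ => (φ y.1).toReal)
  then (((∑' y : γ, (φ y.1).toReal) : ℝ) : EReal)
  else ⊤

/-- A pair potential: Borel, even, with `φ(x) ∈ ℝ` off the origin. -/
structure IsPairPotential {d : ℕ} (φ : EucSp d → EReal) : Prop where
  meas : Measurable φ
  even : ∀ x : EucSp d, x ≠ 0 → φ (-x) = φ x
  finite_off : ∀ x : EucSp d, x ≠ 0 → φ x ≠ ⊤
  ne_bot : ∀ x, φ x ≠ ⊥

/-- Stability (S): `∑_{{x,y} ⊆ η} φ(x-y) ≥ -B|η|` for all finite `η`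
(stated with the sum over ordered pairs, which doubles both sides). -/
def Stable {d : ℕ} (φ : EucSp d → EReal) (B : ℝ) : Prop :=
  ∀ η : Finset (EucSp d),
    ((-(2 * B * η.card) : ℝ) : EReal) ≤ ∑ p ∈ η.offDiag, φ (p.1 - p.2)

/-- Low activity–high temperature (LA-HT): `∫ |e^{-φ} - 1| z dx < (2 e^{1+2B})⁻¹`. -/
def LAHT {d : ℕ} (φ : EucSp d → EReal) (z B : ℝ) : Prop :=
  ∫⁻ x : EucSp d, ENNReal.ofReal (|rexp (-(φ x)) - 1| * z)
    < ENNReal.ofReal (2 * Real.exp (1 + 2 * B))⁻¹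

/-- The Georgii–Nguyen–Zessin identity characterizing `μ ∈ G(z,φ)`. -/
def GNZ {d : ℕ} (z : ℝ) (φ : EucSp d → EReal) (μ : Measure (Config d)) : Prop :=
  ∀ F : Config d → EucSp d → ℝ≥0∞,
    Measurable (Function.uncurry F) →
    ∫⁻ γ, ∑' x : γ.1, F γ x.1 ∂μ
      = ∫⁻ γ, ∫⁻ x, ENNReal.ofReal z * eexp (-(energy φ x γ.1)) * F (γ.ins x) x ∂volume ∂μ


/-- Ordered `n`-tuples of distinct points of `γ`. -/
def injTuples {d : ℕ} (n : ℕ) (γ : Set (EucSp d)) : Set (Fin n → EucSp d) :=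
  {p | Function.Injective p ∧ ∀ i, p i ∈ γ}

/-- `(k_μ^{(n)})` is the family of correlation functions of `μ`: each `k n` is measurable,
nonnegative and symmetric, and for every measurable symmetric `f : (ℝ^d)^n → [0,∞]`,
`∫_Γ ∑_{{x_1,…,x_n} ⊆ γ} f dμ = (1/n!) ∫ f·kₙ dx` (stated equivalently via the sum over
ordered tuples of distinct points, which absorbs the factor `1/n!`). -/
def HasCorrFns {d : ℕ} (μ : Measure (Config d)) (k : ∀ n : ℕ, (Fin n → EucSp d) → ℝ) : Prop :=
  (∀ n : ℕ, Measurable (k n) ∧ (∀ x, 0 ≤ k n x) ∧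
      ∀ (σ : Equiv.Perm (Fin n)) (x : Fin n → EucSp d), k n (x ∘ σ) = k n x) ∧
  ∀ n : ℕ, 0 < n → ∀ f : (Fin n → EucSp d) → ℝ≥0∞, Measurable f →
    (∀ (σ : Equiv.Perm (Fin n)) (x : Fin n → EucSp d), f (x ∘ σ) = f x) →
    ∫⁻ γ, ∑' p : injTuples n γ.1, f p.1 ∂μ
      = ∫⁻ x : Fin n → EucSp d, f x * ENNReal.ofReal (k n x)

/-- The Ruelle bound `k^{(n)} ≤ ξⁿ`. -/
def RuelleBound {d : ℕ} (k : ∀ n : ℕ, (Fin n → EucSp d) → ℝ) (ξ : ℝ) : Prop :=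
  ∀ n : ℕ, 0 < n → ∀ x : Fin n → EucSp d, k n x ≤ ξ ^ n

/-- Translation invariance of a family of functions on tuples. -/
def TransInvFns {d : ℕ} (k : ∀ n : ℕ, (Fin n → EucSp d) → ℝ) : Prop :=
  ∀ (n : ℕ) (a : EucSp d) (x : Fin n → EucSp d), k n (fun i => x i + a) = k n x

/-- `P` is a partition of `{0,…,n-1}` into nonempty pairwise disjoint blocks. -/
def IsPartOfUniv {n : ℕ} (P : Finset (Finset (Fin n))) : Prop :=
  (∀ b ∈ P, b.Nonempty) ∧ (P : Set (Finset (Fin n))).PairwiseDisjoint id ∧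
    P.sup id = Finset.univ

/-- `u` is the family of Ursell functions of `k`:
`k(η) = ∑ u(η_1) ⋯ u(η_j)`, summing over all partitions of `η`. -/
def IsUrsell {d : ℕ} (k u : ∀ n : ℕ, (Fin n → EucSp d) → ℝ) : Prop :=
  ∀ n : ℕ, 0 < n → ∀ x : Fin n → EucSp d,
    k n x = ∑ P : Finset (Finset (Fin n)),
      if IsPartOfUniv P then ∏ b ∈ P, u b.card (fun i => x (b.orderIsoOfFin rfl i).1) else 0

/-- `f ∈ C_0(ℝ^d)`: continuous with compact support. -/
def IsC0 {d : ℕ} (f : EucSp d → ℝ) : Prop := Continuous f ∧ HasCompactSupport f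

/-- Cylinder functions `FC_b(C_0(ℝ^d),Γ)`. -/
def Cyl {d : ℕ} (F : Config d → ℝ) : Prop :=
  ∃ (N : ℕ) (f : Fin N → EucSp d → ℝ) (g : (Fin N → ℝ) → ℝ),
    (∀ i, IsC0 (f i)) ∧ Continuous g ∧ (∃ C, ∀ y, |g y| ≤ C) ∧
    ∀ γ, F γ = g fun i => cpair (f i) γ

/-- `(D_x^- F)(γ) = F(γ∖x) - F(γ)`. -/
def Dminus {d : ℕ} (F : Config d → ℝ) (x : EucSp d) (γ : Config d) : ℝ := F (γ.del x) - F γ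

/-- `(D_x^+ F)(γ) = F(γ∪x) - F(γ)`. -/
def Dplus {d : ℕ} (F : Config d → ℝ) (x : EucSp d) (γ : Config d) : ℝ := F (γ.ins x) - F γ

/-- `(D_{xy}^{-+} F)(γ) = F(γ∖x∪y) - F(γ)`. -/
def Dpm {d : ℕ} (F : Config d → ℝ) (x y : EucSp d) (γ : Config d) : ℝ :=
  F ((γ.del x).ins y) - F γ

/-- The Glauber bilinear form `E_G`. -/
def glauberForm {d : ℕ} (s : ℝ) (φ : EucSp d → EReal) (μ : Measure (Config d))
    (F G : Config d → ℝ) : ℝ :=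
  ∫ γ, (∑' x : γ.1,
      rexp ((s : EReal) * energy φ x.1 (γ.1 \ {x.1})) * Dminus F x.1 γ * Dminus G x.1 γ) ∂μ

/-- The Kawasaki bilinear form `E_K`. -/
def kawasakiForm {d : ℕ} (s : ℝ) (a : EucSp d → ℝ) (φ : EucSp d → EReal)
    (μ : Measure (Config d)) (F G : Config d → ℝ) : ℝ :=
  (1 / 2) * ∫ γ, (∑' x : γ.1, ∫ y : EucSp d,
      a (x.1 - y) *
        rexp ((s : EReal) * energy φ x.1 (γ.1 \ {x.1}) +
          ((s - 1 : ℝ) : EReal) * energy φ y (γ.1 \ {x.1})) *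
        Dpm F x.1 y γ * Dpm G x.1 y γ) ∂μ

/-- The Glauber generator `H_G`. -/
def HG {d : ℕ} (s z : ℝ) (φ : EucSp d → EReal) (F : Config d → ℝ) (γ : Config d) : ℝ :=
  -(∑' x : γ.1, rexp ((s : EReal) * energy φ x.1 (γ.1 \ {x.1})) * Dminus F x.1 γ)
    - ∫ x : EucSp d, z * rexp (((s - 1 : ℝ) : EReal) * energy φ x γ.1) * Dplus F x γ

/-- The Kawasaki generator `H_K`. -/
def HK {d : ℕ} (s : ℝ) (a : EucSp d → ℝ) (φ : EucSp d → EReal) (F : Config d → ℝ)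
    (γ : Config d) : ℝ :=
  -(∑' x : γ.1, ∫ y : EucSp d,
      a (x.1 - y) * rexp ((s : EReal) * energy φ x.1 (γ.1 \ {x.1}) +
        ((s - 1 : ℝ) : EReal) * energy φ y (γ.1 \ {x.1})) * Dpm F x.1 y γ)

/-- The scaled jump kernel `a_ε(x) = ε^d a(ε x)`. -/
def aScaled {d : ℕ} (a : EucSp d → ℝ) (ε : ℝ) (x : EucSp d) : ℝ := ε ^ d * a (ε • x)

/-- `H_ε^-` (death part of the Kawasaki generator with kernel `aa`). -/
def HepsMinus {d : ℕ} (s : ℝ) (aa : EucSp d → ℝ) (φ : EucSp d → EReal)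
    (F : Config d → ℝ) (γ : Config d) : ℝ :=
  -(∑' x : γ.1, Dminus F x.1 γ * ∫ y : EucSp d,
      aa (x.1 - y) * rexp ((s : EReal) * energy φ x.1 (γ.1 \ {x.1}) +
        ((s - 1 : ℝ) : EReal) * energy φ y (γ.1 \ {x.1})))

/-- `H_ε^+` (birth part of the Kawasaki generator with kernel `aa`). -/
def HepsPlus {d : ℕ} (s : ℝ) (aa : EucSp d → ℝ) (φ : EucSp d → EReal)
    (F : Config d → ℝ) (γ : Config d) : ℝ :=
  -(∑' x : γ.1, ∫ y : EucSp d,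
      aa (x.1 - y) * rexp ((s : EReal) * energy φ x.1 (γ.1 \ {x.1}) +
        ((s - 1 : ℝ) : EReal) * energy φ y (γ.1 \ {x.1})) * Dplus F y (γ.del x.1))

/-- `H_0^-` (death part of the Glauber generator). -/
def H0Minus {d : ℕ} (s : ℝ) (φ : EucSp d → EReal) (F : Config d → ℝ) (γ : Config d) : ℝ :=
  -(∑' x : γ.1, rexp ((s : EReal) * energy φ x.1 (γ.1 \ {x.1})) * Dminus F x.1 γ)

/-- `H_0^+` (birth part of the Glauber generator). -/
def H0Plus {d : ℕ} (s z : ℝ) (φ : EucSp d → EReal) (F : Config d → ℝ) (γ : Config d) : ℝ :=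
  -∫ x : EucSp d, z * rexp (((s - 1 : ℝ) : EReal) * energy φ x γ.1) * Dplus F x γ

/-- The standing assumptions of the paper: `s ∈ [0,1/2]`, a stable pair potential in the
low activity–high temperature regime, bounded outside a ball, and `μ` the Gibbs measure
from Ruelle's theorem with its correlation and Ursell functions. -/
structure Setting (d : ℕ) (s z B ξ : ℝ) (φ : EucSp d → EReal) (μ : Measure (Config d))
    (k u : ∀ n : ℕ, (Fin n → EucSp d) → ℝ) : Prop where
  hd : 0 < d
  hs0 : 0 ≤ s
  hs1 : s ≤ 1 / 2
  pp : IsPairPotential φ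
  hB : 0 ≤ B
  stable : Stable φ B
  hz : 0 < z
  laht : LAHT φ z B
  bddOutside : ∃ R C : ℝ, ∀ x : EucSp d, R ≤ ‖x‖ → ∃ r : ℝ, φ x = (r : EReal) ∧ |r| ≤ C
  prob : IsProbabilityMeasure μ
  gnz : GNZ z φ μ
  corr : HasCorrFns μ k
  ti : TransInvFns k
  hξ : 0 < ξ
  ruelle : RuelleBound k ξ
  ursell : IsUrsell k u
  ursellInt : ∀ m : ℕ,
    Integrable (fun y : Fin (m + 1) → EucSp d => u (m + 2) (Fin.cons 0 y)) volume

/-- The jump kernel `a`: bounded, nonnegative, even, integrable. -/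
structure GoodA {d : ℕ} (a : EucSp d → ℝ) : Prop where
  meas : Measurable a
  nonneg : ∀ x, 0 ≤ a x
  bdd : ∃ C, ∀ x, a x ≤ C
  even : ∀ x, a (-x) = a x
  int : Integrable a volume

/-- `φ(x) → 0` as `|x| → ∞`. -/
def PhiVanishes {d : ℕ} (φ : EucSp d → EReal) : Prop :=
  Tendsto φ (cocompact (EucSp d)) (nhds (0 : EReal))

/-- The normalization `∫ a dx = (∫_Γ exp[(s-1) ∑_{u∈γ} φ(u)] dμ(γ))⁻¹`. -/
def NormalizedA {d : ℕ} (s : ℝ) (a : EucSp d → ℝ) (φ : EucSp d → EReal)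
    (μ : Measure (Config d)) : Prop :=
  (∫ x : EucSp d, a x) = (∫ γ, rexp (((s - 1 : ℝ) : EReal) * totPhi φ γ.1) ∂μ)⁻¹


/-! ### Convolution algebra of functions on finite multisets -/

namespace Ruelle

section Algebra

variable {α : Type*}

/-- The sum of `K t r` over all splittings `s = t + r`, counted with multiplicity. -/
def splitSum {R : Type*} [AddCommMonoid R] (K : Multiset α → Multiset α → R)
    (s : Multiset α) : R :=
  (s.antidiagonal.map fun p => K p.1 p.2).sum

section Basic

variable {R : Type*} [AddCommMonoid R]

@[simp] lemma splitSum_zero (K : Multiset α → Multiset α → R) : splitSum K 0 = K 0 0 := by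
  simp [splitSum]

lemma splitSum_cons (K : Multiset α → Multiset α → R) (a : α) (s : Multiset α) :
    splitSum K (a ::ₘ s)
      = splitSum (fun t r => K t (a ::ₘ r)) s + splitSum (fun t r => K (a ::ₘ t) r) s := by
  simp [splitSum]

lemma splitSum_congr {K K' : Multiset α → Multiset α → R} {s : Multiset α}
    (h : ∀ t r, t + r = s → K t r = K' t r) : splitSum K s = splitSum K' s := by
  unfold splitSum
  congr 1
  exact Multiset.map_congr rfl fun p hp => h _ _ (Multiset.mem_antidiagonal.1 hp)

lemma splitSum_add (K K' : Multiset α → Multiset α → R) (s : Multiset α) :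
    splitSum (fun t r => K t r + K' t r) s = splitSum K s + splitSum K' s := by
  simp [splitSum, Multiset.sum_map_add]

lemma splitSum_map_add (K : Multiset α → Multiset α → R) (s w : Multiset α) :
    splitSum K (s + w)
      = splitSum (fun t r => splitSum (fun t' r' => K (t + t') (r + r')) w) s := by
  induction s using Multiset.induction generalizing K with
  | empty => simp
  | cons a s ih =>
    rw [Multiset.cons_add, splitSum_cons, splitSum_cons, ih, ih]
    simp [Multiset.cons_add]

lemma splitSum_swap (K : Multiset α → Multiset α → R) (s : Multiset α) :
    splitSum (fun t r => K r t) s = splitSum K s := by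
  induction s using Multiset.induction generalizing K with
  | empty => simp
  | cons a s ih => rw [splitSum_cons, splitSum_cons, ih, ih (fun t r => K t (a ::ₘ r)), add_comm]

lemma splitSum_assoc (K : Multiset α → Multiset α → Multiset α → R) (s : Multiset α) :
    splitSum (fun t r => splitSum (fun t' r' => K t t' r') r) s
      = splitSum (fun t r => splitSum (fun t' r' => K t' r' r) t) s := by
  induction s using Multiset.induction generalizing K with
  | empty => simp
  | cons a s ih =>
    simp only [splitSum_cons, splitSum_add]
    rw [ih (fun t t' r' => K t t' (a ::ₘ r')), ih (fun t t' r' => K t (a ::ₘ t') r'),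
      ih (fun t t' r' => K (a ::ₘ t) t' r')]
    abel

lemma splitSum_comm {β : Type*} (K : Multiset α → Multiset α → Multiset β → Multiset β → R)
    (s : Multiset α) (w : Multiset β) :
    splitSum (fun t r => splitSum (fun t' r' => K t r t' r') w) s
      = splitSum (fun t' r' => splitSum (fun t r => K t r t' r') s) w := by
  unfold splitSum
  rw [Multiset.sum_map_sum_map]

lemma splitSum_single_left (F : Multiset α → Multiset α → R)
    (hF : ∀ t r, t ≠ 0 → F t r = 0) (s : Multiset α) : splitSum F s = F 0 s := by
  induction s using Multiset.induction generalizing F with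
  | empty => simp
  | cons a s ih =>
    rw [splitSum_cons, ih _ fun t r ht => hF t _ ht,
      ih (fun t r => F (a ::ₘ t) r) fun t r _ => hF _ _ (by simp), hF (a ::ₘ 0) s (by simp),
      add_zero]

end Basic

lemma splitSum_mul_left (c : ℝ) (K : Multiset α → Multiset α → ℝ) (s : Multiset α) :
    splitSum (fun t r => c * K t r) s = c * splitSum K s := by
  simp [splitSum, Multiset.sum_map_mul_left]

lemma splitSum_sub (K K' : Multiset α → Multiset α → ℝ) (s : Multiset α) :
    splitSum (fun t r => K t r - K' t r) s = splitSum K s - splitSum K' s := by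
  simp [splitSum]

lemma prod_add_eq_splitSum {R : Type*} [CommSemiring R] (f g : α → R) (s : Multiset α) :
    (s.map fun x => f x + g x).prod = splitSum (fun t r => (t.map f).prod * (r.map g).prod) s :=
  Multiset.prod_map_add

/-- The convolution product of functions on multisets. -/
def conv (a b : Multiset α → ℝ) : Multiset α → ℝ := splitSum fun t r => a t * b r

/-- The unit of the convolution product. -/
def convOne : Multiset α → ℝ := fun s => if s = 0 then 1 else 0

lemma conv_comm (a b : Multiset α → ℝ) : conv a b = conv b a := by
  funext s
  unfold conv
  rw [← splitSum_swap]
  simp only [mul_comm]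

lemma conv_assoc (a b c : Multiset α → ℝ) : conv (conv a b) c = conv a (conv b c) := by
  funext s
  have h := splitSum_assoc (fun x y z => a x * b y * c z) s
  simp only [conv, ← splitSum_mul_left, ← mul_assoc]
  rw [h]
  refine splitSum_congr fun t r _ => ?_
  rw [mul_comm, ← splitSum_mul_left]
  simp only [mul_comm]

lemma convOne_conv (a : Multiset α → ℝ) : conv convOne a = a := by
  funext s
  unfold conv
  rw [splitSum_single_left]
  · simp [convOne]
  · intro t r ht
    simp [convOne, ht]

lemma conv_splitSum (a : Multiset α → ℝ) {β : Type*}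
    (G : Multiset β → Multiset β → Multiset α → ℝ) (s : Multiset β) :
    conv a (fun w => splitSum (fun t r => G t r w) s)
      = fun w => splitSum (fun t r => conv a (G t r) w) s := by
  funext w
  unfold conv
  simp only [← splitSum_mul_left]
  rw [splitSum_comm]

lemma conv_mul_left (a b : Multiset α → ℝ) (c : ℝ) :
    conv a (fun w => c * b w) = fun w => c * conv a b w := by
  funext w
  unfold conv
  rw [← splitSum_mul_left]
  exact splitSum_congr (R := ℝ) fun t r _ => by ring

lemma conv_diag (a : Multiset α → ℝ) (K : Multiset α → Multiset α → ℝ) :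
    conv a (fun w => splitSum K w) = fun w => splitSum (fun t r => conv a (K t) r) w := by
  funext w
  unfold conv
  simp only [← splitSum_mul_left]
  have h1 := splitSum_assoc (fun x y z => a x * K y z) w
  have h2 := splitSum_assoc (fun y x z => a x * K y z) w
  rw [h1, h2]
  refine splitSum_congr fun t r _ => ?_
  rw [← splitSum_swap]

/-- Successive approximations of the convolution inverse. -/
def invApprox (ψ : Multiset α → ℝ) : ℕ → Multiset α → ℝ
  | 0 => convOne
  | n + 1 => fun s => convOne s - conv (fun t => ψ t - convOne t) (invApprox ψ n) s

/-- The convolution inverse of a function `ψ` with `ψ 0 = 1`. -/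
def convInv (ψ : Multiset α → ℝ) (s : Multiset α) : ℝ := invApprox ψ s.card s

lemma invApprox_succ_eq {ψ : Multiset α → ℝ} (h0 : ψ 0 = 1) (n : ℕ) (s : Multiset α)
    (hs : s.card ≤ n) : invApprox ψ (n + 1) s = invApprox ψ n s := by
  induction n generalizing s with
  | zero =>
    have : s = 0 := by simpa using hs
    subst this
    simp [invApprox, conv, h0, convOne]
  | succ n ih =>
    simp only [invApprox]
    congr 1
    refine splitSum_congr (R := ℝ) fun t r htr => ?_
    by_cases ht : t = 0
    · simp [ht, h0, convOne]
    · refine congrArg (_ * ·) (ih r ?_)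
      have h1 : 0 < t.card := Multiset.card_pos.2 ht
      have h2 := congrArg Multiset.card htr
      rw [Multiset.card_add] at h2
      omega

lemma invApprox_eq {ψ : Multiset α → ℝ} (h0 : ψ 0 = 1) (n : ℕ) (s : Multiset α)
    (hs : s.card ≤ n) : invApprox ψ n s = convInv ψ s := by
  induction n, hs using Nat.le_induction with
  | base => rfl
  | succ n hn ih => rw [invApprox_succ_eq h0 n s hn, ih]

lemma conv_sub_left (a b c : Multiset α → ℝ) (s : Multiset α) :
    conv (fun t => a t - b t) c s = conv a c s - conv b c s := by
  unfold conv
  rw [← splitSum_sub]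
  exact splitSum_congr (R := ℝ) fun t r _ => by ring

lemma conv_convInv {ψ : Multiset α → ℝ} (h0 : ψ 0 = 1) : conv ψ (convInv ψ) = convOne := by
  funext s
  have h : convInv ψ s = convOne s - conv (fun t => ψ t - convOne t) (convInv ψ) s := by
    rw [← invApprox_eq h0 (s.card + 1) s (by omega)]
    simp only [invApprox]
    congr 1
    refine splitSum_congr (R := ℝ) fun t r htr => ?_
    rw [invApprox_eq h0]
    have h2 := congrArg Multiset.card htr
    rw [Multiset.card_add] at h2
    omega
  rw [conv_sub_left, convOne_conv] at h
  linarith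

/-- The function `ψ⁻¹ * D_X ψ`. -/
def relFn (ψ : Multiset α → ℝ) (X : Multiset α) : Multiset α → ℝ :=
  conv (convInv ψ) fun w => ψ (X + w)

lemma conv_relFn {ψ : Multiset α → ℝ} (h0 : ψ 0 = 1) (X : Multiset α) :
    conv ψ (relFn ψ X) = fun w => ψ (X + w) := by
  rw [relFn, ← conv_assoc, conv_convInv h0, convOne_conv]

lemma relFn_zero {ψ : Multiset α → ℝ} (h0 : ψ 0 = 1) : relFn ψ 0 = convOne := by
  simp only [relFn, zero_add]
  rw [conv_comm]
  exact conv_convInv h0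

lemma relFn_eq_zero {ψ : Multiset α → ℝ} {X : Multiset α} (h : ∀ w, ψ (X + w) = 0)
    (w : Multiset α) : relFn ψ X w = 0 := by
  simp [relFn, conv, h, splitSum]

/-- Kirkwood–Salsburg type recursion. -/
lemma relFn_cons {ψ : Multiset α → ℝ} {x : α} {X : Multiset α} {c : ℝ} {f : α → ℝ}
    (h : ∀ w, ψ (x ::ₘ X + w) = c * ((w.map fun y => f y + 1).prod * ψ (X + w)))
    (w : Multiset α) :
    relFn ψ (x ::ₘ X) w
      = c * splitSum (fun t r => (t.map f).prod * relFn ψ (X + t) r) w := by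
  have h1 : (fun w => ψ (x ::ₘ X + w))
      = fun w => c * splitSum (fun t r => (t.map f).prod * ψ (X + t + r)) w := by
    funext w
    rw [h, prod_add_eq_splitSum]
    congr 1
    rw [mul_comm, ← splitSum_mul_left]
    refine splitSum_congr fun t r htr => ?_
    rw [← htr, ← add_assoc]
    simp [mul_comm]
  rw [relFn, h1, conv_mul_left, conv_diag]
  simp only [conv_mul_left]
  rfl

/-- Leibniz rule for the relative functions. -/
lemma relFn_cons_eq_conv {ψ : Multiset α → ℝ} (h0 : ψ 0 = 1) (x : α) (s w : Multiset α) :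
    relFn ψ (x ::ₘ s) w
      = splitSum (fun t r =>
          splitSum (fun w1 w2 => relFn ψ {x} (t + w1) * relFn ψ r w2) w) s := by
  have h1 : (fun w => ψ (x ::ₘ s + w))
      = fun w => splitSum (fun t r =>
          conv (fun w1 => relFn ψ {x} (t + w1)) (fun w2 => ψ (r + w2)) w) s := by
    funext w
    have := congrFun (conv_relFn h0 {x}) (s + w)
    rw [Multiset.singleton_add] at this
    rw [Multiset.cons_add, ← this, conv_comm, conv, splitSum_map_add]
    rfl
  rw [relFn, h1, conv_splitSum]
  refine splitSum_congr fun t r _ => ?_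
  rw [← conv_assoc, conv_comm (convInv ψ), conv_assoc]
  rfl

lemma splitSum_map {β R : Type*} [AddCommMonoid R] (τ : α → β) (K : Multiset β → Multiset β → R)
    (s : Multiset α) :
    splitSum K (s.map τ) = splitSum (fun t r => K (t.map τ) (r.map τ)) s := by
  induction s using Multiset.induction generalizing K with
  | empty => simp
  | cons a s ih => simp [splitSum_cons, ih]

lemma convInv_comp {β : Type*} (ψ : Multiset α → ℝ) (ψ' : Multiset β → ℝ) (τ : α → β)
    (h : ∀ s, ψ' (s.map τ) = ψ s) (s : Multiset α) : convInv ψ' (s.map τ) = convInv ψ s := by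
  have h2 : ∀ n s, invApprox ψ' n (s.map τ) = invApprox ψ n s := by
    intro n
    induction n with
    | zero => intro s; simp [invApprox, convOne]
    | succ n ih =>
      intro s
      simp only [invApprox, conv, splitSum_map, h, ih]
      simp [convOne]
  simp [convInv, h2]

lemma relFn_map {ψ : Multiset α → ℝ} {τ : α → α} (h : ∀ s, ψ (s.map τ) = ψ s)
    (X w : Multiset α) : relFn ψ (X.map τ) (w.map τ) = relFn ψ X w := by
  unfold relFn conv
  rw [splitSum_map]
  refine splitSum_congr fun t r _ => ?_
  show convInv ψ (t.map τ) * ψ (X.map τ + r.map τ) = convInv ψ t * ψ (X + r)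
  rw [convInv_comp ψ ψ τ h, ← Multiset.map_add, h]

end Algebra

end Ruelle

/-! ### The space of finite tuples -/

namespace Ruelle

section Tuples

/-- Finite tuples of arbitrary length. -/
abbrev Tup (α : Type) : Type := Σ n : ℕ, Fin n → α

/-- The multiset of entries of a tuple. -/
def ms {α : Type} (l : Tup α) : Multiset α := (List.ofFn l.2 : List α)

/-- The empty tuple. -/
def tnil {α : Type} : Tup α := ⟨0, Fin.elim0⟩

/-- Prepending an entry to a tuple. -/
def tcons {α : Type} (a : α) (l : Tup α) : Tup α := ⟨l.1 + 1, Fin.cons a l.2⟩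

/-- Concatenation of tuples. -/
def tapp {α : Type} (l l' : Tup α) : Tup α := ⟨l.1 + l'.1, Fin.append l.2 l'.2⟩

/-- Applying a map to all entries. -/
def tmap {α β : Type} (τ : α → β) (l : Tup α) : Tup β := ⟨l.1, τ ∘ l.2⟩

variable {α T : Type}

@[simp] lemma ms_tnil : ms (tnil : Tup α) = 0 := by simp [ms, tnil]

@[simp] lemma ms_tcons (a : α) (l : Tup α) : ms (tcons a l) = a ::ₘ ms l := by
  simp [ms, tcons, List.ofFn_succ]

@[simp] lemma ms_tapp (l l' : Tup α) : ms (tapp l l') = ms l + ms l' := by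
  simp [ms, tapp, List.ofFn_fin_append]

@[simp] lemma ms_tmap {β : Type} (τ : α → β) (l : Tup α) : ms (tmap τ l) = (ms l).map τ := by
  simp [ms, tmap, List.map_ofFn]

@[simp] lemma card_ms (l : Tup α) : (ms l).card = l.1 := by simp [ms]

lemma ms_mk_zero (x : Fin 0 → α) : ms (⟨0, x⟩ : Tup α) = 0 := by simp [ms]

lemma ms_mk_succ {n : ℕ} (x : Fin (n + 1) → α) :
    ms (⟨n + 1, x⟩ : Tup α) = x 0 ::ₘ ms (⟨n, Fin.tail x⟩ : Tup α) := by
  simp only [ms, List.ofFn_succ, Multiset.cons_coe]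
  rfl

lemma mem_ms {n : ℕ} {x : Fin n → α} {a : α} : a ∈ ms (⟨n, x⟩ : Tup α) ↔ ∃ i, x i = a := by
  simp [ms, List.mem_ofFn]

lemma nodup_ms {n : ℕ} {x : Fin n → α} :
    (ms (⟨n, x⟩ : Tup α)).Nodup ↔ Function.Injective x := by
  simp [ms, List.nodup_ofFn]

lemma ms_comp_perm {n : ℕ} (σ : Equiv.Perm (Fin n)) (x : Fin n → α) :
    ms (⟨n, x ∘ σ⟩ : Tup α) = ms (⟨n, x⟩ : Tup α) := by
  simpa [ms] using Equiv.Perm.ofFn_comp_perm σ x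

lemma tup_mk_injective (n : ℕ) :
    Function.Injective (fun x : Fin n → α => (⟨n, x⟩ : Tup α)) := fun x y h => by
  simpa using h

variable [MeasurableSpace α] [MeasurableSpace T]

lemma measurableEmbedding_sigmaMk (n : ℕ) :
    MeasurableEmbedding (fun x : Fin n → α => (⟨n, x⟩ : Tup α)) where
  injective := tup_mk_injective n
  measurable := Measurable.of_le_map (iInf_le _ n)
  measurableSet_image' := by
    intro s hs
    refine MeasurableSpace.measurableSet_iInf.2 fun m => ?_
    show MeasurableSet ((fun x : Fin m → α => (⟨m, x⟩ : Tup α)) ⁻¹'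
      ((fun x : Fin n → α => (⟨n, x⟩ : Tup α)) '' s))
    by_cases h : m = n
    · subst h
      rwa [Set.preimage_image_eq _ (tup_mk_injective m)]
    · convert MeasurableSet.empty
      ext x
      simp only [Set.mem_preimage, Set.mem_image, Set.mem_empty_iff_false, iff_false]
      rintro ⟨y, _, hy⟩
      exact h (congrArg Sigma.fst hy).symm

lemma measurable_sigmaMk (n : ℕ) : Measurable (fun x : Fin n → α => (⟨n, x⟩ : Tup α)) :=
  (measurableEmbedding_sigmaMk n).measurable

lemma measurable_prod_tup {β : Type*} [MeasurableSpace β] {F : T × Tup α → β}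
    (h : ∀ n, Measurable fun p : T × (Fin n → α) => F (p.1, ⟨n, p.2⟩)) : Measurable F := by
  intro S hS
  have : F ⁻¹' S = ⋃ n, Prod.map id (fun x : Fin n → α => (⟨n, x⟩ : Tup α)) ''
      ((fun p : T × (Fin n → α) => F (p.1, ⟨n, p.2⟩)) ⁻¹' S) := by
    ext ⟨t, n, x⟩
    simp only [Set.mem_preimage, Set.mem_iUnion, Set.mem_image, Prod.exists, Prod.map_apply, id]
    constructor
    · intro hx
      exact ⟨n, t, x, hx, rfl⟩
    · rintro ⟨m, t', y, hy, he⟩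
      rw [← he]
      exact hy
  rw [this]
  exact MeasurableSet.iUnion fun n =>
    (MeasurableEmbedding.id.prodMap (measurableEmbedding_sigmaMk n)).measurableSet_image.2
      (h n hS)

lemma measurable_tup {β : Type*} [MeasurableSpace β] {F : Tup α → β}
    (h : ∀ n, Measurable fun x : Fin n → α => F ⟨n, x⟩) : Measurable F := by
  have : Measurable fun p : Unit × Tup α => F p.2 :=
    measurable_prod_tup fun n => (h n).comp measurable_snd
  exact this.comp (measurable_const.prodMk measurable_id : Measurable fun l : Tup α => ((), l))

lemma measurable_tup_fst : Measurable (Sigma.fst : Tup α → ℕ) :=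
  measurable_tup fun _ => measurable_const

lemma measurable_fin_cons {n : ℕ} :
    Measurable fun p : α × (Fin n → α) => (Fin.cons p.1 p.2 : Fin (n + 1) → α) := by
  refine measurable_pi_lambda _ fun i => ?_
  refine Fin.cases ?_ (fun j => ?_) i
  · simpa using measurable_fst
  · simpa [Function.comp_def] using (measurable_pi_apply j).comp measurable_snd

lemma measurable_fin_append {m n : ℕ} :
    Measurable fun p : (Fin m → α) × (Fin n → α) => Fin.append p.1 p.2 := by
  refine measurable_pi_lambda _ fun i => ?_
  refine Fin.addCases (fun j => ?_) (fun j => ?_) i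
  · simpa [Function.comp_def] using (measurable_pi_apply j).comp measurable_fst
  · simpa [Function.comp_def] using (measurable_pi_apply j).comp measurable_snd

lemma measurable_tcons : Measurable fun p : α × Tup α => tcons p.1 p.2 :=
  measurable_prod_tup fun n => (measurable_sigmaMk (n + 1)).comp measurable_fin_cons

lemma measurable_tapp : Measurable fun p : Tup α × Tup α => tapp p.1 p.2 := by
  refine measurable_prod_tup fun n => ?_
  have : Measurable fun p : (Fin n → α) × Tup α => tapp p.2 ⟨n, p.1⟩ :=
    measurable_prod_tup fun m =>
      (measurable_sigmaMk (m + n)).comp (measurable_fin_append.comp measurable_swap)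
  exact this.comp measurable_swap

lemma measurable_tmap {β : Type} [MeasurableSpace β] {τ : α → β} (hτ : Measurable τ) :
    Measurable (tmap τ) :=
  measurable_tup fun n => (measurable_sigmaMk n).comp <|
    measurable_pi_lambda _ fun i => hτ.comp (measurable_pi_apply i)

lemma measurable_splitSum {R : Type*} [AddCommMonoid R] [MeasurableSpace R] [MeasurableAdd₂ R]
    {K : T → Multiset α → Multiset α → R}
    (hK : Measurable fun p : T × Tup α × Tup α => K p.1 (ms p.2.1) (ms p.2.2)) :
    Measurable fun p : T × Tup α => splitSum (K p.1) (ms p.2) := by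
  refine measurable_prod_tup fun n => ?_
  dsimp only
  induction n generalizing T with
  | zero =>
    simp only [ms_mk_zero, splitSum_zero]
    have : Measurable fun p : T × (Fin 0 → α) => (p.1, (tnil : Tup α), (tnil : Tup α)) := by
      fun_prop
    simpa [Function.comp_def] using hK.comp this
  | succ n ih =>
    simp only [ms_mk_succ, splitSum_cons]
    have htail : Measurable fun p : T × (Fin (n + 1) → α) => ((p.1, p.2 0), Fin.tail p.2) := by
      refine Measurable.prodMk (by fun_prop) (measurable_pi_lambda _ fun i => ?_)
      exact (measurable_pi_apply i.succ).comp measurable_snd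
    refine Measurable.add ?_ ?_
    · have hm : Measurable fun p : (T × α) × Tup α × Tup α =>
          (p.1.1, p.2.1, tcons p.1.2 p.2.2) :=
        (by fun_prop : Measurable fun p : (T × α) × Tup α × Tup α => p.1.1).prodMk
          ((by fun_prop : Measurable fun p : (T × α) × Tup α × Tup α => p.2.1).prodMk
            (measurable_tcons.comp (by fun_prop :
              Measurable fun p : (T × α) × Tup α × Tup α => (p.1.2, p.2.2))))
      have := ih (T := T × α) (K := fun p t r => K p.1 t (p.2 ::ₘ r))
        (by simpa [Function.comp_def] using hK.comp hm)
      exact this.comp htail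
    · have hm : Measurable fun p : (T × α) × Tup α × Tup α =>
          (p.1.1, tcons p.1.2 p.2.1, p.2.2) :=
        (by fun_prop : Measurable fun p : (T × α) × Tup α × Tup α => p.1.1).prodMk
          ((measurable_tcons.comp (by fun_prop :
              Measurable fun p : (T × α) × Tup α × Tup α => (p.1.2, p.2.1))).prodMk
            (by fun_prop : Measurable fun p : (T × α) × Tup α × Tup α => p.2.2))
      have := ih (T := T × α) (K := fun p t r => K p.1 (p.2 ::ₘ t) r)
        (by simpa [Function.comp_def] using hK.comp hm)
      exact this.comp htail

lemma measurable_splitSum' {R : Type*} [AddCommMonoid R] [MeasurableSpace R] [MeasurableAdd₂ R]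
    {K : Multiset α → Multiset α → R}
    (hK : Measurable fun p : Tup α × Tup α => K (ms p.1) (ms p.2)) :
    Measurable fun l : Tup α => splitSum K (ms l) := by
  have := measurable_splitSum (T := Unit) (K := fun _ => K) (hK.comp measurable_snd)
  exact this.comp (measurable_const.prodMk measurable_id : Measurable fun l : Tup α => ((), l))

lemma measurable_map_prod {w : T → α → ℝ} (hw : Measurable fun p : T × α => w p.1 p.2) :
    Measurable fun p : T × Tup α => ((ms p.2).map (w p.1)).prod := by
  refine measurable_prod_tup fun n => ?_
  simp only [ms, Multiset.map_coe, Multiset.prod_coe, List.map_ofFn, List.prod_ofFn]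
  refine Finset.measurable_prod _ fun i _ => ?_
  exact hw.comp (by fun_prop : Measurable fun p : T × (Fin n → α) => (p.1, p.2 i))

lemma measurable_map_prod_ennreal {w : T → α → ℝ≥0∞}
    (hw : Measurable fun p : T × α => w p.1 p.2) :
    Measurable fun p : T × Tup α => ((ms p.2).map (w p.1)).prod := by
  refine measurable_prod_tup fun n => ?_
  simp only [ms, Multiset.map_coe, Multiset.prod_coe, List.map_ofFn, List.prod_ofFn]
  refine Finset.measurable_prod _ fun i _ => ?_
  exact hw.comp (by fun_prop : Measurable fun p : T × (Fin n → α) => (p.1, p.2 i))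

lemma measurable_map_prod' {w : α → ℝ} (hw : Measurable w) :
    Measurable fun l : Tup α => ((ms l).map w).prod :=
  (measurable_map_prod (T := Unit) (w := fun _ => w) (hw.comp measurable_snd)).comp
    (measurable_const.prodMk measurable_id : Measurable fun l : Tup α => ((), l))

lemma measurable_map_prod_ennreal' {w : α → ℝ≥0∞} (hw : Measurable w) :
    Measurable fun l : Tup α => ((ms l).map w).prod :=
  (measurable_map_prod_ennreal (T := Unit) (w := fun _ => w) (hw.comp measurable_snd)).comp
    (measurable_const.prodMk measurable_id : Measurable fun l : Tup α => ((), l))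

lemma measurable_conv {a b : Multiset α → ℝ} (ha : Measurable fun l : Tup α => a (ms l))
    (hb : Measurable fun l : Tup α => b (ms l)) :
    Measurable fun l : Tup α => conv a b (ms l) :=
  measurable_splitSum' ((ha.comp measurable_fst).mul (hb.comp measurable_snd))

lemma measurable_convOne : Measurable fun l : Tup α => convOne (ms l) := by
  refine measurable_tup fun n => ?_
  have : (fun x : Fin n → α => convOne (ms (⟨n, x⟩ : Tup α))) = fun _ => if n = 0 then 1 else 0 := by
    funext x
    simp only [convOne, ← Multiset.card_eq_zero, card_ms]
  rw [this]
  exact measurable_const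

lemma measurable_convInv {ψ : Multiset α → ℝ} (hψ : Measurable fun l : Tup α => ψ (ms l)) :
    Measurable fun l : Tup α => convInv ψ (ms l) := by
  have h : ∀ n, Measurable fun l : Tup α => invApprox ψ n (ms l) := by
    intro n
    induction n with
    | zero => exact measurable_convOne
    | succ n ih =>
      exact measurable_convOne.sub (measurable_conv (hψ.sub measurable_convOne) ih)
  refine measurable_tup fun n => ?_
  simp only [convInv, card_ms]
  exact (h n).comp (measurable_sigmaMk n)

lemma measurable_relFn {ψ : Multiset α → ℝ} (hψ : Measurable fun l : Tup α => ψ (ms l)) :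
    Measurable fun p : Tup α × Tup α => relFn ψ (ms p.1) (ms p.2) := by
  refine measurable_splitSum (T := Tup α) (K := fun t a b => convInv ψ a * ψ (ms t + b)) ?_
  refine ((measurable_convInv hψ).comp (by fun_prop)).mul ?_
  have := hψ.comp (measurable_tapp.comp
    (by fun_prop : Measurable fun p : Tup α × Tup α × Tup α => (p.1, p.2.2)))
  simpa [Function.comp_def] using this

end Tuples

end Ruelle

/-! ### The Lebesgue–Poisson measure -/

namespace Ruelle

section LebesguePoisson

variable {α : Type} [MeasurableSpace α]

/-- The (unnormalised) Lebesgue–Poisson measure with intensity `ν`. -/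
def tupMeas (ν : Measure α) : Measure (Tup α) :=
  Measure.sum fun n : ℕ => ((n.factorial : ℝ≥0∞)⁻¹) •
    (Measure.pi fun _ : Fin n => ν).map fun x => (⟨n, x⟩ : Tup α)

variable (ν : Measure α)

instance [SigmaFinite ν] : SFinite (tupMeas ν) := by
  unfold tupMeas
  infer_instance

lemma lintegral_tup (F : Tup α → ℝ≥0∞) :
    ∫⁻ l, F l ∂tupMeas ν
      = ∑' n : ℕ, (n.factorial : ℝ≥0∞)⁻¹ * ∫⁻ x, F ⟨n, x⟩ ∂Measure.pi fun _ : Fin n => ν := by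
  rw [tupMeas, lintegral_sum_measure]
  refine tsum_congr fun n => ?_
  rw [lintegral_smul_measure, (measurableEmbedding_sigmaMk n).lintegral_map, smul_eq_mul]

lemma lintegral_pi_zero (F : (Fin 0 → α) → ℝ≥0∞) :
    ∫⁻ x, F x ∂Measure.pi (fun _ : Fin 0 => ν) = F Fin.elim0 := by
  rw [Measure.pi_of_empty, lintegral_dirac]
  exact congrArg F (Subsingleton.elim _ _)

lemma lintegral_tup_eq_tnil {F : Tup α → ℝ≥0∞} (hF : ∀ l : Tup α, ms l ≠ 0 → F l = 0) :
    ∫⁻ l, F l ∂tupMeas ν = F tnil := by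
  rw [lintegral_tup, tsum_eq_single 0]
  · rw [lintegral_pi_zero]
    simp [tnil]
  · intro n hn
    have : ∀ x : Fin n → α, F ⟨n, x⟩ = 0 := fun x => hF _ fun h => hn (by
      simpa using congrArg Multiset.card h)
    simp [this]

variable [SigmaFinite ν]

lemma lintegral_pi_succ {n : ℕ} {F : (Fin (n + 1) → α) → ℝ≥0∞} (hF : Measurable F) :
    ∫⁻ x, F x ∂Measure.pi (fun _ : Fin (n + 1) => ν)
      = ∫⁻ a, ∫⁻ y, F (Fin.cons a y) ∂Measure.pi (fun _ : Fin n => ν) ∂ν := by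
  have h := (measurePreserving_piFinSuccAbove (fun _ : Fin (n + 1) => ν) 0).symm
  rw [← h.lintegral_comp hF, lintegral_prod]
  · simp [MeasurableEquiv.piFinSuccAbove, Fin.insertNthEquiv]
  · exact (hF.comp (MeasurableEquiv.measurable _)).aemeasurable

lemma lintegral_pi_splitSum {K : Multiset α → Multiset α → ℝ≥0∞}
    (hK : Measurable fun p : Tup α × Tup α => K (ms p.1) (ms p.2)) (N : ℕ) :
    ∫⁻ x, splitSum K (ms ⟨N, x⟩) ∂Measure.pi (fun _ : Fin N => ν)
      = ∑ ij ∈ Finset.HasAntidiagonal.antidiagonal N, (N.choose ij.1) •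
          ∫⁻ x, ∫⁻ y, K (ms ⟨ij.1, x⟩) (ms ⟨ij.2, y⟩)
            ∂Measure.pi (fun _ : Fin ij.2 => ν) ∂Measure.pi (fun _ : Fin ij.1 => ν) := by
  induction N generalizing K with
  | zero => simp [ms_mk_zero]
  | succ N ih =>
    have hc : ∀ (n : ℕ) (a : α) (y : Fin n → α),
        ms (⟨n + 1, Fin.cons a y⟩ : Tup α) = a ::ₘ ms ⟨n, y⟩ := fun n a y => ms_tcons a ⟨n, y⟩
    have hK1 : Measurable fun p : α × Tup α × Tup α => K (ms p.2.1) (p.1 ::ₘ ms p.2.2) := by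
      have := hK.comp ((by fun_prop : Measurable fun p : α × Tup α × Tup α => p.2.1).prodMk
        (measurable_tcons.comp (by fun_prop :
          Measurable fun p : α × Tup α × Tup α => (p.1, p.2.2))))
      simpa [Function.comp_def] using this
    have hK2 : Measurable fun p : α × Tup α × Tup α => K (p.1 ::ₘ ms p.2.1) (ms p.2.2) := by
      have := hK.comp ((measurable_tcons.comp (by fun_prop :
          Measurable fun p : α × Tup α × Tup α => (p.1, p.2.1))).prodMk
          (by fun_prop : Measurable fun p : α × Tup α × Tup α => p.2.2))
      simpa [Function.comp_def] using this
    have hmk : ∀ m n : ℕ, Measurable fun p : (α × (Fin m → α)) × (Fin n → α) =>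
        (p.1.1, (⟨m, p.1.2⟩ : Tup α), (⟨n, p.2⟩ : Tup α)) := fun m n =>
      (by fun_prop : Measurable fun p : (α × (Fin m → α)) × (Fin n → α) => p.1.1).prodMk
        (((measurable_sigmaMk m).comp (by fun_prop :
          Measurable fun p : (α × (Fin m → α)) × (Fin n → α) => p.1.2)).prodMk
        ((measurable_sigmaMk n).comp (by fun_prop :
          Measurable fun p : (α × (Fin m → α)) × (Fin n → α) => p.2)))
    have hS1 := (measurable_splitSum (T := α) (K := fun a t r => K t (a ::ₘ r)) hK1)
    have hS2 := (measurable_splitSum (T := α) (K := fun a t r => K (a ::ₘ t) r) hK2)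
    have hmk1 : Measurable fun p : α × (Fin N → α) => (p.1, (⟨N, p.2⟩ : Tup α)) :=
      measurable_fst.prodMk ((measurable_sigmaMk N).comp measurable_snd)
    rw [lintegral_pi_succ ν (F := fun x => splitSum K (ms ⟨N + 1, x⟩))
      ((measurable_splitSum' hK).comp (measurable_sigmaMk (N + 1)))]
    simp only [hc, splitSum_cons]
    have e1 : ∀ a : α, ∫⁻ y, (splitSum (fun t r => K t (a ::ₘ r)) (ms ⟨N, y⟩)
        + splitSum (fun t r => K (a ::ₘ t) r) (ms ⟨N, y⟩)) ∂Measure.pi (fun _ : Fin N => ν)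
        = ∑ ij ∈ Finset.HasAntidiagonal.antidiagonal N, (N.choose ij.1) •
          ((∫⁻ x, ∫⁻ y, K (ms ⟨ij.1, x⟩) (a ::ₘ ms ⟨ij.2, y⟩)
            ∂Measure.pi (fun _ : Fin ij.2 => ν) ∂Measure.pi (fun _ : Fin ij.1 => ν))
          + ∫⁻ x, ∫⁻ y, K (a ::ₘ ms ⟨ij.1, x⟩) (ms ⟨ij.2, y⟩)
            ∂Measure.pi (fun _ : Fin ij.2 => ν) ∂Measure.pi (fun _ : Fin ij.1 => ν)) := by
      intro a
      rw [lintegral_add_left, ih, ih, ← Finset.sum_add_distrib]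
      · simp only [smul_add]
      · exact hK2.comp measurable_prodMk_left
      · exact hK1.comp measurable_prodMk_left
      · exact hS1.comp (hmk1.comp measurable_prodMk_left)
    simp only [e1]
    have hm1 : ∀ m n : ℕ, Measurable fun a : α =>
        ∫⁻ x, ∫⁻ y, K (ms ⟨m, x⟩) (a ::ₘ ms ⟨n, y⟩)
            ∂Measure.pi (fun _ : Fin n => ν) ∂Measure.pi (fun _ : Fin m => ν) := fun m n =>
      ((hK1.comp (hmk m n)).lintegral_prod_right').lintegral_prod_right'
    have hm2 : ∀ m n : ℕ, Measurable fun a : α =>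
        ∫⁻ x, ∫⁻ y, K (a ::ₘ ms ⟨m, x⟩) (ms ⟨n, y⟩)
            ∂Measure.pi (fun _ : Fin n => ν) ∂Measure.pi (fun _ : Fin m => ν) := fun m n =>
      ((hK2.comp (hmk m n)).lintegral_prod_right').lintegral_prod_right'
    have hm4 : ∀ m n : ℕ, Measurable fun a : α =>
        (∫⁻ x, ∫⁻ y, K (ms ⟨m, x⟩) (a ::ₘ ms ⟨n, y⟩)
            ∂Measure.pi (fun _ : Fin n => ν) ∂Measure.pi (fun _ : Fin m => ν))
          + ∫⁻ x, ∫⁻ y, K (a ::ₘ ms ⟨m, x⟩) (ms ⟨n, y⟩)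
            ∂Measure.pi (fun _ : Fin n => ν) ∂Measure.pi (fun _ : Fin m => ν) :=
      fun m n => (hm1 m n).add (hm2 m n)
    have hm3 : ∀ c m n : ℕ, Measurable fun a : α => c •
        ((∫⁻ x, ∫⁻ y, K (ms ⟨m, x⟩) (a ::ₘ ms ⟨n, y⟩)
            ∂Measure.pi (fun _ : Fin n => ν) ∂Measure.pi (fun _ : Fin m => ν))
          + ∫⁻ x, ∫⁻ y, K (a ::ₘ ms ⟨m, x⟩) (ms ⟨n, y⟩)
            ∂Measure.pi (fun _ : Fin n => ν) ∂Measure.pi (fun _ : Fin m => ν)) :=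
      fun c m n => (hm4 m n).const_smul c
    rw [lintegral_finsetSum _ fun ij _ => hm3 _ _ _]
    rw [Finset.sum_antidiagonal_choose_succ_nsmul (fun m n => ∫⁻ x, ∫⁻ y,
      K (ms ⟨m, x⟩) (ms ⟨n, y⟩) ∂Measure.pi (fun _ : Fin n => ν) ∂Measure.pi (fun _ : Fin m => ν)),
      ← Finset.sum_add_distrib]
    refine Finset.sum_congr rfl fun ij hij => ?_
    rw [Finset.HasAntidiagonal.mem_antidiagonal] at hij
    have hch : N.choose ij.2 = N.choose ij.1 := by
      rw [← hij, Nat.choose_symm_add]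
    rw [hch, ← smul_add]
    simp only [nsmul_eq_mul]
    rw [lintegral_const_mul _ (hm4 _ _), lintegral_add_left (hm1 _ _)]
    congr 2
    · have hsw : ∀ x : Fin ij.1 → α,
          ∫⁻ y, K (ms ⟨ij.1, x⟩) (ms ⟨ij.2 + 1, y⟩) ∂Measure.pi (fun _ : Fin (ij.2 + 1) => ν)
            = ∫⁻ a, ∫⁻ y, K (ms ⟨ij.1, x⟩) (a ::ₘ ms ⟨ij.2, y⟩)
              ∂Measure.pi (fun _ : Fin ij.2 => ν) ∂ν := by
        intro x
        rw [lintegral_pi_succ ν (F := fun y => K (ms ⟨ij.1, x⟩) (ms ⟨ij.2 + 1, y⟩))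
          ((hK.comp measurable_prodMk_left).comp (measurable_sigmaMk _))]
        simp [hc]
      simp only [hsw]
      exact lintegral_lintegral_swap
        ((hK1.comp (hmk ij.1 ij.2)).lintegral_prod_right').aemeasurable
    · have hmeas : Measurable fun x : Fin (ij.1 + 1) → α =>
          ∫⁻ y, K (ms ⟨ij.1 + 1, x⟩) (ms ⟨ij.2, y⟩) ∂Measure.pi (fun _ : Fin ij.2 => ν) := by
        refine Measurable.lintegral_prod_right'
          (f := fun p : (Fin (ij.1 + 1) → α) × (Fin ij.2 → α) =>
            K (ms ⟨ij.1 + 1, p.1⟩) (ms ⟨ij.2, p.2⟩)) ?_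
        exact hK.comp (((measurable_sigmaMk _).comp measurable_fst).prodMk
          ((measurable_sigmaMk _).comp measurable_snd))
      rw [lintegral_pi_succ ν hmeas]
      simp [hc]

/-- Minlos' formula for nonnegative functions. -/
lemma lintegral_splitSum {K : Multiset α → Multiset α → ℝ≥0∞}
    (hK : Measurable fun p : Tup α × Tup α => K (ms p.1) (ms p.2)) :
    ∫⁻ l, splitSum K (ms l) ∂tupMeas ν
      = ∫⁻ l, ∫⁻ l', K (ms l) (ms l') ∂tupMeas ν ∂tupMeas ν := by
  have h1 : ∫⁻ l, ∫⁻ l', K (ms l) (ms l') ∂tupMeas ν ∂tupMeas ν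
      = ∑' m : ℕ, ∑' n : ℕ, ((m.factorial : ℝ≥0∞)⁻¹ * (n.factorial : ℝ≥0∞)⁻¹) *
        ∫⁻ x, ∫⁻ y, K (ms ⟨m, x⟩) (ms ⟨n, y⟩)
          ∂Measure.pi (fun _ : Fin n => ν) ∂Measure.pi (fun _ : Fin m => ν) := by
    rw [lintegral_tup]
    refine tsum_congr fun m => ?_
    simp only [lintegral_tup]
    have hmm : ∀ n : ℕ, Measurable fun x : Fin m → α =>
        ∫⁻ y, K (ms ⟨m, x⟩) (ms ⟨n, y⟩) ∂Measure.pi (fun _ : Fin n => ν) := by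
      intro n
      refine Measurable.lintegral_prod_right'
          (f := fun p : (Fin m → α) × (Fin n → α) => K (ms ⟨m, p.1⟩) (ms ⟨n, p.2⟩)) ?_
      exact hK.comp (((measurable_sigmaMk _).comp measurable_fst).prodMk
          ((measurable_sigmaMk _).comp measurable_snd))
    rw [lintegral_tsum fun n => ((hmm n).const_mul _).aemeasurable, ← ENNReal.tsum_mul_left]
    refine tsum_congr fun n => ?_
    rw [lintegral_const_mul _ (hmm n), mul_assoc]
  rw [h1, lintegral_tup, ← ENNReal.tsum_prod, ← Finset.HasAntidiagonal.sigmaAntidiagonalEquivProd.tsum_eq,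
    ENNReal.tsum_sigma']
  refine tsum_congr fun N => ?_
  rw [lintegral_pi_splitSum ν hK, Finset.mul_sum]
  refine Eq.trans ?_ (Finset.tsum_subtype (Finset.HasAntidiagonal.antidiagonal N)
    (fun p : ℕ × ℕ => ((p.1.factorial : ℝ≥0∞)⁻¹ * (p.2.factorial : ℝ≥0∞)⁻¹) *
        ∫⁻ x, ∫⁻ y, K (ms ⟨p.1, x⟩) (ms ⟨p.2, y⟩)
          ∂Measure.pi (fun _ : Fin p.2 => ν) ∂Measure.pi (fun _ : Fin p.1 => ν))).symm
  refine Finset.sum_congr rfl fun ij hij => ?_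
  rw [Finset.HasAntidiagonal.mem_antidiagonal] at hij
  rw [nsmul_eq_mul, ← mul_assoc]
  congr 1
  have hf : ∀ n : ℕ, (n.factorial : ℝ≥0∞) ≠ 0 := fun n => by
    exact_mod_cast n.factorial_ne_zero
  have ht : ∀ n : ℕ, (n.factorial : ℝ≥0∞) ≠ ⊤ := fun n => ENNReal.natCast_ne_top _
  have h2 : ((N.choose ij.1 * ij.1.factorial * ij.2.factorial : ℕ) : ℝ≥0∞) = N.factorial := by
    rw [← Nat.choose_mul_factorial_mul_factorial (show ij.1 ≤ N by omega),
      show N - ij.1 = ij.2 by omega]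
  push_cast at h2
  rw [← ENNReal.mul_inv (Or.inl (hf _)) (Or.inl (ht _)), ← h2, mul_assoc]
  have hch : ((N.choose ij.1 : ℕ) : ℝ≥0∞) ≠ 0 := by
    have : 0 < N.choose ij.1 := Nat.choose_pos (by omega)
    exact_mod_cast this.ne'
  rw [ENNReal.mul_inv (Or.inl hch) (Or.inl (ENNReal.natCast_ne_top _)), mul_comm, ← mul_assoc,
    ENNReal.mul_inv_cancel hch (ENNReal.natCast_ne_top _), one_mul]

lemma lintegral_tup_prod {w : α → ℝ≥0∞} (hw : Measurable w) :
    ∫⁻ l, ((ms l).map w).prod ∂tupMeas ν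
      = ∑' n : ℕ, (n.factorial : ℝ≥0∞)⁻¹ * (∫⁻ a, w a ∂ν) ^ n := by
  rw [lintegral_tup]
  refine tsum_congr fun n => ?_
  congr 1
  induction n with
  | zero => simp [ms_mk_zero]
  | succ n ih =>
    rw [lintegral_pi_succ ν (F := fun x => ((ms ⟨n + 1, x⟩).map w).prod)
      ((measurable_map_prod_ennreal' hw).comp (measurable_sigmaMk _))]
    have hc : ∀ (a : α) (y : Fin n → α),
        ms (⟨n + 1, Fin.cons a y⟩ : Tup α) = a ::ₘ ms ⟨n, y⟩ := fun a y => ms_tcons a ⟨n, y⟩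
    simp only [hc, Multiset.map_cons, Multiset.prod_cons]
    have : ∀ a, ∫⁻ y, w a * ((ms ⟨n, y⟩).map w).prod ∂Measure.pi (fun _ : Fin n => ν)
        = w a * (∫⁻ a, w a ∂ν) ^ n := by
      intro a
      have hm : Measurable fun y : Fin n → α => ((ms ⟨n, y⟩).map w).prod :=
        (measurable_map_prod_ennreal' hw).comp (measurable_sigmaMk _)
      rw [lintegral_const_mul _ hm, ih]
    simp only [this]
    rw [lintegral_mul_const _ hw, pow_succ']

lemma lintegral_tup_prod_le {w : α → ℝ≥0∞} (hw : Measurable w) {c : ℝ} (hc0 : 0 ≤ c)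
    (hc : ∫⁻ a, w a ∂ν ≤ ENNReal.ofReal c) :
    ∫⁻ l, ((ms l).map w).prod ∂tupMeas ν ≤ ENNReal.ofReal (Real.exp c) := by
  rw [lintegral_tup_prod ν hw, Real.exp_eq_exp_ℝ, NormedSpace.exp_eq_tsum_div]
  dsimp only
  rw [ENNReal.ofReal_tsum_of_nonneg (fun n => by positivity) (Real.summable_pow_div_factorial c)]
  refine ENNReal.tsum_le_tsum fun n => ?_
  rw [div_eq_inv_mul, ENNReal.ofReal_mul (by positivity), ENNReal.ofReal_inv_of_pos (by positivity),
    ENNReal.ofReal_natCast, ENNReal.ofReal_pow hc0]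
  gcongr

/-- Minlos' formula for integrable functions. -/
lemma integrable_splitSum {K : Multiset α → Multiset α → ℝ}
    (hK : Measurable fun p : Tup α × Tup α => K (ms p.1) (ms p.2))
    (hi : ∫⁻ l, ∫⁻ l', ENNReal.ofReal |K (ms l) (ms l')| ∂tupMeas ν ∂tupMeas ν < ⊤) :
    Integrable (fun p : Tup α × Tup α => K (ms p.1) (ms p.2)) ((tupMeas ν).prod (tupMeas ν)) ∧
    Integrable (fun l => splitSum K (ms l)) (tupMeas ν) ∧
    ∫ l, splitSum K (ms l) ∂tupMeas ν
      = ∫ p : Tup α × Tup α, K (ms p.1) (ms p.2) ∂((tupMeas ν).prod (tupMeas ν)) := by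
  have hof : ∀ K' : Multiset α → Multiset α → ℝ, (∀ t r, 0 ≤ K' t r) → ∀ s,
      ENNReal.ofReal (splitSum K' s) = splitSum (fun t r => ENNReal.ofReal (K' t r)) s := by
    intro K' hK' s
    induction s using Multiset.induction generalizing K' with
    | empty => simp
    | cons a s ih =>
      have hnn : ∀ K'' : Multiset α → Multiset α → ℝ, (∀ t r, 0 ≤ K'' t r) →
          0 ≤ splitSum K'' s := by
        intro K'' h
        refine Multiset.sum_nonneg fun x hx => ?_
        obtain ⟨p, _, rfl⟩ := Multiset.mem_map.1 hx
        exact h _ _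
      rw [splitSum_cons, splitSum_cons, ENNReal.ofReal_add (hnn _ fun _ _ => hK' _ _)
        (hnn _ fun _ _ => hK' _ _), ih _ fun _ _ => hK' _ _, ih _ fun _ _ => hK' _ _]
  have key : ∀ K' : Multiset α → Multiset α → ℝ, (∀ t r, 0 ≤ K' t r) →
      (Measurable fun p : Tup α × Tup α => K' (ms p.1) (ms p.2)) →
      (∀ t r, K' t r ≤ |K t r|) →
      Integrable (fun p : Tup α × Tup α => K' (ms p.1) (ms p.2))
        ((tupMeas ν).prod (tupMeas ν)) ∧
      Integrable (fun l => splitSum K' (ms l)) (tupMeas ν) ∧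
      ∫ l, splitSum K' (ms l) ∂tupMeas ν
        = ∫ p : Tup α × Tup α, K' (ms p.1) (ms p.2) ∂((tupMeas ν).prod (tupMeas ν)) := by
    intro K' h0 hm hle
    have hm' : Measurable fun p : Tup α × Tup α => ENNReal.ofReal (K' (ms p.1) (ms p.2)) :=
      hm.ennreal_ofReal
    have hfin : ∫⁻ p : Tup α × Tup α, ENNReal.ofReal (K' (ms p.1) (ms p.2))
        ∂((tupMeas ν).prod (tupMeas ν)) < ⊤ := by
      rw [lintegral_prod _ hm'.aemeasurable]
      refine lt_of_le_of_lt ?_ hi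
      exact lintegral_mono fun l => lintegral_mono fun l' => ENNReal.ofReal_le_ofReal (hle _ _)
    have hsp : ∫⁻ l, ENNReal.ofReal (splitSum K' (ms l)) ∂tupMeas ν
        = ∫⁻ p : Tup α × Tup α, ENNReal.ofReal (K' (ms p.1) (ms p.2))
        ∂((tupMeas ν).prod (tupMeas ν)) := by
      simp only [hof K' h0]
      rw [lintegral_splitSum ν (K := fun t r => ENNReal.ofReal (K' t r)) hm',
        lintegral_prod _ hm'.aemeasurable]
    have hs0 : ∀ s, 0 ≤ splitSum K' s := fun s => by
      refine Multiset.sum_nonneg fun x hx => ?_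
      obtain ⟨p, _, rfl⟩ := Multiset.mem_map.1 hx
      exact h0 _ _
    have hsm := measurable_splitSum' hm
    refine ⟨⟨hm.aestronglyMeasurable, ?_⟩, ⟨hsm.aestronglyMeasurable, ?_⟩, ?_⟩
    · rw [hasFiniteIntegral_iff_ofReal (Filter.Eventually.of_forall fun p => h0 _ _)]
      exact hfin
    · rw [hasFiniteIntegral_iff_ofReal (Filter.Eventually.of_forall fun p => hs0 _), hsp]
      exact hfin
    · rw [integral_eq_lintegral_of_nonneg_ae (Filter.Eventually.of_forall fun p => hs0 _)
        hsm.aestronglyMeasurable, hsp, integral_eq_lintegral_of_nonneg_ae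
        (Filter.Eventually.of_forall fun p => h0 _ _) hm.aestronglyMeasurable]
  obtain ⟨p1, p2, p3⟩ := key (fun t r => max (K t r) 0) (fun _ _ => le_max_right _ _)
    (hK.max measurable_const) (fun _ _ => max_le (le_abs_self _) (abs_nonneg _))
  obtain ⟨n1, n2, n3⟩ := key (fun t r => max (-K t r) 0) (fun _ _ => le_max_right _ _)
    (hK.neg.max measurable_const) (fun _ _ => max_le (neg_le_abs _) (abs_nonneg _))
  have hd : ∀ x : ℝ, x = max x 0 - max (-x) 0 := fun x => by
    rcases le_total 0 x with h | h
    · rw [max_eq_left h, max_eq_right (by linarith), sub_zero]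
    · rw [max_eq_right h, max_eq_left (by linarith), zero_sub, neg_neg]
  have e1 : (fun p : Tup α × Tup α => K (ms p.1) (ms p.2)) = fun p : Tup α × Tup α =>
      max (K (ms p.1) (ms p.2)) 0 - max (-K (ms p.1) (ms p.2)) 0 := by
    funext p
    exact hd _
  have e2 : (fun l => splitSum K (ms l)) = fun l : Tup α =>
      splitSum (fun t r => max (K t r) 0) (ms l)
        - splitSum (fun t r => max (-K t r) 0) (ms l) := by
    funext l
    rw [← splitSum_sub]
    exact splitSum_congr (R := ℝ) fun t r _ => hd _
  rw [e1, e2]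
  refine ⟨p1.sub n1, p2.sub n2, ?_⟩
  rw [integral_sub p2 n2, integral_sub p1 n1, p3, n3]

lemma measurePreserving_tmap {τ : α → α} (hτ : MeasurePreserving τ ν ν) :
    MeasurePreserving (tmap τ) (tupMeas ν) (tupMeas ν) := by
  refine ⟨measurable_tmap hτ.measurable, ?_⟩
  refine Measure.ext_of_lintegral _ fun F hF => ?_
  rw [lintegral_map hF (measurable_tmap hτ.measurable), lintegral_tup, lintegral_tup]
  refine tsum_congr fun n => ?_
  congr 1
  have h := measurePreserving_pi (fun _ : Fin n => ν) (fun _ : Fin n => ν) fun _ => hτ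
  exact h.lintegral_comp (f := fun x => F ⟨n, x⟩) (hF.comp (measurable_sigmaMk n))

end LebesguePoisson

end Ruelle

/-! ### Pair interactions -/

namespace Ruelle

section

variable {α : Type}

lemma ofReal_abs_splitSum_le (K : Multiset α → Multiset α → ℝ) (s : Multiset α) :
    ENNReal.ofReal |splitSum K s| ≤ splitSum (fun t r => ENNReal.ofReal |K t r|) s := by
  induction s using Multiset.induction generalizing K with
  | empty => simp
  | cons a s ih =>
    rw [splitSum_cons, splitSum_cons]
    refine (ENNReal.ofReal_le_ofReal (abs_add_le _ _)).trans ?_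
    rw [ENNReal.ofReal_add (abs_nonneg _) (abs_nonneg _)]
    exact add_le_add (ih _) (ih _)

lemma splitSum_const_mul_ennreal (c : ℝ≥0∞) (K : Multiset α → Multiset α → ℝ≥0∞)
    (s : Multiset α) : splitSum (fun t r => c * K t r) s = c * splitSum K s := by
  simp [splitSum, Multiset.sum_map_mul_left]

lemma splitSum_mono {K K' : Multiset α → Multiset α → ℝ≥0∞} {s : Multiset α}
    (h : ∀ t r, t + r = s → K t r ≤ K' t r) : splitSum K s ≤ splitSum K' s :=
  Multiset.sum_map_le_sum_map _ _ fun _p hp => h _ _ (Multiset.mem_antidiagonal.1 hp)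

lemma ofReal_abs_map_prod (f : α → ℝ) (s : Multiset α) :
    ENNReal.ofReal |(s.map f).prod| = (s.map fun y => ENNReal.ofReal |f y|).prod := by
  induction s using Multiset.induction with
  | empty => simp
  | cons a s ih =>
    simp only [Multiset.map_cons, Multiset.prod_cons, abs_mul]
    rw [ENNReal.ofReal_mul (abs_nonneg _), ih]

lemma pow_card_mul_map_prod (c : ℝ≥0∞) (f : α → ℝ≥0∞) (s : Multiset α) :
    c ^ s.card * (s.map f).prod = (s.map fun y => c * f y).prod := by
  rw [Multiset.prod_map_mul]
  simp

lemma exists_ms_eq (Y : Multiset α) : ∃ l : Tup α, ms l = Y := by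
  induction Y using Multiset.induction with
  | empty => exact ⟨tnil, ms_tnil⟩
  | cons a Y ih =>
    obtain ⟨l, rfl⟩ := ih
    exact ⟨tcons a l, ms_tcons a l⟩

end

/-- A symmetric hard-core-at-coincidence pair interaction with Boltzmann factor `g`, activity `z`,
one-step stability constant `b`, in the high temperature regime. -/
structure Interaction (α : Type) [MeasurableSpace α] where
  ν : Measure α
  sf : SigmaFinite ν
  g : α → α → ℝ
  z : ℝ
  b : ℝ
  meas : Measurable fun p : α × α => g p.1 p.2
  symm : ∀ x y, g x y = g y x
  nonneg : ∀ x y, 0 ≤ g x y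
  diag : ∀ x, g x x = 0
  z_pos : 0 < z
  b_pos : 0 < b
  good : ∀ X : Multiset α, X ≠ 0 → ∃ x X', X = x ::ₘ X' ∧ (X'.map (g x)).prod ≤ b
  reg : ∀ x, ∫⁻ y, ENNReal.ofReal |g x y - 1| ∂ν ≤ ENNReal.ofReal (2 * (z * b * Real.exp 1))⁻¹

namespace Interaction

variable {α : Type} [MeasurableSpace α] (I : Interaction α)

instance : SigmaFinite I.ν := I.sf

/-- The constant in the Ruelle bound. -/
def ξ : ℝ := I.z * I.b * Real.exp 1

lemma ξ_pos : 0 < I.ξ := mul_pos (mul_pos I.z_pos I.b_pos) (Real.exp_pos 1)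

/-- The Boltzmann weight of a finite configuration. -/
def ψ (s : Multiset α) : ℝ :=
  Multiset.recOn s 1 (fun x t r => I.z * (t.map (I.g x)).prod * r) (by
    intro a a' m r
    refine heq_of_eq ?_
    simp only [Multiset.map_cons, Multiset.prod_cons]
    rw [I.symm a a']
    ring)

@[simp] lemma ψ_zero : I.ψ 0 = 1 := by simp [ψ]

lemma ψ_cons (x : α) (s : Multiset α) :
    I.ψ (x ::ₘ s) = I.z * (s.map (I.g x)).prod * I.ψ s := by
  simp [ψ]

lemma prod_g_nonneg (x : α) (s : Multiset α) : 0 ≤ (s.map (I.g x)).prod := by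
  refine Multiset.prod_nonneg fun y hy => ?_
  obtain ⟨w, _, rfl⟩ := Multiset.mem_map.1 hy
  exact I.nonneg _ _

lemma ψ_nonneg (s : Multiset α) : 0 ≤ I.ψ s := by
  induction s using Multiset.induction with
  | empty => simp
  | cons x s ih =>
    rw [ψ_cons]
    exact mul_nonneg (mul_nonneg I.z_pos.le (I.prod_g_nonneg x s)) ih

lemma ψ_le (s : Multiset α) : I.ψ s ≤ (I.z * I.b) ^ s.card := by
  induction hn : s.card generalizing s with
  | zero => simp [Multiset.card_eq_zero.1 hn]
  | succ n ih =>
    obtain ⟨x, X', rfl, hb⟩ := I.good s (by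
      rintro rfl
      simp at hn)
    rw [ψ_cons, pow_succ']
    have h1 : X'.card = n := by simpa using hn
    exact mul_le_mul (mul_le_mul_of_nonneg_left hb I.z_pos.le) (ih X' h1) (I.ψ_nonneg _)
      (mul_pos I.z_pos I.b_pos).le

lemma g_le (x y : α) : I.g x y ≤ I.b := by
  obtain ⟨x', X', h, hb⟩ := I.good (x ::ₘ {y}) (by simp)
  have hx : x' = x ∧ X' = {y} ∨ x' = y ∧ X' = {x} := by
    rcases Multiset.cons_eq_cons.1 h with ⟨h1, h2⟩ | ⟨_, cs, h2, h3⟩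
    · exact Or.inl ⟨h1.symm, h2.symm⟩
    · right
      have := Multiset.singleton_eq_cons_iff _ |>.1 h2
      refine ⟨this.1.symm, ?_⟩
      rw [h3, this.2]
      rfl
  rcases hx with ⟨rfl, rfl⟩ | ⟨rfl, rfl⟩
  · simpa using hb
  · rw [I.symm]
    simpa using hb

lemma ψ_eq_zero {s : Multiset α} (h : ¬ s.Nodup) : I.ψ s = 0 := by
  rw [Multiset.nodup_iff_le] at h
  push Not at h
  obtain ⟨a, ha⟩ := h
  obtain ⟨t, rfl⟩ := Multiset.le_iff_exists_add.1 ha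
  simp [ψ_cons, I.diag]

lemma measurable_ψ : Measurable fun l : Tup α => I.ψ (ms l) := by
  refine measurable_tup fun n => ?_
  induction n with
  | zero => simp [ms_mk_zero]
  | succ n ih =>
    simp only [ms_mk_succ, ψ_cons]
    have htail : Measurable fun x : Fin (n + 1) → α => (x 0, Fin.tail x) :=
      (measurable_pi_apply 0).prodMk
        (measurable_pi_lambda _ fun i => measurable_pi_apply i.succ)
    have h1 := (measurable_map_prod I.meas).comp
      ((measurable_fst.prodMk ((measurable_sigmaMk n).comp measurable_snd)).comp htail)
    exact (h1.const_mul _).mul (ih.comp (measurable_snd.comp htail))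

/-- Kirkwood–Salsburg recursion for the relative functions. -/
lemma relFn_ψ_cons (x : α) (X w : Multiset α) :
    relFn I.ψ (x ::ₘ X) w = I.z * (X.map (I.g x)).prod *
      splitSum (fun t r => (t.map fun y => I.g x y - 1).prod * relFn I.ψ (X + t) r) w := by
  refine relFn_cons (fun w => ?_) w
  rw [Multiset.cons_add, ψ_cons, Multiset.map_add, Multiset.prod_add]
  simp only [sub_add_cancel]
  ring

lemma measurable_relFn_ψ : Measurable fun p : Tup α × Tup α => relFn I.ψ (ms p.1) (ms p.2) :=
  measurable_relFn I.measurable_ψ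

lemma measurable_f (x : α) : Measurable fun y => I.g x y - 1 :=
  (I.meas.comp measurable_prodMk_left).sub measurable_const

lemma lintegral_trunc_relFn_le (M : ℕ) (X : Multiset α) :
    ∫⁻ l, (if l.1 ≤ M then 2 ^ l.1 * ENNReal.ofReal |relFn I.ψ X (ms l)| else 0)
      ∂tupMeas I.ν ≤ ENNReal.ofReal I.ξ ^ X.card := by
  induction hN : X.card + M using Nat.strong_induction_on generalizing M X with
  | _ N ih =>
  by_cases hX : X = 0
  · subst hX
    rw [lintegral_tup_eq_tnil]
    · simp [relFn_zero, convOne, show (tnil : Tup α).1 = 0 from rfl]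
    · intro l hl
      simp [relFn_zero, convOne, hl]
  obtain ⟨x, X', rfl, hb⟩ := I.good X hX
  obtain ⟨lX, rfl⟩ := exists_ms_eq X'
  set F : Multiset α → Multiset α → ℝ≥0∞ := fun t r =>
    (t.map fun y => 2 * ENNReal.ofReal |I.g x y - 1|).prod *
      (if t.card + r.card ≤ M then 2 ^ r.card * ENNReal.ofReal |relFn I.ψ (ms lX + t) r| else 0)
    with hF
  have hrel : Measurable fun p : Tup α × Tup α => relFn I.ψ (ms lX + ms p.1) (ms p.2) := by
    have := I.measurable_relFn_ψ.comp ((measurable_tapp.comp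
      ((measurable_const (a := lX)).prodMk measurable_fst)).prodMk measurable_snd :
        Measurable fun p : Tup α × Tup α => (tapp lX p.1, p.2))
    simpa [Function.comp_def] using this
  have hFm : Measurable fun p : Tup α × Tup α => F (ms p.1) (ms p.2) := by
    refine ((measurable_map_prod_ennreal' ?_).comp measurable_fst).mul ?_
    · exact ((I.measurable_f x).abs.ennreal_ofReal).const_mul _
    · simp only [card_ms]
      refine Measurable.ite ?_ (Measurable.mul ?_ hrel.abs.ennreal_ofReal) measurable_const
      · exact measurableSet_le ((measurable_tup_fst.comp measurable_fst).add
          (measurable_tup_fst.comp measurable_snd)) measurable_const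
      · exact (measurable_from_top (f := fun n : ℕ => (2 : ℝ≥0∞) ^ n)).comp
          (measurable_tup_fst.comp measurable_snd)
  have hle : ∀ l : Tup α,
      (if l.1 ≤ M then 2 ^ l.1 * ENNReal.ofReal |relFn I.ψ (x ::ₘ ms lX) (ms l)| else 0)
        ≤ ENNReal.ofReal (I.z * I.b) * splitSum F (ms l) := by
    intro l
    split_ifs with hl
    swap
    · exact bot_le
    rw [relFn_ψ_cons, abs_mul, ENNReal.ofReal_mul (abs_nonneg _), mul_left_comm]
    refine mul_le_mul' (ENNReal.ofReal_le_ofReal ?_) ?_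
    · rw [abs_of_nonneg (mul_nonneg I.z_pos.le (I.prod_g_nonneg _ _))]
      exact mul_le_mul_of_nonneg_left hb I.z_pos.le
    · refine (mul_le_mul' le_rfl (ofReal_abs_splitSum_le _ _)).trans ?_
      rw [← splitSum_const_mul_ennreal]
      refine splitSum_mono fun t r htr => ?_
      have hc : t.card + r.card = l.1 := by
        rw [← Multiset.card_add, htr, card_ms]
      rw [hF]
      dsimp only
      rw [hc, if_pos hl, ← hc, pow_add, abs_mul, ENNReal.ofReal_mul (abs_nonneg _),
        ofReal_abs_map_prod, ← pow_card_mul_map_prod]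
      exact le_of_eq (by ring)
  refine (lintegral_mono hle).trans ?_
  rw [lintegral_const_mul _ (measurable_splitSum' hFm), lintegral_splitSum I.ν hFm]
  have hin : ∀ t : Tup α, ∫⁻ r, F (ms t) (ms r) ∂tupMeas I.ν
      ≤ ENNReal.ofReal I.ξ ^ lX.1 *
        ((ms t).map fun y => ENNReal.ofReal I.ξ * (2 * ENNReal.ofReal |I.g x y - 1|)).prod := by
    intro t
    rw [hF]
    dsimp only
    have hmr : Measurable fun r : Tup α => (if (ms t).card + (ms r).card ≤ M then
        2 ^ (ms r).card * ENNReal.ofReal |relFn I.ψ (ms lX + ms t) (ms r)| else 0) := by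
      simp only [card_ms]
      refine Measurable.ite ?_ (Measurable.mul ?_
        (hrel.comp measurable_prodMk_left).abs.ennreal_ofReal) measurable_const
      · exact measurableSet_le (measurable_const.add measurable_tup_fst) measurable_const
      · exact (measurable_from_top (f := fun n : ℕ => (2 : ℝ≥0∞) ^ n)).comp measurable_tup_fst
    rw [lintegral_const_mul _ hmr, ← pow_card_mul_map_prod (ENNReal.ofReal I.ξ), ← mul_assoc,
      mul_comm]
    refine mul_le_mul' ?_ le_rfl
    rw [card_ms, ← pow_add]
    by_cases ht : t.1 ≤ M
    · have := ih ((ms lX + ms t).card + (M - t.1)) (by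
        simp only [Multiset.card_add, Multiset.card_cons, card_ms] at hN ⊢
        omega) (M - t.1) (ms lX + ms t) rfl
      simp only [Multiset.card_add, card_ms] at this ⊢
      refine le_trans (le_of_eq (lintegral_congr fun r => ?_)) this
      congr 1
      exact propext ⟨fun h => by omega, fun h => by omega⟩
    · have : ∀ r : Tup α, ¬ t.1 + r.1 ≤ M := fun r => by omega
      simp [this]
  refine (mul_le_mul' le_rfl (lintegral_mono hin)).trans ?_
  have hwm : Measurable fun y => ENNReal.ofReal I.ξ * (2 * ENNReal.ofReal |I.g x y - 1|) :=
    (((I.measurable_f x).abs.ennreal_ofReal).const_mul _).const_mul _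
  rw [lintegral_const_mul _ (measurable_map_prod_ennreal' hwm)]
  have hexp := lintegral_tup_prod_le I.ν hwm (c := 1) zero_le_one (by
    rw [lintegral_const_mul _ (((I.measurable_f x).abs.ennreal_ofReal).const_mul _),
      lintegral_const_mul _ ((I.measurable_f x).abs.ennreal_ofReal)]
    refine (mul_le_mul' le_rfl (mul_le_mul' le_rfl (I.reg x))).trans ?_
    rw [show (2 : ℝ≥0∞) = ENNReal.ofReal 2 by simp, ← ENNReal.ofReal_mul (by norm_num),
      ← ENNReal.ofReal_mul I.ξ_pos.le]
    refine ENNReal.ofReal_le_ofReal (le_of_eq ?_)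
    have := I.ξ_pos.ne'
    rw [show I.z * I.b * Real.exp 1 = I.ξ from rfl]
    field_simp)
  refine (mul_le_mul' le_rfl (mul_le_mul' le_rfl hexp)).trans (le_of_eq ?_)
  rw [Multiset.card_cons, card_ms, pow_succ, mul_left_comm,
    ← ENNReal.ofReal_mul (mul_pos I.z_pos I.b_pos).le]
  rfl

/-- The weighted `L¹` bound on the relative functions. -/
lemma lintegral_relFn_le (X : Multiset α) :
    ∫⁻ l, 2 ^ l.1 * ENNReal.ofReal |relFn I.ψ X (ms l)| ∂tupMeas I.ν
      ≤ ENNReal.ofReal I.ξ ^ X.card := by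
  have hm : ∀ M : ℕ, Measurable fun l : Tup α =>
      (if l.1 ≤ M then 2 ^ l.1 * ENNReal.ofReal |relFn I.ψ X (ms l)| else 0) := by
    intro M
    obtain ⟨lX, rfl⟩ := exists_ms_eq X
    refine Measurable.ite ?_ (Measurable.mul ?_
      (I.measurable_relFn_ψ.comp (measurable_prodMk_left (x := lX))).abs.ennreal_ofReal)
      measurable_const
    · exact measurableSet_le measurable_tup_fst measurable_const
    · exact (measurable_from_top (f := fun n : ℕ => (2 : ℝ≥0∞) ^ n)).comp measurable_tup_fst
  have hsup : ∀ l : Tup α, 2 ^ l.1 * ENNReal.ofReal |relFn I.ψ X (ms l)|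
      = ⨆ M : ℕ, (if l.1 ≤ M then 2 ^ l.1 * ENNReal.ofReal |relFn I.ψ X (ms l)| else 0) := by
    intro l
    refine le_antisymm (le_iSup_of_le l.1 (by simp)) (iSup_le fun M => ?_)
    split_ifs
    · exact le_rfl
    · exact bot_le
  rw [lintegral_congr hsup, lintegral_iSup hm]
  · exact iSup_le fun M => I.lintegral_trunc_relFn_le M X
  · intro M M' h l
    dsimp only
    split_ifs with h1 h2
    · exact le_rfl
    · omega
    · exact bot_le
    · exact le_rfl

end Interaction

end Ruelle

/-! ### Correlation functions -/

namespace Ruelle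

section

variable {α : Type}

/-- The indicator that all points of a multiset lie in `A`. -/
def ind (A : Set α) (s : Multiset α) : ℝ := (s.map (A.indicator 1)).prod

@[simp] lemma ind_zero (A : Set α) : ind A 0 = 1 := by simp [ind]

lemma ind_add (A : Set α) (s t : Multiset α) : ind A (s + t) = ind A s * ind A t := by
  simp [ind]

lemma ind_cons (A : Set α) (x : α) (s : Multiset α) :
    ind A (x ::ₘ s) = A.indicator 1 x * ind A s := by
  simp [ind]

lemma ind_eq (A : Set α) (s : Multiset α) : ind A s = if ∀ x ∈ s, x ∈ A then 1 else 0 := by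
  induction s using Multiset.induction with
  | empty => simp
  | cons x s ih =>
    rw [ind_cons, ih]
    by_cases hx : x ∈ A <;> simp [hx]

lemma ind_nonneg (A : Set α) (s : Multiset α) : 0 ≤ ind A s := by
  rw [ind_eq]
  split_ifs <;> norm_num

lemma ind_le_one (A : Set α) (s : Multiset α) : ind A s ≤ 1 := by
  rw [ind_eq]
  split_ifs <;> norm_num

@[simp] lemma ind_univ (s : Multiset α) : ind univ s = 1 := by simp [ind_eq]

lemma mul_splitSum_of_mul (w : Multiset α → ℝ) (hw : ∀ s t, w (s + t) = w s * w t)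
    (K : Multiset α → Multiset α → ℝ) (s : Multiset α) :
    w s * splitSum K s = splitSum (fun t r => w t * w r * K t r) s := by
  rw [← splitSum_mul_left]
  refine splitSum_congr (R := ℝ) fun t r h => ?_
  rw [← h, hw]

lemma ind_union {A D : Set α} (h : Disjoint A D) (s : Multiset α) :
    ind (A ∪ D) s = splitSum (fun t r => ind A t * ind D r) s := by
  unfold ind
  rw [← prod_add_eq_splitSum]
  congr 1
  refine Multiset.map_congr rfl fun x _ => ?_
  rw [Set.indicator_union_of_disjoint h]

variable [MeasurableSpace α]

lemma measurable_ind {A : Set α} (hA : MeasurableSet A) : Measurable fun l : Tup α => ind A (ms l) :=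
  measurable_map_prod' (measurable_one.indicator hA)

lemma lintegral_ind_pow_lt_top (ν : Measure α) [SigmaFinite ν] {D : Set α} (hD : MeasurableSet D)
    (hfin : ν D < ⊤) (c : ℝ≥0∞) (hc : c ≠ ⊤) :
    ∫⁻ l, ENNReal.ofReal (ind D (ms l)) * c ^ l.1 ∂tupMeas ν < ⊤ := by
  have hm : Measurable fun y : α => D.indicator (fun _ => c) y := measurable_const.indicator hD
  have h1 : ∀ l : Tup α, ENNReal.ofReal (ind D (ms l)) * c ^ l.1
      = ((ms l).map fun y => D.indicator (fun _ => c) y).prod := by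
    intro l
    rw [← card_ms l]
    induction ms l using Multiset.induction with
    | empty => simp
    | cons a s ih =>
      simp only [Multiset.map_cons, Multiset.prod_cons, ← ih, ind_cons, Multiset.card_cons]
      by_cases ha : a ∈ D
      · simp [ha, pow_succ]
        ring
      · simp [ha]
  rw [lintegral_congr h1]
  refine (lintegral_tup_prod_le ν hm (c := (c * ν D).toReal) ENNReal.toReal_nonneg ?_).trans_lt
    ENNReal.ofReal_lt_top
  rw [lintegral_indicator hD, lintegral_const, Measure.restrict_apply_univ,
    ENNReal.ofReal_toReal (ENNReal.mul_ne_top hc hfin.ne)]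

lemma le_lintegral_tup (ν : Measure α) (F : Tup α → ℝ≥0∞) : F tnil ≤ ∫⁻ l, F l ∂tupMeas ν := by
  rw [lintegral_tup]
  refine le_trans ?_ (ENNReal.le_tsum 0)
  rw [lintegral_pi_zero]
  simp [tnil]

end

namespace Interaction

variable {α : Type} [MeasurableSpace α] (I : Interaction α)

/-- The correlation functions of the Gibbs measure in the volume `A`. -/
def corr (A : Set α) (X : Multiset α) : ℝ := ∫ l, ind A (ms l) * relFn I.ψ X (ms l) ∂tupMeas I.ν

lemma measurable_relFn_right (X : Multiset α) : Measurable fun l : Tup α => relFn I.ψ X (ms l) := by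
  obtain ⟨lX, rfl⟩ := exists_ms_eq X
  have h := I.measurable_relFn_ψ.comp
    (measurable_prodMk_left : Measurable fun l : Tup α => (lX, l))
  simpa only [Function.comp_def] using h

lemma lintegral_abs_relFn_le (X : Multiset α) :
    ∫⁻ l, ENNReal.ofReal |relFn I.ψ X (ms l)| ∂tupMeas I.ν ≤ ENNReal.ofReal I.ξ ^ X.card := by
  refine le_trans (lintegral_mono fun l => ?_) (I.lintegral_relFn_le X)
  exact le_mul_of_one_le_left bot_le (one_le_pow₀ (by norm_num))

lemma integrable_relFn (X : Multiset α) :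
    Integrable (fun l : Tup α => relFn I.ψ X (ms l)) (tupMeas I.ν) := by
  refine ⟨(I.measurable_relFn_right X).aestronglyMeasurable, ?_⟩
  rw [hasFiniteIntegral_iff_norm]
  exact (I.lintegral_abs_relFn_le X).trans_lt (ENNReal.pow_lt_top ENNReal.ofReal_lt_top)

lemma integrable_ind_relFn {A : Set α} (hA : MeasurableSet A) (X : Multiset α) :
    Integrable (fun l : Tup α => ind A (ms l) * relFn I.ψ X (ms l)) (tupMeas I.ν) := by
  refine (I.integrable_relFn X).bdd_mul (c := 1) (measurable_ind hA).aestronglyMeasurable ?_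
  exact Filter.Eventually.of_forall fun l => by
    rw [Real.norm_eq_abs, abs_of_nonneg (ind_nonneg _ _)]
    exact ind_le_one _ _

lemma abs_corr_le (A : Set α) (X : Multiset α) : |I.corr A X| ≤ I.ξ ^ X.card := by
  have h1 := I.lintegral_abs_relFn_le X
  rw [← ENNReal.ofReal_pow I.ξ_pos.le] at h1
  rw [← ENNReal.ofReal_le_ofReal_iff (pow_nonneg I.ξ_pos.le _), ← Real.enorm_eq_ofReal_abs]
  refine (enorm_integral_le_lintegral_enorm _).trans (le_trans (lintegral_mono fun l => ?_) h1)
  rw [Real.enorm_eq_ofReal_abs, abs_mul, abs_of_nonneg (ind_nonneg _ _)]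
  exact ENNReal.ofReal_le_ofReal (mul_le_of_le_one_left (abs_nonneg _) (ind_le_one _ _))

lemma measurable_corr {A : Set α} (hA : MeasurableSet A) :
    Measurable fun l : Tup α => I.corr A (ms l) := by
  have h1 : Measurable fun p : Tup α × Tup α => ind A (ms p.2) * relFn I.ψ (ms p.1) (ms p.2) :=
    ((measurable_ind hA).comp measurable_snd).mul I.measurable_relFn_ψ
  exact (h1.stronglyMeasurable.integral_prod_right' (ν := tupMeas I.ν)).measurable

lemma integral_tup_eq_tnil (ν : Measure α) [SigmaFinite ν] {F : Multiset α → ℝ}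
    (hF : ∀ s, s ≠ 0 → F s = 0) (hm : Measurable fun l : Tup α => F (ms l)) :
    ∫ l, F (ms l) ∂tupMeas ν = F 0 := by
  have hm' : AEStronglyMeasurable (fun l : Tup α => F (ms l)) (tupMeas ν) :=
    hm.aestronglyMeasurable
  have hi : Integrable (fun l : Tup α => F (ms l)) (tupMeas ν) := by
    refine ⟨hm', ?_⟩
    rw [hasFiniteIntegral_iff_norm, lintegral_tup_eq_tnil ν (fun l hl => by simp [hF _ hl])]
    exact ENNReal.ofReal_lt_top
  rw [integral_eq_lintegral_pos_part_sub_lintegral_neg_part hi,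
    lintegral_tup_eq_tnil ν (fun l hl => by simp [hF _ hl]),
    lintegral_tup_eq_tnil ν (fun l hl => by simp [hF _ hl])]
  rw [ms_tnil]
  rcases le_total 0 (F 0) with h | h
  · simp [h, ENNReal.ofReal_of_nonpos (neg_nonpos.2 h)]
  · simp [h, ENNReal.ofReal_of_nonpos h]

@[simp] lemma corr_zero {A : Set α} (hA : MeasurableSet A) : I.corr A 0 = 1 := by
  unfold corr
  rw [integral_tup_eq_tnil I.ν (F := fun s => ind A s * relFn I.ψ 0 s)]
  · simp [relFn_zero, convOne]
  · intro s hs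
    simp [relFn_zero, convOne, hs]
  · exact (measurable_ind hA).mul (I.measurable_relFn_right 0)

lemma corr_of_not_nodup {A : Set α} {X : Multiset α} (h : ¬ X.Nodup) : I.corr A X = 0 := by
  unfold corr
  have : ∀ w, relFn I.ψ X w = 0 :=
    relFn_eq_zero fun w => I.ψ_eq_zero fun h' => h (Multiset.nodup_add.1 h').1
  simp [this]

/-- Integrability of the double splitting appearing in the Kirkwood–Salsburg equation. -/
lemma lintegral_lintegral_ks_lt_top (x : α) (X : Multiset α) {K : Multiset α → Multiset α → ℝ}
    (hK : ∀ t r, |K t r| ≤ |(t.map fun y => I.g x y - 1).prod| * |relFn I.ψ (X + t) r|) :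
    ∫⁻ t, ∫⁻ r, ENNReal.ofReal |K (ms t) (ms r)| ∂tupMeas I.ν ∂tupMeas I.ν < ⊤ := by
  have h1 : ∀ t : Tup α, ∫⁻ r, ENNReal.ofReal |K (ms t) (ms r)| ∂tupMeas I.ν
      ≤ ENNReal.ofReal I.ξ ^ X.card *
        ((ms t).map fun y => ENNReal.ofReal I.ξ * ENNReal.ofReal |I.g x y - 1|).prod := by
    intro t
    calc ∫⁻ r, ENNReal.ofReal |K (ms t) (ms r)| ∂tupMeas I.ν
        ≤ ∫⁻ r, ENNReal.ofReal |((ms t).map fun y => I.g x y - 1).prod| *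
            ENNReal.ofReal |relFn I.ψ (X + ms t) (ms r)| ∂tupMeas I.ν := by
          refine lintegral_mono fun r => ?_
          rw [← ENNReal.ofReal_mul (abs_nonneg _)]
          exact ENNReal.ofReal_le_ofReal (hK _ _)
      _ ≤ ENNReal.ofReal |((ms t).map fun y => I.g x y - 1).prod| *
            ENNReal.ofReal I.ξ ^ (X + ms t).card := by
          rw [lintegral_const_mul _ (I.measurable_relFn_right _).abs.ennreal_ofReal]
          exact mul_le_mul' le_rfl (I.lintegral_abs_relFn_le _)
      _ = _ := by
          rw [Multiset.card_add, pow_add, ← pow_card_mul_map_prod, ofReal_abs_map_prod]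
          ring
  have hwm : Measurable fun y => ENNReal.ofReal I.ξ * ENNReal.ofReal |I.g x y - 1| :=
    ((I.measurable_f x).abs.ennreal_ofReal).const_mul _
  refine (lintegral_mono h1).trans_lt ?_
  rw [lintegral_const_mul _ (measurable_map_prod_ennreal' hwm)]
  refine ENNReal.mul_lt_top (ENNReal.pow_lt_top ENNReal.ofReal_lt_top) ?_
  refine (lintegral_tup_prod_le I.ν hwm (c := 1) zero_le_one ?_).trans_lt ENNReal.ofReal_lt_top
  rw [lintegral_const_mul _ ((I.measurable_f x).abs.ennreal_ofReal)]
  refine (mul_le_mul' le_rfl (I.reg x)).trans ?_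
  rw [← ENNReal.ofReal_mul I.ξ_pos.le]
  refine ENNReal.ofReal_le_ofReal ?_
  have := I.ξ_pos.ne'
  rw [show I.z * I.b * Real.exp 1 = I.ξ from rfl]
  rw [mul_inv, mul_left_comm, mul_inv_cancel₀ this]
  norm_num

/-- The Kirkwood–Salsburg equation. -/
lemma corr_cons {A : Set α} (hA : MeasurableSet A) (x : α) (X : Multiset α) :
    I.corr A (x ::ₘ X) = I.z * (X.map (I.g x)).prod *
      ∫ t, ind A (ms t) * ((ms t).map fun y => I.g x y - 1).prod * I.corr A (X + ms t)
        ∂tupMeas I.ν := by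
  set K : Multiset α → Multiset α → ℝ := fun t r =>
    ind A t * ind A r * ((t.map fun y => I.g x y - 1).prod * relFn I.ψ (X + t) r) with hK
  have hfin := I.lintegral_lintegral_ks_lt_top x X (K := K) (fun t r => by
    rw [hK]
    dsimp only
    rw [abs_mul, abs_mul (Multiset.prod _)]
    refine mul_le_of_le_one_left (by positivity) ?_
    rw [abs_of_nonneg (mul_nonneg (ind_nonneg _ _) (ind_nonneg _ _))]
    exact mul_le_one₀ (ind_le_one _ _) (ind_nonneg _ _) (ind_le_one _ _))
  have hKm : Measurable fun p : Tup α × Tup α => K (ms p.1) (ms p.2) := by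
    obtain ⟨lX, rfl⟩ := exists_ms_eq X
    have hrel : Measurable fun p : Tup α × Tup α => relFn I.ψ (ms lX + ms p.1) (ms p.2) := by
      have := I.measurable_relFn_ψ.comp ((measurable_tapp.comp
        ((measurable_const (a := lX)).prodMk measurable_fst)).prodMk measurable_snd :
          Measurable fun p : Tup α × Tup α => (tapp lX p.1, p.2))
      simpa [Function.comp_def] using this
    exact (((measurable_ind hA).comp measurable_fst).mul
      ((measurable_ind hA).comp measurable_snd)).mul
        (((measurable_map_prod' (I.measurable_f x)).comp measurable_fst).mul hrel)
  obtain ⟨h1, _, h3⟩ := integrable_splitSum I.ν hKm hfin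
  calc I.corr A (x ::ₘ X)
      = ∫ l, I.z * (X.map (I.g x)).prod * splitSum K (ms l) ∂tupMeas I.ν := by
        refine integral_congr_ae (Filter.Eventually.of_forall fun l => ?_)
        dsimp only
        rw [relFn_ψ_cons, mul_left_comm, mul_splitSum_of_mul _ (ind_add A)]
    _ = _ := by
        rw [integral_const_mul, h3, integral_prod _ h1]
        congr 1
        refine integral_congr_ae (Filter.Eventually.of_forall fun t => ?_)
        dsimp only [hK]
        unfold corr
        rw [← integral_const_mul]
        refine integral_congr_ae (Filter.Eventually.of_forall fun r => ?_)
        dsimp only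
        ring

end Interaction

end Ruelle

/-! ### Positivity and consistency of the correlation functions -/

namespace Ruelle

lemma eventually_ind_eq {α : Type} (A : Set α) {S : ℕ → Set α} (hS : Monotone S)
    (hU : ⋃ n, S n = univ) (s : Multiset α) : ∀ᶠ n in atTop, ind (A ∩ S n) s = ind A s := by
  induction s using Multiset.induction with
  | empty => simp
  | cons x s ih =>
    obtain ⟨N, hN⟩ := mem_iUnion.1 (hU ▸ mem_univ x : x ∈ ⋃ n, S n)
    filter_upwards [ih, eventually_ge_atTop N] with n hn hn'
    have hx : x ∈ S n := hS hn' hN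
    rw [ind_cons, ind_cons, hn]
    by_cases hA : x ∈ A <;> simp [hA, hx]

lemma lintegral_lintegral_lt_top_of_le {T : Type} [MeasurableSpace T] (m : Measure T)
    {F G : T → ℝ} {K : T → T → ℝ} (hF : Measurable F) (hG : Measurable G)
    (hFi : ∫⁻ t, ENNReal.ofReal |F t| ∂m < ⊤) (hGi : ∫⁻ t, ENNReal.ofReal |G t| ∂m < ⊤)
    (hK : ∀ t r, |K t r| ≤ |F t| * |G r|) :
    ∫⁻ t, ∫⁻ r, ENNReal.ofReal |K t r| ∂m ∂m < ⊤ := by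
  have h1 : ∀ t r, ENNReal.ofReal |K t r| ≤ ENNReal.ofReal |F t| * ENNReal.ofReal |G r| := by
    intro t r
    rw [← ENNReal.ofReal_mul (abs_nonneg _)]
    exact ENNReal.ofReal_le_ofReal (hK t r)
  refine (lintegral_mono fun t => lintegral_mono fun r => h1 t r).trans_lt ?_
  have h2 : ∀ t, ∫⁻ r, ENNReal.ofReal |F t| * ENNReal.ofReal |G r| ∂m
      = ENNReal.ofReal |F t| * ∫⁻ r, ENNReal.ofReal |G r| ∂m :=
    fun t => lintegral_const_mul _ hG.abs.ennreal_ofReal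
  rw [lintegral_congr h2, lintegral_mul_const _ hF.abs.ennreal_ofReal]
  exact ENNReal.mul_lt_top hFi hGi

namespace Interaction

variable {α : Type} [MeasurableSpace α] (I : Interaction α)

/-- The unnormalised finite volume correlation functions. -/
def wt (A : Set α) (X : Multiset α) : ℝ := ∫ l, ind A (ms l) * I.ψ (X + ms l) ∂tupMeas I.ν

lemma abs_ind_ψ_le (A : Set α) (X s : Multiset α) :
    |ind A s * I.ψ (X + s)| ≤ ind A s * (I.z * I.b) ^ (X.card + s.card) := by
  rw [abs_of_nonneg (mul_nonneg (ind_nonneg _ _) (I.ψ_nonneg _)), ← Multiset.card_add]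
  exact mul_le_mul_of_nonneg_left (I.ψ_le _) (ind_nonneg _ _)

lemma measurable_ψ_add (X : Multiset α) : Measurable fun l : Tup α => I.ψ (X + ms l) := by
  obtain ⟨lX, rfl⟩ := exists_ms_eq X
  have h := I.measurable_ψ.comp (measurable_tapp.comp
    (measurable_prodMk_left : Measurable fun l : Tup α => (lX, l)))
  simpa [Function.comp_def] using h

lemma measurable_corr_add {A : Set α} (hA : MeasurableSet A) (X : Multiset α) :
    Measurable fun l : Tup α => I.corr A (X + ms l) := by
  obtain ⟨lX, rfl⟩ := exists_ms_eq X
  have h := (I.measurable_corr hA).comp (measurable_tapp.comp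
    (measurable_prodMk_left : Measurable fun l : Tup α => (lX, l)))
  simpa [Function.comp_def] using h

lemma lintegral_ind_bound_lt_top {A : Set α} (hA : MeasurableSet A) (hfin : I.ν A < ⊤) (c : ℝ)
    (hc : 0 ≤ c) {F : Multiset α → ℝ} (m : ℕ) (hF : ∀ s, |F s| ≤ ind A s * c ^ (m + s.card)) :
    ∫⁻ l, ENNReal.ofReal |F (ms l)| ∂tupMeas I.ν < ⊤ := by
  have h1 : ∀ l : Tup α, ENNReal.ofReal |F (ms l)|
      ≤ ENNReal.ofReal c ^ m * (ENNReal.ofReal (ind A (ms l)) * ENNReal.ofReal c ^ l.1) := by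
    intro l
    refine (ENNReal.ofReal_le_ofReal (hF _)).trans (le_of_eq ?_)
    rw [ENNReal.ofReal_mul (ind_nonneg _ _), ENNReal.ofReal_pow hc, pow_add, card_ms]
    ring
  refine (lintegral_mono h1).trans_lt ?_
  have hm : Measurable fun l : Tup α =>
      ENNReal.ofReal (ind A (ms l)) * ENNReal.ofReal c ^ l.1 :=
    (measurable_ind hA).ennreal_ofReal.mul
      ((measurable_from_top (f := fun n : ℕ => ENNReal.ofReal c ^ n)).comp measurable_tup_fst)
  rw [lintegral_const_mul _ hm]
  exact ENNReal.mul_lt_top (ENNReal.pow_lt_top ENNReal.ofReal_lt_top)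
    (lintegral_ind_pow_lt_top I.ν hA hfin _ ENNReal.ofReal_ne_top)

lemma integrable_of_ind_bound {A : Set α} (hA : MeasurableSet A) (hfin : I.ν A < ⊤) (c : ℝ)
    (hc : 0 ≤ c) {F : Multiset α → ℝ} (m : ℕ) (hF : ∀ s, |F s| ≤ ind A s * c ^ (m + s.card))
    (hm : Measurable fun l : Tup α => F (ms l)) :
    Integrable (fun l : Tup α => F (ms l)) (tupMeas I.ν) := by
  refine ⟨hm.aestronglyMeasurable, ?_⟩
  rw [hasFiniteIntegral_iff_norm]
  exact I.lintegral_ind_bound_lt_top hA hfin c hc m hF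

lemma zb_nonneg : 0 ≤ I.z * I.b := (mul_pos I.z_pos I.b_pos).le

lemma integrable_ind_ψ {A : Set α} (hA : MeasurableSet A) (hfin : I.ν A < ⊤) (X : Multiset α) :
    Integrable (fun l : Tup α => ind A (ms l) * I.ψ (X + ms l)) (tupMeas I.ν) :=
  I.integrable_of_ind_bound hA hfin (I.z * I.b) I.zb_nonneg
    (F := fun s => ind A s * I.ψ (X + s)) X.card (I.abs_ind_ψ_le A X)
    ((measurable_ind hA).mul (I.measurable_ψ_add X))

lemma wt_nonneg (A : Set α) (X : Multiset α) : 0 ≤ I.wt A X :=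
  integral_nonneg fun _ => mul_nonneg (ind_nonneg _ _) (I.ψ_nonneg _)

lemma one_le_wt_zero {A : Set α} (hA : MeasurableSet A) (hfin : I.ν A < ⊤) : 1 ≤ I.wt A 0 := by
  rw [← ENNReal.ofReal_le_ofReal_iff (I.wt_nonneg A 0), wt,
    ofReal_integral_eq_lintegral_ofReal (I.integrable_ind_ψ hA hfin 0)
      (Filter.Eventually.of_forall fun _ => mul_nonneg (ind_nonneg _ _) (I.ψ_nonneg _))]
  refine le_trans ?_ (le_lintegral_tup I.ν _)
  simp

lemma wt_zero_mul_corr {A : Set α} (hA : MeasurableSet A) (hfin : I.ν A < ⊤) (X : Multiset α) :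
    I.wt A 0 * I.corr A X = I.wt A X := by
  set K : Multiset α → Multiset α → ℝ := fun t r =>
    (ind A t * I.ψ (0 + t)) * (ind A r * relFn I.ψ X r) with hK
  have hKm : Measurable fun p : Tup α × Tup α => K (ms p.1) (ms p.2) :=
    (((measurable_ind hA).mul (I.measurable_ψ_add 0)).comp measurable_fst).mul
      (((measurable_ind hA).mul (I.measurable_relFn_right X)).comp measurable_snd)
  have h2 := I.integrable_ind_relFn hA X
  have hfin' : ∫⁻ t, ∫⁻ r, ENNReal.ofReal |K (ms t) (ms r)| ∂tupMeas I.ν ∂tupMeas I.ν < ⊤ := by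
    refine lintegral_lintegral_lt_top_of_le (tupMeas I.ν)
      (F := fun t => ind A (ms t) * I.ψ (0 + ms t)) (G := fun r => ind A (ms r) * relFn I.ψ X (ms r))
      ((measurable_ind hA).mul (I.measurable_ψ_add 0))
      ((measurable_ind hA).mul (I.measurable_relFn_right X))
      (hasFiniteIntegral_iff_norm _ |>.1 (I.integrable_ind_ψ hA hfin 0).2)
      (hasFiniteIntegral_iff_norm _ |>.1 h2.2) fun t r => ?_
    rw [← abs_mul]
  obtain ⟨_, _, h3⟩ := integrable_splitSum I.ν hKm hfin'
  unfold wt corr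
  rw [← integral_prod_mul, ← h3]
  refine integral_congr_ae (Filter.Eventually.of_forall fun l => ?_)
  dsimp only
  rw [← congrFun (conv_relFn I.ψ_zero X) (ms l), conv, mul_splitSum_of_mul _ (ind_add A)]
  refine splitSum_congr (R := ℝ) fun t r _ => ?_
  rw [hK]
  dsimp only
  rw [zero_add]
  ring

lemma corr_nonneg_of_lt_top {A : Set α} (hA : MeasurableSet A) (hfin : I.ν A < ⊤)
    (X : Multiset α) : 0 ≤ I.corr A X := by
  have h1 := I.wt_zero_mul_corr hA hfin X
  have h2 := I.one_le_wt_zero hA hfin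
  have h3 := I.wt_nonneg A X
  rw [← h1] at h3
  exact nonneg_of_mul_nonneg_right h3 (by linarith)

lemma tendsto_corr {A : Set α} (hA : MeasurableSet A) {S : ℕ → Set α} (hS : Monotone S)
    (hSm : ∀ n, MeasurableSet (S n)) (hU : ⋃ n, S n = univ) (X : Multiset α) :
    Tendsto (fun n => I.corr (A ∩ S n) X) atTop (𝓝 (I.corr A X)) := by
  refine tendsto_integral_of_dominated_convergence (fun l => |relFn I.ψ X (ms l)|)
    (fun n => ((measurable_ind (hA.inter (hSm n))).mul
      (I.measurable_relFn_right X)).aestronglyMeasurable)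
    (I.integrable_relFn X).abs
    (fun n => Filter.Eventually.of_forall fun l => ?_)
    (Filter.Eventually.of_forall fun l => ?_)
  · rw [Real.norm_eq_abs, abs_mul, abs_of_nonneg (ind_nonneg _ _)]
    exact mul_le_of_le_one_left (abs_nonneg _) (ind_le_one _ _)
  · refine tendsto_const_nhds.congr' ?_
    filter_upwards [eventually_ind_eq A hS hU (ms l)] with n hn
    rw [hn]

lemma corr_nonneg {A : Set α} (hA : MeasurableSet A) (X : Multiset α) : 0 ≤ I.corr A X := by
  refine ge_of_tendsto' (I.tendsto_corr hA (monotone_spanningSets I.ν)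
    (measurableSet_spanningSets I.ν) (iUnion_spanningSets I.ν) X) fun n => ?_
  exact I.corr_nonneg_of_lt_top (hA.inter (measurableSet_spanningSets I.ν n))
    ((measure_mono inter_subset_right).trans_lt (measure_spanningSets_lt_top I.ν n)) X

lemma corr_le {A : Set α} (X : Multiset α) : I.corr A X ≤ I.ξ ^ X.card :=
  (le_abs_self _).trans (I.abs_corr_le A X)

lemma wt_union {A D : Set α} (hA : MeasurableSet A) (hD : MeasurableSet D) (hd : Disjoint A D)
    (hfin : I.ν A < ⊤) (hfin' : I.ν D < ⊤) (X : Multiset α) :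
    I.wt (A ∪ D) X = ∫ u, ind D (ms u) * I.wt A (X + ms u) ∂tupMeas I.ν := by
  set K : Multiset α → Multiset α → ℝ := fun t r =>
    ind D t * (ind A r * I.ψ ((X + t) + r)) with hK
  have hψ : Measurable fun p : Tup α × Tup α => I.ψ ((X + ms p.1) + ms p.2) := by
    have h := (I.measurable_ψ_add X).comp measurable_tapp
    simpa [Function.comp_def, add_assoc] using h
  have hKm : Measurable fun p : Tup α × Tup α => K (ms p.1) (ms p.2) :=
    ((measurable_ind hD).comp measurable_fst).mul
      (((measurable_ind hA).comp measurable_snd).mul hψ)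
  have hf : ∫⁻ t, ∫⁻ r, ENNReal.ofReal |K (ms t) (ms r)| ∂tupMeas I.ν ∂tupMeas I.ν < ⊤ := by
    have hzb := I.zb_nonneg
    have hp : ∀ m : ℕ, Measurable fun l : Tup α => (I.z * I.b) ^ (m + (ms l).card) := by
      intro m
      simp only [card_ms]
      exact (measurable_from_top (f := fun n : ℕ => (I.z * I.b) ^ (m + n))).comp
        measurable_tup_fst
    have hb : ∀ {C : Set α} (m : ℕ), ∀ s : Multiset α, |ind C s * (I.z * I.b) ^ (m + s.card)|
        ≤ ind C s * (I.z * I.b) ^ (m + s.card) := by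
      intro C m s
      exact (abs_of_nonneg (mul_nonneg (ind_nonneg _ _) (pow_nonneg hzb _))).le
    refine lintegral_lintegral_lt_top_of_le (tupMeas I.ν)
      (F := fun t => ind D (ms t) * (I.z * I.b) ^ (X.card + (ms t).card))
      (G := fun r => ind A (ms r) * (I.z * I.b) ^ (0 + (ms r).card))
      ((measurable_ind hD).mul (hp _)) ((measurable_ind hA).mul (hp _))
      (I.lintegral_ind_bound_lt_top hD hfin' _ hzb
        (F := fun s => ind D s * (I.z * I.b) ^ (X.card + s.card)) _ (hb _))
      (I.lintegral_ind_bound_lt_top hA hfin _ hzb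
        (F := fun s => ind A s * (I.z * I.b) ^ (0 + s.card)) _ (hb _)) fun t r => ?_
    rw [hK]
    dsimp only
    rw [abs_mul, abs_mul (ind D (ms t)), mul_assoc |ind D (ms t)|,
      abs_of_nonneg (pow_nonneg hzb _)]
    refine mul_le_mul_of_nonneg_left ?_ (abs_nonneg _)
    refine (I.abs_ind_ψ_le A _ _).trans (le_of_eq ?_)
    rw [abs_of_nonneg (mul_nonneg (ind_nonneg _ _) (pow_nonneg hzb _)), zero_add,
      Multiset.card_add, pow_add, pow_add]
    ring
  obtain ⟨h1, _, h3⟩ := integrable_splitSum I.ν hKm hf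
  calc I.wt (A ∪ D) X = ∫ l, splitSum K (ms l) ∂tupMeas I.ν := by
        refine integral_congr_ae (Filter.Eventually.of_forall fun l => ?_)
        dsimp only
        rw [union_comm, ind_union hd.symm, mul_comm, ← splitSum_mul_left]
        refine splitSum_congr (R := ℝ) fun t r h => ?_
        rw [hK, ← h]
        dsimp only
        rw [add_assoc]
        ring
    _ = _ := by
        rw [h3, integral_prod _ h1]
        refine integral_congr_ae (Filter.Eventually.of_forall fun t => ?_)
        dsimp only [hK]
        rw [integral_const_mul]
        rfl

/-- The normalisation constant relating correlation functions in `A` and in `A ∪ D`. -/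
def nrm (A D : Set α) : ℝ := ∫ u, ind D (ms u) * I.corr A (ms u) ∂tupMeas I.ν

lemma abs_ind_corr_le (A D : Set α) (X s : Multiset α) :
    |ind D s * I.corr A (X + s)| ≤ ind D s * I.ξ ^ (X.card + s.card) := by
  rw [abs_mul, abs_of_nonneg (ind_nonneg _ _), ← Multiset.card_add]
  exact mul_le_mul_of_nonneg_left (I.abs_corr_le _ _) (ind_nonneg _ _)

lemma integrable_ind_corr {A D : Set α} (hA : MeasurableSet A) (hD : MeasurableSet D)
    (hfin : I.ν D < ⊤) (X : Multiset α) :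
    Integrable (fun u : Tup α => ind D (ms u) * I.corr A (X + ms u)) (tupMeas I.ν) :=
  I.integrable_of_ind_bound hD hfin I.ξ I.ξ_pos.le
    (F := fun s => ind D s * I.corr A (X + s)) X.card (I.abs_ind_corr_le A D X)
    ((measurable_ind hD).mul (I.measurable_corr_add hA X))

lemma corr_union_of_lt_top {A D : Set α} (hA : MeasurableSet A) (hD : MeasurableSet D)
    (hd : Disjoint A D) (hfin : I.ν A < ⊤) (hfin' : I.ν D < ⊤) (X : Multiset α) :
    ∫ u, ind D (ms u) * I.corr A (X + ms u) ∂tupMeas I.ν = I.nrm A D * I.corr (A ∪ D) X := by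
  have hU : I.ν (A ∪ D) < ⊤ := (measure_union_le _ _).trans_lt (ENNReal.add_lt_top.2 ⟨hfin, hfin'⟩)
  have key : ∀ X, I.wt A 0 * ∫ u, ind D (ms u) * I.corr A (X + ms u) ∂tupMeas I.ν
      = I.wt (A ∪ D) X := by
    intro X
    rw [I.wt_union hA hD hd hfin hfin', ← integral_const_mul]
    refine integral_congr_ae (Filter.Eventually.of_forall fun u => ?_)
    dsimp only
    rw [← I.wt_zero_mul_corr hA hfin (X + ms u)]
    ring
  have h1 := key X
  have h0 : I.wt A 0 * I.nrm A D = I.wt (A ∪ D) 0 := by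
    rw [← key 0]
    simp [nrm]
  rw [← I.wt_zero_mul_corr (hA.union hD) hU, ← h0, mul_assoc] at h1
  have := I.one_le_wt_zero hA hfin
  exact mul_left_cancel₀ (by linarith) h1

lemma tendsto_integral_ind_corr {A D : Set α} (hA : MeasurableSet A) (hD : MeasurableSet D)
    (hfin : I.ν D < ⊤) {S : ℕ → Set α} (hS : Monotone S)
    (hSm : ∀ n, MeasurableSet (S n)) (hU : ⋃ n, S n = univ) (X : Multiset α) :
    Tendsto (fun n => ∫ u, ind D (ms u) * I.corr (A ∩ S n) (X + ms u) ∂tupMeas I.ν) atTop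
      (𝓝 (∫ u, ind D (ms u) * I.corr A (X + ms u) ∂tupMeas I.ν)) := by
  refine tendsto_integral_of_dominated_convergence
    (fun u => ind D (ms u) * I.ξ ^ (X.card + (ms u).card))
    (fun n => ((measurable_ind hD).mul
      (I.measurable_corr_add (hA.inter (hSm n)) X)).aestronglyMeasurable)
    (I.integrable_of_ind_bound hD hfin I.ξ I.ξ_pos.le
      (F := fun s => ind D s * I.ξ ^ (X.card + s.card)) X.card (fun s => ?_) ?_)
    (fun n => Filter.Eventually.of_forall fun l => I.abs_ind_corr_le _ _ _ _)
    (Filter.Eventually.of_forall fun l =>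
      (I.tendsto_corr hA hS hSm hU _).const_mul _)
  · exact (abs_of_nonneg (mul_nonneg (ind_nonneg _ _) (pow_nonneg I.ξ_pos.le _))).le
  · simp only [card_ms]
    exact (measurable_ind hD).mul
      ((measurable_from_top (f := fun n : ℕ => I.ξ ^ (X.card + n))).comp measurable_tup_fst)

/-- Consistency of the correlation functions. -/
lemma corr_union {A D : Set α} (hA : MeasurableSet A) (hD : MeasurableSet D)
    (hd : Disjoint A D) (hfin : I.ν D < ⊤) (X : Multiset α) :
    ∫ u, ind D (ms u) * I.corr A (X + ms u) ∂tupMeas I.ν = I.nrm A D * I.corr (A ∪ D) X := by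
  set S := fun n => spanningSets I.ν n ∪ D
  have hS : Monotone S := fun m n h => union_subset_union_left _ (monotone_spanningSets I.ν h)
  have hSm : ∀ n, MeasurableSet (S n) := fun n => (measurableSet_spanningSets I.ν n).union hD
  have hU : ⋃ n, S n = univ := by
    refine eq_univ_of_univ_subset ?_
    rw [← iUnion_spanningSets I.ν]
    exact iUnion_mono fun n => subset_union_left
  have hf : ∀ n, I.ν (S n) < ⊤ := fun n => (measure_union_le _ _).trans_lt
    (ENNReal.add_lt_top.2 ⟨measure_spanningSets_lt_top I.ν n, hfin⟩)
  have h1 := I.tendsto_integral_ind_corr hA hD hfin hS hSm hU X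
  have h2 := I.tendsto_integral_ind_corr hA hD hfin hS hSm hU 0
  have h3 := I.tendsto_corr (hA.union hD) hS hSm hU X
  simp only [zero_add] at h2
  refine tendsto_nhds_unique h1 ((h2.mul h3).congr fun n => ?_)
  have e : (A ∪ D) ∩ S n = (A ∩ S n) ∪ D := by
    ext x
    simp only [S, mem_inter_iff, mem_union]
    tauto
  rw [e]
  exact (I.corr_union_of_lt_top (hA.inter (hSm n)) hD (hd.mono_left inter_subset_left)
    ((measure_mono inter_subset_right).trans_lt (hf n)) hfin X).symm

lemma lintegral_ind_corr {A D : Set α} (hA : MeasurableSet A) (hD : MeasurableSet D)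
    (hd : Disjoint A D) (hfin : I.ν D < ⊤) (X : Multiset α) :
    ∫⁻ u, ENNReal.ofReal (ind D (ms u)) * ENNReal.ofReal (I.corr A (X + ms u)) ∂tupMeas I.ν
      = ENNReal.ofReal (I.nrm A D) * ENNReal.ofReal (I.corr (A ∪ D) X) := by
  have hn : 0 ≤ I.nrm A D :=
    integral_nonneg fun u => mul_nonneg (ind_nonneg _ _) (I.corr_nonneg hA _)
  rw [← ENNReal.ofReal_mul hn, ← I.corr_union hA hD hd hfin X,
    ofReal_integral_eq_lintegral_ofReal (I.integrable_ind_corr hA hD hfin X)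
      (Filter.Eventually.of_forall fun u => mul_nonneg (ind_nonneg _ _) (I.corr_nonneg hA _))]
  exact lintegral_congr fun u => (ENNReal.ofReal_mul (ind_nonneg _ _)).symm

lemma one_le_nrm {A D : Set α} (hA : MeasurableSet A) (hD : MeasurableSet D)
    (hfin : I.ν D < ⊤) : 1 ≤ I.nrm A D := by
  have hi := I.integrable_ind_corr hA hD hfin 0
  simp only [zero_add] at hi
  have h0 : 0 ≤ I.nrm A D :=
    integral_nonneg fun u => mul_nonneg (ind_nonneg _ _) (I.corr_nonneg hA _)
  rw [← ENNReal.ofReal_le_ofReal_iff h0, nrm, ofReal_integral_eq_lintegral_ofReal hi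
      (Filter.Eventually.of_forall fun u => mul_nonneg (ind_nonneg _ _) (I.corr_nonneg hA _))]
  refine le_trans ?_ (le_lintegral_tup I.ν _)
  simp [I.corr_zero hA]

end Interaction

end Ruelle

/-! ### Expectations in terms of correlation functions -/

namespace Ruelle

section

variable {α : Type}

lemma ind_mul_map_prod (W : Set α) (h : α → ℝ) (s : Multiset α) :
    ind W s * (s.map h).prod = (s.map fun y => W.indicator 1 y * h y).prod := by
  rw [Multiset.prod_map_mul]
  rfl

lemma pow_card_mul_map_prod_real (c : ℝ) (f : α → ℝ) (s : Multiset α) :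
    c ^ s.card * (s.map f).prod = (s.map fun y => c * f y).prod := by
  rw [Multiset.prod_map_mul]
  simp

variable [MeasurableSpace α]

lemma lintegral_abs_map_prod_lt_top (ν : Measure α) [SigmaFinite ν] {w : α → ℝ}
    (hw : Measurable w) (hfin : ∫⁻ y, ENNReal.ofReal |w y| ∂ν < ⊤) :
    ∫⁻ l, ENNReal.ofReal |((ms l).map w).prod| ∂tupMeas ν < ⊤ := by
  simp only [ofReal_abs_map_prod]
  refine (lintegral_tup_prod_le ν hw.abs.ennreal_ofReal
    (c := (∫⁻ y, ENNReal.ofReal |w y| ∂ν).toReal) ENNReal.toReal_nonneg ?_).trans_lt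
    ENNReal.ofReal_lt_top
  rw [ENNReal.ofReal_toReal hfin.ne]

lemma lintegral_abs_indicator_mul_lt_top (ν : Measure α) {W : Set α} (hW : MeasurableSet W)
    (hfin : ν W < ⊤) {h : α → ℝ} {C : ℝ} (hC : ∀ y, |h y| ≤ C) :
    ∫⁻ y, ENNReal.ofReal |W.indicator 1 y * h y| ∂ν < ⊤ := by
  have : ∀ y, ENNReal.ofReal |W.indicator 1 y * h y|
      ≤ W.indicator (fun _ => ENNReal.ofReal C) y := by
    intro y
    by_cases hy : y ∈ W
    · simpa [hy] using ENNReal.ofReal_le_ofReal (hC y)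
    · simp [hy]
  refine (lintegral_mono this).trans_lt ?_
  rw [lintegral_indicator hW, lintegral_const, Measure.restrict_apply_univ]
  exact ENNReal.mul_lt_top ENNReal.ofReal_lt_top hfin

end

namespace Interaction

variable {α : Type} [MeasurableSpace α] (I : Interaction α)

lemma measurable_corr_add_add {A : Set α} (hA : MeasurableSet A) (X : Multiset α) :
    Measurable fun p : Tup α × Tup α => I.corr A (X + ms p.1 + ms p.2) := by
  have h := (I.measurable_corr_add hA X).comp measurable_tapp
  simpa [Function.comp_def, add_assoc] using h

/-- Expectation of a sum over subconfigurations. -/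
lemma lintegral_ind_splitSum_corr {W : Set α} (hW : MeasurableSet W) (hfin : I.ν W < ⊤)
    {F : Multiset α → ℝ≥0∞} (hF : Measurable fun l : Tup α => F (ms l)) :
    ∫⁻ u, ENNReal.ofReal (ind W (ms u)) * splitSum (fun t _ => F t) (ms u) *
        ENNReal.ofReal (I.corr Wᶜ (ms u)) ∂tupMeas I.ν
      = ENNReal.ofReal (I.nrm Wᶜ W) * ∫⁻ t, ENNReal.ofReal (ind W (ms t)) * F (ms t) *
        ENNReal.ofReal (I.corr univ (ms t)) ∂tupMeas I.ν := by
  set K : Multiset α → Multiset α → ℝ≥0∞ := fun t r =>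
    (ENNReal.ofReal (ind W t) * F t) *
      (ENNReal.ofReal (ind W r) * ENNReal.ofReal (I.corr Wᶜ (t + r))) with hK
  have hcm : Measurable fun p : Tup α × Tup α => I.corr Wᶜ (ms p.1 + ms p.2) := by
    have h := I.measurable_corr_add_add hW.compl 0
    simpa using h
  have hKm : Measurable fun p : Tup α × Tup α => K (ms p.1) (ms p.2) :=
    (((measurable_ind hW).ennreal_ofReal.mul hF).comp measurable_fst).mul
      (((measurable_ind hW).ennreal_ofReal.comp measurable_snd).mul hcm.ennreal_ofReal)
  have h1 : ∀ u : Tup α, ENNReal.ofReal (ind W (ms u)) * splitSum (fun t _ => F t) (ms u) *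
      ENNReal.ofReal (I.corr Wᶜ (ms u)) = splitSum K (ms u) := by
    intro u
    rw [mul_right_comm, ← splitSum_const_mul_ennreal]
    refine splitSum_congr (R := ℝ≥0∞) fun t r h => ?_
    rw [hK, ← h, ind_add, ENNReal.ofReal_mul (ind_nonneg _ _)]
    dsimp only
    ring
  rw [lintegral_congr h1, lintegral_splitSum I.ν hKm]
  have hm2 : Measurable fun t : Tup α => ENNReal.ofReal (ind W (ms t)) * F (ms t) *
        ENNReal.ofReal (I.corr univ (ms t)) :=
    ((measurable_ind hW).ennreal_ofReal.mul hF).mul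
      (I.measurable_corr MeasurableSet.univ).ennreal_ofReal
  rw [← lintegral_const_mul _ hm2]
  refine lintegral_congr fun t => ?_
  have h2 := I.lintegral_ind_corr hW.compl hW disjoint_compl_left hfin (ms t)
  rw [compl_union_self] at h2
  have hm3 : Measurable fun r : Tup α => ENNReal.ofReal (ind W (ms r)) *
      ENNReal.ofReal (I.corr Wᶜ (ms t + ms r)) :=
    (measurable_ind hW).ennreal_ofReal.mul
      (I.measurable_corr_add hW.compl (ms t)).ennreal_ofReal
  rw [hK]
  dsimp only
  rw [lintegral_const_mul _ hm3, h2]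
  ring

/-- Expectation of a product functional. -/
lemma integral_ind_prod_corr {W : Set α} (hW : MeasurableSet W) (hfin : I.ν W < ⊤)
    {h : α → ℝ} (hh : Measurable h) {C : ℝ} (hC : ∀ y, |h y| ≤ C) (X : Multiset α) :
    ∫ u, ind W (ms u) * ((ms u).map fun y => h y + 1).prod * I.corr Wᶜ (X + ms u) ∂tupMeas I.ν
      = I.nrm Wᶜ W *
        ∫ t, ind W (ms t) * ((ms t).map h).prod * I.corr univ (X + ms t) ∂tupMeas I.ν := by
  set K : Multiset α → Multiset α → ℝ := fun t r =>
    (ind W t * (t.map h).prod) * (ind W r * I.corr Wᶜ (X + t + r)) with hK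
  have hKm : Measurable fun p : Tup α × Tup α => K (ms p.1) (ms p.2) :=
    (((measurable_ind hW).mul (measurable_map_prod' hh)).comp measurable_fst).mul
      (((measurable_ind hW).comp measurable_snd).mul (I.measurable_corr_add_add hW.compl X))
  have hind : Measurable fun y : α => W.indicator (1 : α → ℝ) y := measurable_one.indicator hW
  have hw1 : Measurable fun y => I.ξ * (W.indicator 1 y * h y) := (hind.mul hh).const_mul _
  have hw2 : Measurable fun y => I.ξ * (W.indicator 1 y * (1 : ℝ)) :=
    (hind.mul measurable_const).const_mul _
  have aux : ∀ {h' : α → ℝ} {C' : ℝ}, Measurable h' → (∀ y, |h' y| ≤ C') →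
      ∫⁻ y, ENNReal.ofReal |I.ξ * (W.indicator 1 y * h' y)| ∂I.ν < ⊤ := by
    intro h' C' hm hb
    have e : ∀ y, ENNReal.ofReal |I.ξ * (W.indicator 1 y * h' y)|
        = ENNReal.ofReal I.ξ * ENNReal.ofReal |W.indicator 1 y * h' y| := by
      intro y
      rw [abs_mul, abs_of_pos I.ξ_pos, ENNReal.ofReal_mul I.ξ_pos.le]
    have hm' : Measurable fun y => ENNReal.ofReal |W.indicator 1 y * h' y| :=
      (hind.mul hm).abs.ennreal_ofReal
    rw [lintegral_congr e, lintegral_const_mul _ hm']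
    exact ENNReal.mul_lt_top ENNReal.ofReal_lt_top
      (lintegral_abs_indicator_mul_lt_top I.ν hW hfin hb)
  have hf : ∫⁻ t, ∫⁻ r, ENNReal.ofReal |K (ms t) (ms r)| ∂tupMeas I.ν ∂tupMeas I.ν < ⊤ := by
    refine lintegral_lintegral_lt_top_of_le (tupMeas I.ν)
      (F := fun t => ((ms t).map fun y => I.ξ * (W.indicator 1 y * h y)).prod)
      (G := fun r => I.ξ ^ X.card * ((ms r).map fun y => I.ξ * (W.indicator 1 y * (1 : ℝ))).prod)
      (measurable_map_prod' hw1) ((measurable_map_prod' hw2).const_mul _)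
      (lintegral_abs_map_prod_lt_top I.ν hw1 (aux hh hC)) ?_ fun t r => ?_
    · have e : ∀ r : Tup α, ENNReal.ofReal |I.ξ ^ X.card *
          ((ms r).map fun y => I.ξ * (W.indicator 1 y * (1 : ℝ))).prod|
          = ENNReal.ofReal (I.ξ ^ X.card) * ENNReal.ofReal
            |((ms r).map fun y => I.ξ * (W.indicator 1 y * (1 : ℝ))).prod| := by
        intro r
        rw [abs_mul, abs_of_pos (pow_pos I.ξ_pos _), ENNReal.ofReal_mul (pow_pos I.ξ_pos _).le]
      have hm' : Measurable fun r : Tup α => ENNReal.ofReal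
            |((ms r).map fun y => I.ξ * (W.indicator 1 y * (1 : ℝ))).prod| :=
        (measurable_map_prod' hw2).abs.ennreal_ofReal
      rw [lintegral_congr e, lintegral_const_mul _ hm']
      exact ENNReal.mul_lt_top ENNReal.ofReal_lt_top
        (lintegral_abs_map_prod_lt_top I.ν hw2
          (aux (h' := fun _ => 1) (C' := 1) measurable_const (by simp)))
    · rw [← pow_card_mul_map_prod_real, ← pow_card_mul_map_prod_real, ← ind_mul_map_prod,
        ← ind_mul_map_prod, hK]
      dsimp only
      rw [abs_mul, abs_mul (I.ξ ^ _), abs_of_pos (pow_pos I.ξ_pos _)]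
      have h3 := I.abs_corr_le Wᶜ (X + ms t + ms r)
      rw [Multiset.card_add, Multiset.card_add] at h3
      simp only [Multiset.map_const', Multiset.prod_replicate, one_pow, mul_one]
      rw [abs_mul (ind W (ms r)), abs_mul (I.ξ ^ X.card), abs_mul (I.ξ ^ _),
        abs_of_pos (pow_pos I.ξ_pos X.card), abs_of_pos (pow_pos I.ξ_pos (ms r).card)]
      calc _ ≤ |ind W (ms t) * ((ms t).map h).prod| * (|ind W (ms r)| *
            I.ξ ^ (X.card + (ms t).card + (ms r).card)) := by gcongr
        _ = _ := by
          rw [pow_add, pow_add]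
          ring
  obtain ⟨h1, _, h3⟩ := integrable_splitSum I.ν hKm hf
  calc _ = ∫ l, splitSum K (ms l) ∂tupMeas I.ν := by
        refine integral_congr_ae (Filter.Eventually.of_forall fun l => ?_)
        dsimp only
        rw [prod_add_eq_splitSum, mul_right_comm, ← splitSum_mul_left]
        refine splitSum_congr (R := ℝ) fun t r hl => ?_
        rw [hK, ← hl, ind_add]
        dsimp only
        rw [add_assoc]
        simp
        ring
    _ = _ := by
        rw [h3, integral_prod _ h1, ← integral_const_mul]
        refine integral_congr_ae (Filter.Eventually.of_forall fun t => ?_)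
        dsimp only [hK]
        rw [integral_const_mul, I.corr_union hW.compl hW disjoint_compl_left hfin,
          compl_union_self]
        ring

lemma g_sub_one_abs_le (x y : α) : |I.g x y - 1| ≤ I.b + 1 := by
  have h1 := I.nonneg x y
  have h2 := I.g_le x y
  have h3 := I.b_pos
  rw [abs_le]
  constructor <;> linarith

lemma lintegral_abs_f_lt_top (x : α) : ∫⁻ y, ENNReal.ofReal |I.g x y - 1| ∂I.ν < ⊤ :=
  (I.reg x).trans_lt ENNReal.ofReal_lt_top

lemma lintegral_const_mul_abs_lt_top {w : α → ℝ} (hw : Measurable w)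
    (h : ∫⁻ y, ENNReal.ofReal |w y| ∂I.ν < ⊤) (c : ℝ) :
    ∫⁻ y, ENNReal.ofReal |c * w y| ∂I.ν < ⊤ := by
  have e : ∀ y, ENNReal.ofReal |c * w y| = ENNReal.ofReal |c| * ENNReal.ofReal |w y| := by
    intro y
    rw [abs_mul, ENNReal.ofReal_mul (abs_nonneg _)]
  rw [lintegral_congr e, lintegral_const_mul _ hw.abs.ennreal_ofReal]
  exact ENNReal.mul_lt_top ENNReal.ofReal_lt_top h

/-- Integrability of product functionals against the correlation functions. -/
lemma integrable_prod_corr {A : Set α} (hA : MeasurableSet A) {w : α → ℝ} (hw : Measurable w)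
    (h : ∫⁻ y, ENNReal.ofReal |w y| ∂I.ν < ⊤) :
    Integrable (fun l : Tup α => ((ms l).map w).prod * I.corr A (ms l)) (tupMeas I.ν) := by
  refine ⟨((measurable_map_prod' hw).mul (I.measurable_corr hA)).aestronglyMeasurable, ?_⟩
  rw [hasFiniteIntegral_iff_norm]
  refine lt_of_le_of_lt (lintegral_mono fun l => ?_) (lintegral_abs_map_prod_lt_top I.ν
    (hw.const_mul I.ξ) (I.lintegral_const_mul_abs_lt_top hw h I.ξ))
  refine ENNReal.ofReal_le_ofReal ?_
  rw [← pow_card_mul_map_prod_real, Real.norm_eq_abs, abs_mul, abs_mul,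
    abs_of_pos (pow_pos I.ξ_pos _), mul_comm]
  exact mul_le_mul_of_nonneg_right (I.abs_corr_le _ _) (abs_nonneg _)

/-- The interaction function seen from `x` with an additional void constraint in `B`. -/
def voidF (x : α) (B : Set α) (y : α) : ℝ := Bᶜ.indicator (fun y => I.g x y) y - 1

lemma measurable_voidF (x : α) {B : Set α} (hB : MeasurableSet B) : Measurable (I.voidF x B) :=
  ((I.meas.comp measurable_prodMk_left).indicator hB.compl).sub measurable_const

lemma voidF_abs_le (x : α) (B : Set α) (y : α) : |I.voidF x B y| ≤ I.b + 1 := by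
  unfold voidF
  by_cases hy : y ∈ B
  · simp only [mem_compl_iff, hy, not_true_eq_false, not_false_eq_true, indicator_of_notMem]
    have := I.b_pos
    norm_num
    exact this.le
  · simpa [hy] using I.g_sub_one_abs_le x y

lemma lintegral_abs_voidF_lt_top (x : α) {B : Set α} (hB : MeasurableSet B) (hfin : I.ν B < ⊤) :
    ∫⁻ y, ENNReal.ofReal |I.voidF x B y| ∂I.ν < ⊤ := by
  have h1 : ∀ y, ENNReal.ofReal |I.voidF x B y|
      ≤ ENNReal.ofReal |I.g x y - 1| + B.indicator 1 y := by
    intro y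
    unfold voidF
    by_cases hy : y ∈ B
    · simp [hy]
    · simp [hy]
  refine (lintegral_mono h1).trans_lt ?_
  rw [lintegral_add_left (I.measurable_f x).abs.ennreal_ofReal, lintegral_indicator_one hB]
  exact ENNReal.add_lt_top.2 ⟨I.lintegral_abs_f_lt_top x, hfin⟩

lemma integral_void_corr (x : α) {B : Set α} (hB : MeasurableSet B) (hfin : I.ν B < ⊤) :
    ∫ u, ((ms u).map fun y => -B.indicator 1 y).prod * I.corr univ ({x} + ms u) ∂tupMeas I.ν
      = I.z * ∫ u, ((ms u).map (I.voidF x B)).prod * I.corr univ (ms u) ∂tupMeas I.ν := by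
  set K : Multiset α → Multiset α → ℝ := fun t r =>
    (t.map fun y => -B.indicator 1 y * I.g x y).prod *
      ((r.map fun y => I.g x y - 1).prod * I.corr univ (t + r)) with hK
  have hg : Measurable fun y => I.g x y := I.meas.comp measurable_prodMk_left
  have hind : Measurable fun y : α => B.indicator (1 : α → ℝ) y := measurable_one.indicator hB
  have hw : Measurable fun y => -B.indicator 1 y * I.g x y := hind.neg.mul hg
  have hcm : Measurable fun p : Tup α × Tup α => I.corr univ (ms p.1 + ms p.2) := by
    have h := I.measurable_corr_add_add MeasurableSet.univ 0
    simpa using h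
  have hKm : Measurable fun p : Tup α × Tup α => K (ms p.1) (ms p.2) :=
    ((measurable_map_prod' hw).comp measurable_fst).mul
      (((measurable_map_prod' (I.measurable_f x)).comp measurable_snd).mul hcm)
  have hwi : ∫⁻ y, ENNReal.ofReal |-B.indicator 1 y * I.g x y| ∂I.ν < ⊤ := by
    have := lintegral_abs_indicator_mul_lt_top I.ν hB hfin (h := fun y => I.g x y) (C := I.b)
      (fun y => by rw [abs_of_nonneg (I.nonneg x y)]; exact I.g_le x y)
    simpa only [neg_mul, abs_neg] using this
  have hf : ∫⁻ t, ∫⁻ r, ENNReal.ofReal |K (ms t) (ms r)| ∂tupMeas I.ν ∂tupMeas I.ν < ⊤ := by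
    refine lintegral_lintegral_lt_top_of_le (tupMeas I.ν)
      (F := fun t => ((ms t).map fun y => I.ξ * (-B.indicator 1 y * I.g x y)).prod)
      (G := fun r => ((ms r).map fun y => I.ξ * (I.g x y - 1)).prod)
      (measurable_map_prod' (hw.const_mul _)) (measurable_map_prod' ((I.measurable_f x).const_mul _))
      (lintegral_abs_map_prod_lt_top I.ν (hw.const_mul _)
        (I.lintegral_const_mul_abs_lt_top hw hwi _))
      (lintegral_abs_map_prod_lt_top I.ν ((I.measurable_f x).const_mul _)
        (I.lintegral_const_mul_abs_lt_top (I.measurable_f x) (I.lintegral_abs_f_lt_top x) _))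
      fun t r => ?_
    rw [← pow_card_mul_map_prod_real, ← pow_card_mul_map_prod_real, hK]
    dsimp only
    rw [abs_mul, abs_mul, abs_mul (I.ξ ^ _), abs_mul (I.ξ ^ _), abs_of_pos (pow_pos I.ξ_pos _),
      abs_of_pos (pow_pos I.ξ_pos _)]
    have h3 := I.abs_corr_le univ (ms t + ms r)
    rw [Multiset.card_add, pow_add] at h3
    calc _ ≤ |((ms t).map fun y => -B.indicator 1 y * I.g x y).prod| *
          (|((ms r).map fun y => I.g x y - 1).prod| *
            (I.ξ ^ (ms t).card * I.ξ ^ (ms r).card)) := by gcongr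
      _ = _ := by ring
  obtain ⟨h1, _, h3⟩ := integrable_splitSum I.ν hKm hf
  have h4 : ∫ u, ((ms u).map (I.voidF x B)).prod * I.corr univ (ms u) ∂tupMeas I.ν
      = ∫ l, splitSum K (ms l) ∂tupMeas I.ν := by
    refine integral_congr_ae (Filter.Eventually.of_forall fun l => ?_)
    dsimp only
    have e : I.voidF x B = fun y => -B.indicator 1 y * I.g x y + (I.g x y - 1) := by
      funext y
      unfold voidF
      by_cases hy : y ∈ B
      · simp [hy]
        ring
      · simp [hy]
    rw [e, prod_add_eq_splitSum, mul_comm, ← splitSum_mul_left]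
    refine splitSum_congr (R := ℝ) fun t r hl => ?_
    rw [hK, ← hl]
    dsimp only
    ring
  rw [h4, h3, integral_prod _ h1, ← integral_const_mul]
  refine integral_congr_ae (Filter.Eventually.of_forall fun t => ?_)
  dsimp only [hK]
  rw [integral_const_mul, Multiset.singleton_add, I.corr_cons MeasurableSet.univ,
    Multiset.prod_map_mul]
  simp only [ind_univ, one_mul]
  ring

lemma tendsto_integral_ind_prod_corr {w : α → ℝ} (hw : Measurable w)
    (h : ∫⁻ y, ENNReal.ofReal |w y| ∂I.ν < ⊤) {S : ℕ → Set α} (hS : Monotone S)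
    (hSm : ∀ n, MeasurableSet (S n)) (hU : ⋃ n, S n = univ) :
    Tendsto (fun n => ∫ u, ind (S n) (ms u) * ((ms u).map w).prod * I.corr univ (ms u)
        ∂tupMeas I.ν) atTop
      (𝓝 (∫ u, ((ms u).map w).prod * I.corr univ (ms u) ∂tupMeas I.ν)) := by
  refine tendsto_integral_of_dominated_convergence
    (fun u => |((ms u).map w).prod * I.corr univ (ms u)|)
    (fun n => (((measurable_ind (hSm n)).mul (measurable_map_prod' hw)).mul
      (I.measurable_corr MeasurableSet.univ)).aestronglyMeasurable)
    (I.integrable_prod_corr MeasurableSet.univ hw h).abs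
    (fun n => Filter.Eventually.of_forall fun l => ?_)
    (Filter.Eventually.of_forall fun l => ?_)
  · rw [Real.norm_eq_abs, mul_assoc, abs_mul, abs_of_nonneg (ind_nonneg _ _)]
    exact mul_le_of_le_one_left (abs_nonneg _) (ind_le_one _ _)
  · refine tendsto_const_nhds.congr' ?_
    filter_upwards [eventually_ind_eq univ hS hU (ms l)] with n hn
    rw [univ_inter] at hn
    rw [hn]
    simp

end Interaction

end Ruelle

/-! ### Cluster functions -/

namespace Ruelle

lemma integral_splitSum_left {α T : Type} [MeasurableSpace T] {m : Measure T}
    {F : Multiset α → Multiset α → T → ℝ} {s : Multiset α}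
    (hF : ∀ t r, t + r = s → Integrable (F t r) m) :
    Integrable (fun w => splitSum (fun t r => F t r w) s) m ∧
      ∫ w, splitSum (fun t r => F t r w) s ∂m = splitSum (fun t r => ∫ w, F t r w ∂m) s := by
  induction s using Multiset.induction generalizing F with
  | empty =>
    have := hF 0 0 (by simp)
    simpa [splitSum] using this
  | cons a s ih =>
    simp only [splitSum_cons]
    obtain ⟨h1, h2⟩ := ih (F := fun t r => F t (a ::ₘ r)) fun t r h =>
      hF _ _ (by rw [Multiset.add_cons, h])
    obtain ⟨h3, h4⟩ := ih (F := fun t r => F (a ::ₘ t) r) fun t r h =>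
      hF _ _ (by rw [Multiset.cons_add, h])
    refine ⟨h1.add h3, ?_⟩
    rw [integral_add h1 h3, h2, h4]

lemma splitSum_comp_add {α : Type} (F : Multiset α → ℝ≥0∞) (s : Multiset α) :
    splitSum (fun t r => F (t + r)) s = 2 ^ s.card * F s := by
  rw [splitSum_congr (K' := fun _ _ => F s) fun t r h => by rw [h]]
  simp [splitSum, Multiset.map_const', Multiset.sum_replicate]

namespace Interaction

variable {α : Type} [MeasurableSpace α] (I : Interaction α)

lemma measurable_relFn_comp_add (X : Multiset α) :
    Measurable fun p : Tup α × Tup α => relFn I.ψ X (ms p.1 + ms p.2) := by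
  have h := (I.measurable_relFn_right X).comp measurable_tapp
  simpa [Function.comp_def] using h

lemma lintegral_lintegral_relFn_add_le (X : Multiset α) :
    ∫⁻ t, ∫⁻ w, ENNReal.ofReal |relFn I.ψ X (ms t + ms w)| ∂tupMeas I.ν ∂tupMeas I.ν
      ≤ ENNReal.ofReal I.ξ ^ X.card := by
  rw [← lintegral_splitSum I.ν (K := fun t w => ENNReal.ofReal |relFn I.ψ X (t + w)|)
    (I.measurable_relFn_comp_add X).abs.ennreal_ofReal]
  refine le_trans (le_of_eq (lintegral_congr fun l => ?_)) (I.lintegral_relFn_le X)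
  rw [splitSum_comp_add (fun s => ENNReal.ofReal |relFn I.ψ X s|), card_ms]

/-- Summability of the cluster expansion at `t`. -/
def ClusterFinite (X t : Multiset α) : Prop :=
  ∫⁻ w, ENNReal.ofReal |relFn I.ψ X (t + ms w)| ∂tupMeas I.ν < ⊤

lemma ae_clusterFinite (X : Multiset α) :
    ∀ᵐ l ∂tupMeas I.ν, ∀ t r, t + r = ms l → I.ClusterFinite X t := by
  have hm : Measurable fun t : Tup α =>
      ∫⁻ w, ENNReal.ofReal |relFn I.ψ X (ms t + ms w)| ∂tupMeas I.ν :=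
    (I.measurable_relFn_comp_add X).abs.ennreal_ofReal.lintegral_prod_right'
  set b : Multiset α → ℝ≥0∞ := fun t => if I.ClusterFinite X t then 0 else 1 with hb
  have hbm : Measurable fun t : Tup α => b (ms t) := by
    refine Measurable.ite ?_ measurable_const measurable_const
    exact measurableSet_lt hm measurable_const
  have h0 : ∀ᵐ t ∂tupMeas I.ν, b (ms t) = 0 := by
    have h := ae_lt_top hm ((I.lintegral_lintegral_relFn_add_le X).trans_lt
      (ENNReal.pow_lt_top ENNReal.ofReal_lt_top)).ne
    filter_upwards [h] with t ht
    exact if_pos ht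
  have hKm : Measurable fun p : Tup α × Tup α => (fun t _ => b t : Multiset α → Multiset α → ℝ≥0∞)
      (ms p.1) (ms p.2) := hbm.comp measurable_fst
  have h1 : ∫⁻ l, splitSum (fun t _ => b t) (ms l) ∂tupMeas I.ν = 0 := by
    rw [lintegral_splitSum I.ν hKm, lintegral_eq_zero_iff' (by
      simp only [lintegral_const]
      exact (hbm.mul_const _).aemeasurable)]
    filter_upwards [h0] with t ht
    simp [ht]
  rw [lintegral_eq_zero_iff (measurable_splitSum' hKm)] at h1
  filter_upwards [h1] with l hl t r htr
  have h2 : b t = 0 := by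
    have h3 : splitSum (fun t _ => b t) (ms l) = 0 := hl
    unfold splitSum at h3
    rw [Multiset.sum_eq_zero_iff] at h3
    exact h3 _ (Multiset.mem_map.2 ⟨(t, r), Multiset.mem_antidiagonal.2 htr, rfl⟩)
  by_contra hc
  rw [hb] at h2
  simp [hc] at h2

/-- The cluster expansion of the Ursell functions. -/
def clusterFn (X t : Multiset α) : ℝ := ∫ w, relFn I.ψ X (t + ms w) ∂tupMeas I.ν

lemma corr_cons_eq_splitSum {x : α} {s : Multiset α}
    (hs : ∀ t r, t + r = s → I.ClusterFinite {x} t) :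
    I.corr univ (x ::ₘ s) = splitSum (fun t r => I.clusterFn {x} t * I.corr univ r) s := by
  have hadd : ∀ t : Multiset α, Measurable fun w : Tup α => relFn I.ψ {x} (t + ms w) := by
    intro t
    obtain ⟨lt, rfl⟩ := exists_ms_eq t
    have h := (I.measurable_relFn_comp_add {x}).comp
      (measurable_prodMk_left : Measurable fun l : Tup α => (lt, l))
    simpa [Function.comp_def] using h
  have key : ∀ t r, t + r = s →
      Integrable (fun w : Tup α => splitSum (fun w1 w2 => relFn I.ψ {x} (t + w1) * relFn I.ψ r w2)
        (ms w)) (tupMeas I.ν) ∧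
      ∫ w, splitSum (fun w1 w2 => relFn I.ψ {x} (t + w1) * relFn I.ψ r w2) (ms w) ∂tupMeas I.ν
        = I.clusterFn {x} t * I.corr univ r := by
    intro t r htr
    obtain ⟨_, h2, h3⟩ := integrable_splitSum I.ν
      (K := fun w1 w2 => relFn I.ψ {x} (t + w1) * relFn I.ψ r w2)
      (((hadd t).comp measurable_fst).mul ((I.measurable_relFn_right r).comp measurable_snd))
      (lintegral_lintegral_lt_top_of_le (tupMeas I.ν)
        (F := fun w => relFn I.ψ {x} (t + ms w)) (G := fun w => relFn I.ψ r (ms w))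
        (hadd t) (I.measurable_relFn_right r) (hs t r htr)
        ((I.lintegral_abs_relFn_le r).trans_lt (ENNReal.pow_lt_top ENNReal.ofReal_lt_top))
        fun t' r' => (abs_mul _ _).le)
    refine ⟨h2, ?_⟩
    rw [h3]
    have h4 := integral_prod_mul (μ := tupMeas I.ν) (ν := tupMeas I.ν)
      (fun w : Tup α => relFn I.ψ {x} (t + ms w)) (fun w : Tup α => relFn I.ψ r (ms w))
    rw [h4]
    simp [clusterFn, corr]
  have h5 := (integral_splitSum_left (m := tupMeas I.ν)
    (F := fun t r (w : Tup α) => splitSum (fun w1 w2 => relFn I.ψ {x} (t + w1) * relFn I.ψ r w2)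
      (ms w)) (s := s) fun t r h => (key t r h).1).2
  calc I.corr univ (x ::ₘ s) = _ := by
        unfold corr
        refine Eq.trans (integral_congr_ae (Filter.Eventually.of_forall fun w => ?_)) h5
        dsimp only
        rw [ind_univ, one_mul, relFn_cons_eq_conv I.ψ_zero]
    _ = _ := splitSum_congr (R := ℝ) fun t r h => (key t r h).2

/-- The algebraically defined Ursell function. -/
def urs (x : α) (s : Multiset α) : ℝ := relFn (I.corr univ) {x} s

lemma corr_cons_eq_urs (x : α) (s : Multiset α) :
    I.corr univ (x ::ₘ s) = splitSum (fun t r => I.urs x t * I.corr univ r) s := by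
  have h := congrFun (conv_relFn (I.corr_zero MeasurableSet.univ) {x}) s
  rw [conv_comm, Multiset.singleton_add] at h
  exact h.symm

lemma urs_eq_clusterFn {x : α} {s : Multiset α}
    (hs : ∀ t r, t + r = s → I.ClusterFinite {x} t) : I.urs x s = I.clusterFn {x} s := by
  have h1 : I.urs x s = conv (convInv (I.corr univ)) (conv (I.corr univ) (I.clusterFn {x})) s := by
    unfold urs relFn
    refine splitSum_congr (R := ℝ) fun t r h => ?_
    dsimp only
    rw [Multiset.singleton_add, conv_comm (I.corr univ)]
    rw [I.corr_cons_eq_splitSum (s := r) fun t' r' h' => hs t' (r' + t) (by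
      rw [← h, ← h']
      abel)]
    rfl
  rw [h1, ← conv_assoc, conv_comm (convInv _), conv_convInv (I.corr_zero MeasurableSet.univ),
    convOne_conv]

lemma measurable_urs (x : α) : Measurable fun l : Tup α => I.urs x (ms l) := by
  have h := (measurable_relFn (I.measurable_corr MeasurableSet.univ)).comp
    (measurable_prodMk_left : Measurable fun l : Tup α => (tcons x tnil, l))
  simpa [Function.comp_def, urs] using h

lemma lintegral_urs_le (x : α) :
    ∫⁻ l, ENNReal.ofReal |I.urs x (ms l)| ∂tupMeas I.ν ≤ ENNReal.ofReal I.ξ := by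
  have h := I.lintegral_lintegral_relFn_add_le {x}
  rw [Multiset.card_singleton, pow_one] at h
  refine le_trans (lintegral_mono_ae ?_) h
  filter_upwards [I.ae_clusterFinite {x}] with l hl
  rw [I.urs_eq_clusterFn hl, clusterFn, ← Real.enorm_eq_ofReal_abs]
  refine (enorm_integral_le_lintegral_enorm _).trans (le_of_eq ?_)
  simp only [Real.enorm_eq_ofReal_abs]

lemma integrable_urs (x : α) (n : ℕ) :
    Integrable (fun y : Fin n → α => I.urs x (ms ⟨n, y⟩)) (Measure.pi fun _ => I.ν) := by
  refine ⟨((I.measurable_urs x).comp (measurable_sigmaMk n)).aestronglyMeasurable, ?_⟩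
  rw [hasFiniteIntegral_iff_norm]
  have h := I.lintegral_urs_le x
  rw [lintegral_tup] at h
  have h1 := (ENNReal.le_tsum n).trans h
  by_contra hc
  rw [not_lt, top_le_iff] at hc
  simp only [Real.norm_eq_abs] at hc
  rw [hc, ENNReal.mul_top (by simp)] at h1
  exact absurd h1 (by simp)

/-- Invariance of the infinite volume correlation functions. -/
lemma corr_map {τ : α → α} (hτ : MeasurePreserving τ I.ν I.ν)
    (hg : ∀ x y, I.g (τ x) (τ y) = I.g x y) (X : Multiset α) :
    I.corr univ (X.map τ) = I.corr univ X := by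
  have hψ : ∀ s : Multiset α, I.ψ (s.map τ) = I.ψ s := by
    intro s
    induction s using Multiset.induction with
    | empty => simp
    | cons x s ih =>
      rw [Multiset.map_cons, ψ_cons, ψ_cons, ih, Multiset.map_map]
      simp only [Function.comp_def, hg]
  unfold corr
  simp only [ind_univ, one_mul]
  have hmp := measurePreserving_tmap I.ν hτ
  rw [← hmp.map_eq, integral_map hmp.measurable.aemeasurable
    (I.measurable_relFn_right _).aestronglyMeasurable, hmp.map_eq]
  refine integral_congr_ae (Filter.Eventually.of_forall fun w => ?_)
  dsimp only
  rw [ms_tmap, relFn_map hψ]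

end Interaction

end Ruelle

/-! ### Ursell functions and partitions -/

namespace Ruelle

lemma splitSum_val {ι R : Type*} [DecidableEq ι] [AddCommMonoid R]
    (K : Multiset ι → Multiset ι → R) (S : Finset ι) :
    splitSum K S.val = ∑ t ∈ S.powerset, K t.val (S \ t).val := by
  induction S using Finset.induction generalizing K with
  | empty => simp
  | insert a S ha ih =>
    rw [Finset.sum_powerset_insert ha, Finset.insert_val_of_notMem ha, splitSum_cons, ih, ih]
    congr 1
    · refine Finset.sum_congr rfl fun t ht => ?_
      have hat : a ∉ t := fun h => ha (Finset.mem_powerset.1 ht h)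
      rw [Finset.insert_sdiff_of_notMem _ hat,
        Finset.insert_val_of_notMem (by simp [ha])]
    · refine Finset.sum_congr rfl fun t ht => ?_
      have hat : a ∉ t := fun h => ha (Finset.mem_powerset.1 ht h)
      rw [Finset.insert_sdiff_insert, Finset.sdiff_insert_of_notMem ha,
        Finset.insert_val_of_notMem hat]

/-- `P` is a partition of the finite set `S` into nonempty pairwise disjoint blocks. -/
def IsPart {n : ℕ} (P : Finset (Finset (Fin n))) (S : Finset (Fin n)) : Prop :=
  (∀ b ∈ P, b.Nonempty) ∧ (P : Set (Finset (Fin n))).PairwiseDisjoint id ∧ P.sup id = S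

section Partitions

variable {n : ℕ}

lemma IsPart.subset {P : Finset (Finset (Fin n))} {S b : Finset (Fin n)} (h : IsPart P S)
    (hb : b ∈ P) : b ⊆ S := by
  rw [← h.2.2]
  exact Finset.le_sup (f := id) hb

lemma isPart_empty_iff {P : Finset (Finset (Fin n))} : IsPart P ∅ ↔ P = ∅ := by
  refine ⟨fun h => ?_, ?_⟩
  · refine Finset.eq_empty_of_forall_notMem fun b hb => ?_
    exact (h.1 b hb).ne_empty (Finset.subset_empty.1 (h.subset hb))
  · rintro rfl
    exact ⟨by simp, by simp, by simp⟩

lemma IsPart.eq_of_mem {P : Finset (Finset (Fin n))} {S b b' : Finset (Fin n)} {m : Fin n}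
    (h : IsPart P S) (hb : b ∈ P) (hb' : b' ∈ P) (hm : m ∈ b) (hm' : m ∈ b') : b = b' := by
  by_contra hne
  exact Finset.disjoint_left.1 (h.2.1 hb hb' hne) hm hm'

/-- Adding a disjoint block to a partition. -/
lemma IsPart.insert_block {P : Finset (Finset (Fin n))} {S b : Finset (Fin n)}
    (h : IsPart P S) (hb : b.Nonempty) (hd : Disjoint b S) :
    b ∉ P ∧ IsPart (insert b P) (b ∪ S) := by
  refine ⟨fun hbP => ?_, ?_, ?_, ?_⟩
  · obtain ⟨m, hm⟩ := hb
    exact Finset.disjoint_left.1 hd hm (h.subset hbP hm)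
  · intro c hc
    rcases Finset.mem_insert.1 hc with rfl | hc
    exacts [hb, h.1 c hc]
  · rw [Finset.coe_insert, Set.pairwiseDisjoint_insert]
    exact ⟨h.2.1, fun c hc _ => Disjoint.mono_right (h.subset hc) hd⟩
  · rw [Finset.sup_insert, h.2.2]
    rfl

/-- Removing a block from a partition. -/
lemma IsPart.erase_block {P : Finset (Finset (Fin n))} {S b : Finset (Fin n)}
    (h : IsPart P S) (hb : b ∈ P) : IsPart (P.erase b) (S \ b) := by
  refine ⟨fun c hc => h.1 c (Finset.mem_of_mem_erase hc),
    h.2.1.subset (by simp), ?_⟩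
  ext i
  simp only [Finset.mem_sup, Finset.mem_erase, id, Finset.mem_sdiff]
  constructor
  · rintro ⟨c, ⟨hcb, hc⟩, hi⟩
    exact ⟨h.subset hc hi, fun hib => hcb (h.eq_of_mem hc hb hi hib)⟩
  · rintro ⟨hi, hib⟩
    rw [← h.2.2, Finset.mem_sup] at hi
    obtain ⟨c, hc, hi⟩ := hi
    exact ⟨c, ⟨fun hcb => hib (hcb ▸ hi), hc⟩, hi⟩

lemma sum_isPart_insert (f : Finset (Fin n) → ℝ) {m : Fin n} {S : Finset (Fin n)} (hm : m ∉ S) :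
    (∑ P : Finset (Finset (Fin n)), if IsPart P (insert m S) then ∏ b ∈ P, f b else 0)
      = ∑ t ∈ S.powerset, f (insert m t) *
          ∑ P : Finset (Finset (Fin n)), if IsPart P (S \ t) then ∏ b ∈ P, f b else 0 := by
  simp only [Finset.mul_sum, ← Finset.sum_filter]
  rw [Finset.sum_sigma']
  symm
  refine Finset.sum_bij (fun a _ => insert (insert m a.1) a.2) ?_ ?_ ?_ ?_
  · rintro ⟨t, P⟩ h
    simp only [Finset.mem_sigma, Finset.mem_powerset, Finset.mem_filter, Finset.mem_univ,
      true_and] at h ⊢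
    have hd : Disjoint (insert m t) (S \ t) := by
      rw [Finset.disjoint_insert_left]
      exact ⟨by simp [hm], Finset.disjoint_sdiff⟩
    have := (h.2.insert_block (Finset.insert_nonempty m t) hd).2
    rwa [Finset.insert_union, Finset.union_sdiff_of_subset h.1] at this
  · rintro ⟨t, P⟩ h ⟨t', P'⟩ h' heq
    simp only [Finset.mem_sigma, Finset.mem_powerset, Finset.mem_filter, Finset.mem_univ,
      true_and] at h h' heq
    have key : ∀ {t P}, t ⊆ S → IsPart P (S \ t) → ∀ c ∈ P, m ∉ c := fun ht hP c hc hmc =>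
      hm (Finset.mem_sdiff.1 (hP.subset hc hmc)).1
    have hb : insert m t ∈ insert (insert m t') P' := heq ▸ Finset.mem_insert_self _ _
    have h1 : insert m t = insert m t' := by
      rcases Finset.mem_insert.1 hb with h1 | h1
      · exact h1
      · exact absurd (Finset.mem_insert_self m t) (key h'.1 h'.2 _ h1)
    have h2 : t = t' := by
      rw [← Finset.erase_insert (fun h0 => hm (h.1 h0)), h1,
        Finset.erase_insert (fun h0 => hm (h'.1 h0))]
    subst h2
    have h3 : P = P' := by
      rw [← Finset.erase_insert (fun h0 => key h.1 h.2 _ h0 (Finset.mem_insert_self m t)), heq,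
        Finset.erase_insert (fun h0 => key h'.1 h'.2 _ h0 (Finset.mem_insert_self m t))]
    rw [h3]
  · intro P hP
    simp only [Finset.mem_filter, Finset.mem_univ, true_and] at hP
    have hmS : m ∈ P.sup id := hP.2.2 ▸ Finset.mem_insert_self m S
    obtain ⟨b, hb, hmb⟩ := Finset.mem_sup.1 hmS
    have hmb' : m ∈ b := hmb
    have hbS := hP.subset hb
    refine ⟨⟨b.erase m, P.erase b⟩, ?_, ?_⟩
    · simp only [Finset.mem_sigma, Finset.mem_powerset, Finset.mem_filter, Finset.mem_univ,
        true_and]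
      refine ⟨fun i hi => ?_, ?_⟩
      · rcases Finset.mem_insert.1 (hbS (Finset.mem_of_mem_erase hi)) with rfl | h
        · exact absurd rfl (Finset.ne_of_mem_erase hi)
        · exact h
      · have := hP.erase_block hb
        convert this using 1
        ext i
        simp only [Finset.mem_sdiff, Finset.mem_erase, Finset.mem_insert]
        constructor
        · rintro ⟨h1, h2⟩
          exact ⟨Or.inr h1, fun h3 => h2 ⟨fun h4 => hm (h4 ▸ h1), h3⟩⟩
        · rintro ⟨h1 | h1, h2⟩
          · exact absurd (h1 ▸ hmb') h2
          · exact ⟨h1, fun h3 => h2 h3.2⟩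
    · simp only
      rw [Finset.insert_erase hmb', Finset.insert_erase hb]
  · rintro ⟨t, P⟩ h
    simp only [Finset.mem_sigma, Finset.mem_powerset, Finset.mem_filter, Finset.mem_univ,
      true_and] at h
    have hd : Disjoint (insert m t) (S \ t) := by
      rw [Finset.disjoint_insert_left]
      exact ⟨by simp [hm], Finset.disjoint_sdiff⟩
    rw [Finset.prod_insert (h.2.insert_block (Finset.insert_nonempty m t) hd).1]

variable {α : Type}

/-- The block weight obtained from a function of a distinguished point and the other points, the
distinguished point being the one with the smallest index. -/
def blockFn (U : α → Multiset α → ℝ) (x : Fin n → α) (b : Finset (Fin n)) : ℝ :=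
  if h : b.Nonempty then U (x (b.min' h)) ((b.erase (b.min' h)).val.map x) else 0

lemma eq_sum_isPart {K : Multiset α → ℝ} {U : α → Multiset α → ℝ} (h0 : K 0 = 1)
    (hK : ∀ a s, K (a ::ₘ s) = splitSum (fun t r => U a t * K r) s) (x : Fin n → α)
    (S : Finset (Fin n)) :
    K (S.val.map x)
      = ∑ P : Finset (Finset (Fin n)), if IsPart P S then ∏ b ∈ P, blockFn U x b else 0 := by
  induction S using Finset.strongInduction with
  | H S ih =>
    rcases S.eq_empty_or_nonempty with rfl | hS
    · simp [h0, isPart_empty_iff]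
    · have hmem := S.min'_mem hS
      set m := S.min' hS with hm
      set S' := S.erase m with hS'
      have hmS : m ∉ S' := Finset.notMem_erase _ _
      have hins : insert m S' = S := Finset.insert_erase hmem
      rw [← hins, sum_isPart_insert _ hmS, Finset.insert_val_of_notMem hmS, Multiset.map_cons, hK,
        splitSum_map, splitSum_val]
      refine Finset.sum_congr rfl fun t ht => ?_
      rw [Finset.mem_powerset] at ht
      have hmt : m ∉ t := fun h => hmS (ht h)
      have hss : S' \ t ⊂ S :=
        (Finset.ssubset_of_subset_of_ssubset Finset.sdiff_subset (Finset.erase_ssubset hmem))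
      rw [ih _ hss]
      congr 1
      have hmin : (insert m t).min' (Finset.insert_nonempty m t) = m := by
        refine le_antisymm (Finset.min'_le _ _ (Finset.mem_insert_self m t)) ?_
        refine Finset.le_min' _ _ _ fun i hi => ?_
        rcases Finset.mem_insert.1 hi with rfl | hi
        · exact le_rfl
        · exact Finset.min'_le _ _ (Finset.mem_of_mem_erase (ht hi))
      rw [blockFn, dif_pos (Finset.insert_nonempty m t), hmin, Finset.erase_insert hmt]

/-- The functions of ordered tuples attached to a function of a distinguished point and the other
points. -/
def tupleFn (U : α → Multiset α → ℝ) : ∀ n : ℕ, (Fin n → α) → ℝ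
  | 0, _ => 0
  | n + 1, x => U (x 0) (ms (⟨n, Fin.tail x⟩ : Tup α))

lemma ms_eq_map_univ (x : Fin n → α) :
    ms (⟨n, x⟩ : Tup α) = (Finset.univ : Finset (Fin n)).val.map x := by
  rw [Fin.univ_val_map]
  rfl

lemma tupleFn_orderIsoOfFin (U : α → Multiset α → ℝ) (x : Fin n → α) {b : Finset (Fin n)}
    (hb : b.Nonempty) {k : ℕ} (hk : b.card = k) :
    tupleFn U k (fun i => x (b.orderIsoOfFin hk i).1) = blockFn U x b := by
  cases k with
  | zero => exact absurd hk (Finset.card_pos.2 hb).ne'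
  | succ k =>
    have h0 : (b.orderIsoOfFin hk 0).1 = b.min' hb := b.orderEmbOfFin_zero hk k.succ_pos
    rw [blockFn, dif_pos hb, tupleFn, h0]
    congr 1
    have h1 : b.val = (b.orderIsoOfFin hk 0).1 ::ₘ
        ms (⟨k, Fin.tail fun i => (b.orderIsoOfFin hk i).1⟩ : Tup (Fin n)) := by
      rw [← ms_mk_succ (fun i => (b.orderIsoOfFin hk i).1), ms_eq_map_univ]
      conv_lhs => rw [← b.map_orderEmbOfFin_univ hk]
      rfl
    rw [Finset.erase_val, h1, ← h0, Multiset.erase_cons_head, ← ms_tmap]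
    rfl

lemma eq_sum_isPartOfUniv {K : Multiset α → ℝ} {U : α → Multiset α → ℝ} (h0 : K 0 = 1)
    (hK : ∀ a s, K (a ::ₘ s) = splitSum (fun t r => U a t * K r) s) (x : Fin n → α) :
    K (ms (⟨n, x⟩ : Tup α))
      = ∑ P : Finset (Finset (Fin n)), if IsPartOfUniv P then
          ∏ b ∈ P, tupleFn U b.card (fun i => x (b.orderIsoOfFin rfl i).1) else 0 := by
  rw [ms_eq_map_univ, eq_sum_isPart h0 hK]
  refine Finset.sum_congr rfl fun P _ => ?_
  by_cases hP : IsPartOfUniv P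
  · rw [if_pos hP, if_pos (show IsPart P Finset.univ from hP)]
    exact Finset.prod_congr rfl fun b hb => (tupleFn_orderIsoOfFin U x (hP.1 b hb) rfl).symm
  · rw [if_neg hP, if_neg (show ¬ IsPart P Finset.univ from hP)]

end Partitions

end Ruelle

/-! ### The interaction of a pair potential -/

namespace Ruelle

section Potential

variable {d : ℕ}

/-- The Mayer weight `e^{-φ(x - y)}`, set to `0` on the diagonal. -/
def bweight (φ : EucSp d → EReal) (x y : EucSp d) : ℝ :=
  if x = y then 0 else Real.exp (-(φ (x - y)).toReal)

variable {φ : EucSp d → EReal}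

lemma coe_toReal_off (hφ : IsPairPotential φ) {x : EucSp d} (hx : x ≠ 0) :
    ((φ x).toReal : EReal) = φ x := EReal.coe_toReal (hφ.finite_off x hx) (hφ.ne_bot x)

lemma rexp_neg_of_ne (hφ : IsPairPotential φ) {x : EucSp d} (hx : x ≠ 0) :
    rexp (-(φ x)) = Real.exp (-(φ x).toReal) := by
  rw [← coe_toReal_off hφ hx, ← EReal.coe_neg, rexp, eexp, if_neg (EReal.coe_ne_top _),
    if_neg (EReal.coe_ne_bot _), EReal.toReal_coe, EReal.toReal_coe,
    ENNReal.toReal_ofReal (Real.exp_pos _).le]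

lemma volume_singleton_eq_zero (hd : 0 < d) (x : EucSp d) : volume ({x} : Set (EucSp d)) = 0 := by
  have : Nonempty (Fin d) := ⟨⟨0, hd⟩⟩
  have : Nontrivial (EucSp d) := inferInstance
  exact measure_singleton x

lemma coe_finset_sum_ereal {ι : Type*} (s : Finset ι) (f : ι → ℝ) :
    ((∑ i ∈ s, f i : ℝ) : EReal) = ∑ i ∈ s, (f i : EReal) := by
  induction s using Finset.induction with
  | empty => simp
  | insert a s ha ih => rw [Finset.sum_insert ha, Finset.sum_insert ha, EReal.coe_add, ih]

lemma exists_prod_bweight_le (hφ : IsPairPotential φ) {B : ℝ} (hS : Stable φ B)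
    (X : Multiset (EucSp d)) (hX : X ≠ 0) :
    ∃ x X', X = x ::ₘ X' ∧ (X'.map (bweight φ x)).prod ≤ Real.exp (2 * B) := by
  by_cases hn : X.Nodup
  · set η : Finset (EucSp d) := ⟨X, hn⟩ with hη
    have hne : η.Nonempty := Finset.nonempty_of_ne_empty fun h => hX (by
      simpa [hη] using congrArg Finset.val h)
    have h1 : ∑ p ∈ η.offDiag, φ (p.1 - p.2)
        = ((∑ p ∈ η.offDiag, (φ (p.1 - p.2)).toReal : ℝ) : EReal) := by
      rw [coe_finset_sum_ereal]
      refine Finset.sum_congr rfl fun p hp => ?_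
      rw [coe_toReal_off hφ (sub_ne_zero.2 (Finset.mem_offDiag.1 hp).2.2)]
    have h2 := hS η
    rw [h1, EReal.coe_le_coe_iff] at h2
    have h3 : ∑ p ∈ η.offDiag, (φ (p.1 - p.2)).toReal
        = ∑ x ∈ η, ∑ y ∈ η.erase x, (φ (x - y)).toReal := by
      rw [Finset.sum_sigma']
      refine Finset.sum_bij' (fun p _ => ⟨p.1, p.2⟩) (fun p _ => (p.1, p.2)) ?_ ?_ ?_ ?_ ?_
      · intro p hp
        simp only [Finset.mem_offDiag] at hp
        simp [hp.1, hp.2.1, Ne.symm hp.2.2]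
      · rintro ⟨x, y⟩ h
        simp only [Finset.mem_sigma, Finset.mem_erase] at h
        simp [h.1, h.2.2, Ne.symm h.2.1]
      · simp
      · simp
      · simp
    rw [h3] at h2
    obtain ⟨x, hx, hle⟩ : ∃ x ∈ η, -(2 * B) ≤ ∑ y ∈ η.erase x, (φ (x - y)).toReal := by
      refine Finset.exists_le_of_sum_le hne ?_
      rw [Finset.sum_const, nsmul_eq_mul]
      linarith
    refine ⟨x, X.erase x, (Multiset.cons_erase hx).symm, ?_⟩
    have h4 : ((X.erase x).map (bweight φ x)).prod = ∏ y ∈ η.erase x, bweight φ x y := rfl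
    rw [h4]
    have h5 : ∏ y ∈ η.erase x, bweight φ x y
        = Real.exp (-∑ y ∈ η.erase x, (φ (x - y)).toReal) := by
      rw [← Finset.sum_neg_distrib, Real.exp_sum]
      refine Finset.prod_congr rfl fun y hy => ?_
      rw [bweight, if_neg (Finset.ne_of_mem_erase hy).symm]
    rw [h5]
    exact Real.exp_le_exp.2 (by linarith)
  · obtain ⟨x, hx⟩ : ∃ x, 2 ≤ X.count x := by
      by_contra! h
      exact hn (Multiset.nodup_iff_count_le_one.2 fun x => by have := h x; omega)
    have hmem : x ∈ X := Multiset.count_pos.1 (by omega)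
    refine ⟨x, X.erase x, (Multiset.cons_erase hmem).symm, ?_⟩
    have hmem' : x ∈ X.erase x := by
      rw [← Multiset.count_pos, Multiset.count_erase_self]
      omega
    rw [Multiset.prod_eq_zero (Multiset.mem_map.2 ⟨x, hmem', by simp [bweight]⟩)]
    positivity

lemma measurable_bweight (hφ : IsPairPotential φ) :
    Measurable fun p : EucSp d × EucSp d => bweight φ p.1 p.2 := by
  unfold bweight
  refine Measurable.ite (measurableSet_eq_fun measurable_fst measurable_snd) measurable_const ?_
  have := hφ.meas
  fun_prop

lemma bweight_comm (hφ : IsPairPotential φ) (x y : EucSp d) : bweight φ x y = bweight φ y x := by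
  unfold bweight
  by_cases h : x = y
  · rw [if_pos h, if_pos h.symm]
  · rw [if_neg h, if_neg (Ne.symm h), ← hφ.even (x - y) (sub_ne_zero.2 h), neg_sub]

lemma lintegral_bweight_sub_one_le (hd : 0 < d) (hφ : IsPairPotential φ) {z B : ℝ} (hz : 0 < z)
    (hL : LAHT φ z B) (x : EucSp d) :
    ∫⁻ y, ENNReal.ofReal |bweight φ x y - 1|
      ≤ ENNReal.ofReal (2 * (z * Real.exp (2 * B) * Real.exp 1))⁻¹ := by
  have h1 : ∫⁻ y, ENNReal.ofReal |bweight φ x y - 1|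
      = ∫⁻ y : EucSp d, ENNReal.ofReal |rexp (-(φ (x - y))) - 1| := by
    refine lintegral_congr_ae ?_
    have : ∀ᵐ y : EucSp d, y ≠ x := by
      rw [ae_iff]
      simpa using volume_singleton_eq_zero hd x
    filter_upwards [this] with y hy
    rw [bweight, if_neg (Ne.symm hy), rexp_neg_of_ne hφ (sub_ne_zero.2 (Ne.symm hy))]
  have h2 : ∫⁻ y : EucSp d, ENNReal.ofReal |rexp (-(φ (x - y))) - 1|
      = ∫⁻ y : EucSp d, ENNReal.ofReal |rexp (-(φ y)) - 1| :=
    lintegral_sub_left_eq_self (fun y => ENNReal.ofReal |rexp (-(φ y)) - 1|) x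
  rw [h1, h2]
  unfold LAHT at hL
  have h3 : ∫⁻ x : EucSp d, ENNReal.ofReal (|rexp (-(φ x)) - 1| * z)
      = (∫⁻ y : EucSp d, ENNReal.ofReal |rexp (-(φ y)) - 1|) * ENNReal.ofReal z := by
    rw [← lintegral_mul_const' _ _ ENNReal.ofReal_ne_top]
    refine lintegral_congr fun y => ?_
    rw [ENNReal.ofReal_mul (abs_nonneg _)]
  rw [h3] at hL
  have h4 : (2 * (z * Real.exp (2 * B) * Real.exp 1))⁻¹ = (2 * Real.exp (1 + 2 * B))⁻¹ / z := by
    rw [Real.exp_add]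
    field_simp
  rw [h4, ENNReal.ofReal_div_of_pos hz]
  exact (ENNReal.le_div_iff_mul_le (Or.inl (by simpa using hz)) (Or.inl ENNReal.ofReal_ne_top)).2
    hL.le

/-- The interaction attached to a pair potential. -/
def potInteraction (hd : 0 < d) (hφ : IsPairPotential φ) {B : ℝ} (hS : Stable φ B) {z : ℝ}
    (hz : 0 < z) (hL : LAHT φ z B) : Interaction (EucSp d) where
  ν := volume
  sf := inferInstance
  g := bweight φ
  z := z
  b := Real.exp (2 * B)
  meas := measurable_bweight hφ
  symm := bweight_comm hφ
  nonneg x y := by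
    unfold bweight
    split_ifs
    exacts [le_rfl, (Real.exp_pos _).le]
  diag x := by simp [bweight]
  z_pos := hz
  b_pos := Real.exp_pos _
  good := exists_prod_bweight_le hφ hS
  reg := lintegral_bweight_sub_one_le hd hφ hz hL

end Potential

end Ruelle

/-! ### The random sequence of configurations in growing volumes -/

namespace Ruelle

open ProbabilityTheory

/-- Concatenation of the entries `1, …, n` of a sequence of tuples. -/
def acc {α : Type} : ℕ → (ℕ → Tup α) → Tup α
  | 0, _ => tnil
  | n + 1, ω => tapp (acc n ω) (ω (n + 1))

/-- Extension of a finite sequence of tuples by empty tuples. -/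
def extTup {α : Type} (n : ℕ) (h : (i : Finset.Iic n) → Tup α) : ℕ → Tup α :=
  fun i => if hi : i ∈ Finset.Iic n then h ⟨i, hi⟩ else tnil

section Acc

variable {α : Type}

lemma acc_congr {ω ω' : ℕ → Tup α} {n : ℕ} (h : ∀ i ≤ n, ω i = ω' i) : acc n ω = acc n ω' := by
  induction n with
  | zero => rfl
  | succ n ih =>
    rw [acc, acc, ih fun i hi => h i (by omega), h (n + 1) le_rfl]

lemma acc_extTup (n : ℕ) (ω : ℕ → Tup α) :
    acc n (extTup n (Preorder.frestrictLe (π := fun _ => Tup α) n ω)) = acc n ω :=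
  acc_congr fun i hi => by
    simp [extTup, hi]

variable [MeasurableSpace α]

lemma measurable_acc (n : ℕ) : Measurable (acc n : (ℕ → Tup α) → Tup α) := by
  induction n with
  | zero => exact measurable_const
  | succ n ih => exact measurable_tapp.comp (ih.prodMk (measurable_pi_apply (n + 1)))

lemma measurable_extTup (n : ℕ) :
    Measurable (extTup n : ((i : Finset.Iic n) → Tup α) → ℕ → Tup α) := by
  refine measurable_pi_iff.2 fun i => ?_
  unfold extTup
  split_ifs
  exacts [measurable_pi_apply _, measurable_const]

end Acc

/-- An exhaustion of the space by sets of finite measure. -/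
structure Exhaustion {α : Type} [MeasurableSpace α] (ν : Measure α) (W : ℕ → Set α) : Prop where
  meas : ∀ n, MeasurableSet (W n)
  mono : Monotone W
  zero : W 0 = ∅
  fin : ∀ n, ν (W n) < ⊤
  cover : ⋃ n, W n = univ

namespace Interaction

variable {α : Type} [MeasurableSpace α] (I : Interaction α) (W : ℕ → Set α)

/-- Conditional density of the configuration in the `n`-th shell, given the configuration in the
volumes before. -/
def dens (n : ℕ) (s t : Multiset α) : ℝ≥0∞ :=
  if I.corr (W n)ᶜ s = 0 then if t.card = 0 then 1 else 0
  else ENNReal.ofReal (ind (W (n + 1) \ W n) t) * ENNReal.ofReal (I.corr (W (n + 1))ᶜ (s + t)) /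
    (ENNReal.ofReal (I.nrm (W (n + 1))ᶜ (W (n + 1) \ W n)) * ENNReal.ofReal (I.corr (W n)ᶜ s))

variable {I W}

section

variable (hW : Exhaustion I.ν W)
include hW

lemma measurable_dens (n : ℕ) :
    Measurable fun p : Tup α × Tup α => I.dens W n (ms p.1) (ms p.2) := by
  unfold dens
  have h1 : Measurable fun p : Tup α × Tup α => I.corr (W n)ᶜ (ms p.1) :=
    (I.measurable_corr (hW.meas n).compl).comp measurable_fst
  have h2 : Measurable fun p : Tup α × Tup α => ind (W (n + 1) \ W n) (ms p.2) :=
    (measurable_ind ((hW.meas (n + 1)).diff (hW.meas n))).comp measurable_snd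
  have h3 : Measurable fun p : Tup α × Tup α => I.corr (W (n + 1))ᶜ (ms p.1 + ms p.2) := by
    have := (I.measurable_corr (hW.meas (n + 1)).compl).comp measurable_tapp
    simpa [Function.comp_def] using this
  refine Measurable.ite (measurableSet_eq_fun h1 measurable_const) ?_ ?_
  · refine Measurable.ite ?_ measurable_const measurable_const
    have h4 : Measurable fun p : Tup α × Tup α => (ms p.2).card := by
      simp only [card_ms]
      exact measurable_tup_fst.comp measurable_snd
    exact measurableSet_eq_fun h4 measurable_const
  · exact (h2.ennreal_ofReal.mul h3.ennreal_ofReal).div (measurable_const.mul h1.ennreal_ofReal)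

lemma shell_lt_top (n : ℕ) : I.ν (W (n + 1) \ W n) < ⊤ :=
  (measure_mono sdiff_subset).trans_lt (hW.fin (n + 1))

lemma shell_union (n : ℕ) : (W (n + 1))ᶜ ∪ (W (n + 1) \ W n) = (W n)ᶜ := by
  ext x
  have := @hW.mono n (n + 1) n.le_succ x
  simp only [mem_union, mem_compl_iff, Set.mem_sdiff]
  tauto

lemma lintegral_shell (n : ℕ) (s : Multiset α) :
    ∫⁻ u, ENNReal.ofReal (ind (W (n + 1) \ W n) (ms u)) *
        ENNReal.ofReal (I.corr (W (n + 1))ᶜ (s + ms u)) ∂tupMeas I.ν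
      = ENNReal.ofReal (I.nrm (W (n + 1))ᶜ (W (n + 1) \ W n)) * ENNReal.ofReal (I.corr (W n)ᶜ s) := by
  rw [I.lintegral_ind_corr (hW.meas _).compl ((hW.meas _).diff (hW.meas _))
    (disjoint_compl_left.mono_right sdiff_subset) (shell_lt_top hW n), shell_union hW]

lemma nrm_shell_ne_zero (n : ℕ) :
    ENNReal.ofReal (I.nrm (W (n + 1))ᶜ (W (n + 1) \ W n)) ≠ 0 := by
  have := I.one_le_nrm (hW.meas (n + 1)).compl ((hW.meas (n + 1)).diff (hW.meas n))
    (shell_lt_top hW n)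
  simpa using by linarith

lemma lintegral_dens (n : ℕ) (s : Multiset α) :
    ∫⁻ u, I.dens W n s (ms u) ∂tupMeas I.ν = 1 := by
  unfold dens
  split_ifs with h
  · rw [lintegral_tup_eq_tnil]
    · simp
    · intro l hl
      rw [if_neg]
      rwa [Multiset.card_eq_zero]
  · have hpos : 0 < I.corr (W n)ᶜ s :=
      lt_of_le_of_ne (I.corr_nonneg (hW.meas n).compl s) (Ne.symm h)
    have h0 : ENNReal.ofReal (I.nrm (W (n + 1))ᶜ (W (n + 1) \ W n)) *
        ENNReal.ofReal (I.corr (W n)ᶜ s) ≠ 0 :=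
      mul_ne_zero (nrm_shell_ne_zero hW n) (by simpa using hpos)
    have ht : ENNReal.ofReal (I.nrm (W (n + 1))ᶜ (W (n + 1) \ W n)) *
        ENNReal.ofReal (I.corr (W n)ᶜ s) ≠ ⊤ :=
      ENNReal.mul_ne_top ENNReal.ofReal_ne_top ENNReal.ofReal_ne_top
    simp only [div_eq_mul_inv]
    rw [lintegral_mul_const' _ _ (ENNReal.inv_ne_top.2 h0), lintegral_shell hW,
      ENNReal.mul_inv_cancel h0 ht]

lemma nrm_mul_corr_mul_dens (n : ℕ) (s : Multiset α) :
    (fun u : Tup α => ENNReal.ofReal (I.nrm (W (n + 1))ᶜ (W (n + 1) \ W n)) *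
      ENNReal.ofReal (I.corr (W n)ᶜ s) * I.dens W n s (ms u)) =ᵐ[tupMeas I.ν]
    fun u => ENNReal.ofReal (ind (W (n + 1) \ W n) (ms u)) *
      ENNReal.ofReal (I.corr (W (n + 1))ᶜ (s + ms u)) := by
  by_cases h : I.corr (W n)ᶜ s = 0
  · have h1 := lintegral_shell hW n s
    rw [h, ENNReal.ofReal_zero, mul_zero, lintegral_eq_zero_iff] at h1
    · filter_upwards [h1] with u hu
      rw [hu, h]
      simp
    · exact ((measurable_ind ((hW.meas (n + 1)).diff (hW.meas n))).ennreal_ofReal).mul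
        (I.measurable_corr_add (hW.meas (n + 1)).compl s).ennreal_ofReal
  · refine Filter.Eventually.of_forall fun u => ?_
    have hpos : 0 < I.corr (W n)ᶜ s :=
      lt_of_le_of_ne (I.corr_nonneg (hW.meas n).compl s) (Ne.symm h)
    have h0 : ENNReal.ofReal (I.nrm (W (n + 1))ᶜ (W (n + 1) \ W n)) *
        ENNReal.ofReal (I.corr (W n)ᶜ s) ≠ 0 :=
      mul_ne_zero (nrm_shell_ne_zero hW n) (by simpa using hpos)
    have ht : ENNReal.ofReal (I.nrm (W (n + 1))ᶜ (W (n + 1) \ W n)) *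
        ENNReal.ofReal (I.corr (W n)ᶜ s) ≠ ⊤ :=
      ENNReal.mul_ne_top ENNReal.ofReal_ne_top ENNReal.ofReal_ne_top
    simp only [dens, if_neg h]
    exact ENNReal.mul_div_cancel h0 ht

end

variable (I W) in
/-- The transition kernel from the configuration in `W n` to the configuration in the `n`-th
shell. -/
def shellKernel (n : ℕ) : Kernel (Tup α) (Tup α) :=
  (Kernel.const (Tup α) (tupMeas I.ν)).withDensity fun s u => I.dens W n (ms s) (ms u)

lemma shellKernel_apply (hW : Exhaustion I.ν W) (n : ℕ) (s : Tup α) :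
    I.shellKernel W n s = (tupMeas I.ν).withDensity fun u => I.dens W n (ms s) (ms u) := by
  rw [shellKernel, Kernel.withDensity_apply _ (measurable_dens hW n), Kernel.const_apply]

lemma isMarkovKernel_shellKernel (hW : Exhaustion I.ν W) (n : ℕ) :
    IsMarkovKernel (I.shellKernel W n) := by
  refine ⟨fun s => ⟨?_⟩⟩
  rw [shellKernel_apply hW, withDensity_apply _ MeasurableSet.univ, Measure.restrict_univ,
    lintegral_dens hW]

variable (I W) in
/-- The transition kernel as a kernel on histories. -/
def histKernel (n : ℕ) : Kernel ((i : Finset.Iic n) → Tup α) (Tup α) :=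
  (I.shellKernel W n).comap (fun h => acc n (extTup n h))
    ((measurable_acc n).comp (measurable_extTup n))

lemma histKernel_apply (hW : Exhaustion I.ν W) (n : ℕ) (ω : ℕ → Tup α) :
    I.histKernel W n (Preorder.frestrictLe (π := fun _ => Tup α) n ω)
      = (tupMeas I.ν).withDensity fun u => I.dens W n (ms (acc n ω)) (ms u) := by
  rw [← acc_extTup n ω]
  exact shellKernel_apply hW n _

lemma isMarkovKernel_histKernel (hW : Exhaustion I.ν W) (n : ℕ) :
    IsMarkovKernel (I.histKernel W n) := by
  have := isMarkovKernel_shellKernel hW n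
  unfold histKernel
  infer_instance

/-- The law of the sequence of shell configurations. -/
def shellLaw (hW : Exhaustion I.ν W) : Measure (ℕ → Tup α) :=
  haveI := isMarkovKernel_histKernel hW
  Kernel.trajMeasure (X := fun _ => Tup α) (Measure.dirac tnil) (I.histKernel W)

instance (hW : Exhaustion I.ν W) : IsProbabilityMeasure (shellLaw hW) := by
  have := isMarkovKernel_histKernel hW
  unfold shellLaw
  infer_instance

lemma lintegral_shellLaw_step (hW : Exhaustion I.ν W) (n : ℕ) {G : Tup α → Tup α → ℝ≥0∞}
    (hG : Measurable fun p : Tup α × Tup α => G p.1 p.2) :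
    ∫⁻ ω, G (acc n ω) (ω (n + 1)) ∂shellLaw hW
      = ∫⁻ ω, ∫⁻ u, I.dens W n (ms (acc n ω)) (ms u) * G (acc n ω) u ∂tupMeas I.ν ∂shellLaw hW := by
  have := isMarkovKernel_histKernel hW
  have h := Kernel.map_frestrictLe_trajMeasure_compProd_eq_map_trajMeasure
    (X := fun _ => Tup α) (μ₀ := Measure.dirac tnil) (κ := I.histKernel W) (a := n)
  have hm : Measurable fun h : (i : Finset.Iic n) → Tup α => acc n (extTup n h) :=
    (measurable_acc n).comp (measurable_extTup n)
  have hG' : Measurable fun p : ((i : Finset.Iic n) → Tup α) × Tup α =>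
      G (acc n (extTup n p.1)) p.2 :=
    hG.comp ((hm.comp measurable_fst).prodMk measurable_snd)
  have hr : Measurable (Preorder.frestrictLe (π := fun _ : ℕ => Tup α) n) := by fun_prop
  have h2 := congrArg (fun m => ∫⁻ p, G (acc n (extTup n p.1)) p.2 ∂m) h
  rw [Measure.lintegral_compProd hG', lintegral_map (hG'.lintegral_kernel_prod_right') hr,
    lintegral_map hG' (hr.prodMk (measurable_pi_apply (n + 1)))] at h2
  simp only [acc_extTup] at h2
  change ∫⁻ ω, G (acc n ω) (ω (n + 1)) ∂Kernel.trajMeasure (X := fun _ => Tup α)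
    (Measure.dirac tnil) (I.histKernel W) = _
  rw [← h2]
  refine lintegral_congr fun ω => ?_
  have hk : ∀ m : Measure (Tup α), m = (tupMeas I.ν).withDensity
      (fun u => I.dens W n (ms (acc n ω)) (ms u)) → ∫⁻ u, G (acc n ω) u ∂m
        = ∫⁻ u, I.dens W n (ms (acc n ω)) (ms u) * G (acc n ω) u ∂tupMeas I.ν := by
    rintro m rfl
    exact lintegral_withDensity_eq_lintegral_mul _
      ((measurable_dens hW n).comp measurable_prodMk_left) (hG.comp measurable_prodMk_left)
  exact hk _ (histKernel_apply hW n ω)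

end Interaction

end Ruelle

/-! ### Marginal laws of the sequence of configurations -/

namespace Ruelle

open ProbabilityTheory

namespace Interaction

section

variable {α : Type}

lemma ofReal_ind_union {A D : Set α} (h : Disjoint A D) (s : Multiset α) :
    ENNReal.ofReal (ind (A ∪ D) s)
      = splitSum (fun t r => ENNReal.ofReal (ind A t) * ENNReal.ofReal (ind D r)) s := by
  rw [ind_union h]
  unfold splitSum
  have key : ∀ S : Multiset (Multiset α × Multiset α),
      ENNReal.ofReal (S.map fun p => ind A p.1 * ind D p.2).sum
        = (S.map fun p => ENNReal.ofReal (ind A p.1) * ENNReal.ofReal (ind D p.2)).sum := by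
    intro S
    induction S using Multiset.induction with
    | empty => simp
    | cons a S ih =>
      rw [Multiset.map_cons, Multiset.sum_cons, Multiset.map_cons, Multiset.sum_cons, ← ih,
        ENNReal.ofReal_add (mul_nonneg (ind_nonneg _ _) (ind_nonneg _ _)),
        ENNReal.ofReal_mul (ind_nonneg _ _)]
      refine Multiset.sum_nonneg fun x hx => ?_
      obtain ⟨p, _, rfl⟩ := Multiset.mem_map.1 hx
      exact mul_nonneg (ind_nonneg _ _) (ind_nonneg _ _)
  exact key _

/-- The set of all points of a sequence of configurations. -/
def pts (ω : ℕ → Tup α) : Set α := {x | ∃ n, x ∈ ms (acc n ω)}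

lemma mem_acc_succ {ω : ℕ → Tup α} {n : ℕ} {x : α} :
    x ∈ ms (acc (n + 1) ω) ↔ x ∈ ms (acc n ω) ∨ x ∈ ms (ω (n + 1)) := by
  rw [acc, ms_tapp, Multiset.mem_add]

lemma acc_mono {ω : ℕ → Tup α} {n m : ℕ} (h : n ≤ m) {x : α} (hx : x ∈ ms (acc n ω)) :
    x ∈ ms (acc m ω) := by
  induction m, h using Nat.le_induction with
  | base => exact hx
  | succ m _ ih => exact mem_acc_succ.2 (Or.inl ih)

end

variable {α : Type} [MeasurableSpace α] {I : Interaction α} {W : ℕ → Set α}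

/-- Product of the normalization constants of the first shells. -/
def shellConst (I : Interaction α) (W : ℕ → Set α) : ℕ → ℝ≥0∞
  | 0 => 1
  | n + 1 => ENNReal.ofReal (I.nrm (W (n + 1))ᶜ (W (n + 1) \ W n)) * shellConst I W n

section

variable (hW : Exhaustion I.ν W)
include hW

lemma shellConst_mul_lintegral_acc (n : ℕ) {H : Multiset α → ℝ≥0∞}
    (hH : Measurable fun l : Tup α => H (ms l)) :
    I.shellConst W n * ∫⁻ ω, H (ms (acc n ω)) ∂shellLaw hW
      = ∫⁻ s, ENNReal.ofReal (ind (W n) (ms s)) * H (ms s) * ENNReal.ofReal (I.corr (W n)ᶜ (ms s))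
          ∂tupMeas I.ν := by
  induction n generalizing H with
  | zero =>
    rw [lintegral_tup_eq_tnil]
    · simp [shellConst, acc, I.corr_zero (hW.meas 0).compl]
    · intro l hl
      have : ind (W 0) (ms l) = 0 := by
        rw [ind_eq, if_neg]
        intro h
        obtain ⟨x, hx⟩ := Multiset.exists_mem_of_ne_zero hl
        have := h x hx
        rw [hW.zero] at this
        exact this
      rw [this]
      simp
  | succ n ih =>
    have happ : Measurable fun p : Tup α × Tup α => H (ms p.1 + ms p.2) := by
      have := hH.comp measurable_tapp
      simpa [Function.comp_def] using this
    have hcorr : Measurable fun p : Tup α × Tup α => I.corr (W (n + 1))ᶜ (ms p.1 + ms p.2) := by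
      have := (I.measurable_corr (hW.meas (n + 1)).compl).comp measurable_tapp
      simpa [Function.comp_def] using this
    have h1 : ∫⁻ ω, H (ms (acc (n + 1) ω)) ∂shellLaw hW
        = ∫⁻ ω, (fun s : Multiset α => ∫⁻ u, I.dens W n s (ms u) * H (s + ms u) ∂tupMeas I.ν)
            (ms (acc n ω)) ∂shellLaw hW := by
      rw [← lintegral_shellLaw_step hW n (G := fun s u => H (ms s + ms u)) happ]
      simp [acc]
    have hF : Measurable fun p : Tup α × Tup α =>
        I.dens W n (ms p.1) (ms p.2) * H (ms p.1 + ms p.2) := (measurable_dens hW n).mul happ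
    have hH' : Measurable fun l : Tup α =>
        (fun s : Multiset α => ∫⁻ u, I.dens W n s (ms u) * H (s + ms u) ∂tupMeas I.ν) (ms l) :=
      hF.lintegral_prod_right'
    rw [h1, shellConst, mul_assoc, ih (H := fun s : Multiset α =>
      ∫⁻ u, I.dens W n s (ms u) * H (s + ms u) ∂tupMeas I.ν) hH', ← lintegral_const_mul' _ _ ENNReal.ofReal_ne_top]
    have hunion : W n ∪ (W (n + 1) \ W n) = W (n + 1) :=
      Set.union_sdiff_cancel (hW.mono n.le_succ)
    have hdisj : Disjoint (W n) (W (n + 1) \ W n) := disjoint_sdiff_right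
    have hK : Measurable fun p : Tup α × Tup α =>
        (fun t r => ENNReal.ofReal (ind (W n) t) * ENNReal.ofReal (ind (W (n + 1) \ W n) r) *
          (H (t + r) * ENNReal.ofReal (I.corr (W (n + 1))ᶜ (t + r)))) (ms p.1) (ms p.2) :=
      ((((measurable_ind (hW.meas n)).comp measurable_fst).ennreal_ofReal).mul
        (((measurable_ind ((hW.meas (n + 1)).diff (hW.meas n))).comp
          measurable_snd).ennreal_ofReal)).mul (happ.mul hcorr.ennreal_ofReal)
    have h2 : ∀ s : Multiset α, ENNReal.ofReal (ind (W (n + 1)) s) * H s *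
        ENNReal.ofReal (I.corr (W (n + 1))ᶜ s)
        = splitSum (fun t r => ENNReal.ofReal (ind (W n) t) *
            ENNReal.ofReal (ind (W (n + 1) \ W n) r) *
            (H (t + r) * ENNReal.ofReal (I.corr (W (n + 1))ᶜ (t + r)))) s := by
      intro s
      rw [← hunion, ofReal_ind_union hdisj, hunion]
      unfold splitSum
      rw [mul_assoc, ← Multiset.sum_map_mul_right]
      congr 1
      refine Multiset.map_congr rfl fun p hp => ?_
      dsimp only
      rw [Multiset.mem_antidiagonal.1 hp]
    simp only [h2]
    rw [lintegral_splitSum I.ν hK]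
    refine lintegral_congr fun s => ?_
    have hm : Measurable fun u : Tup α => I.dens W n (ms s) (ms u) * H (ms s + ms u) := by
      have h0 := hF.comp (measurable_prodMk_left : Measurable fun u : Tup α => (s, u))
      simpa only [Function.comp_def] using h0
    calc ENNReal.ofReal (I.nrm (W (n + 1))ᶜ (W (n + 1) \ W n)) * (ENNReal.ofReal (ind (W n) (ms s)) *
          (∫⁻ u, I.dens W n (ms s) (ms u) * H (ms s + ms u) ∂tupMeas I.ν) *
          ENNReal.ofReal (I.corr (W n)ᶜ (ms s)))
        = (ENNReal.ofReal (ind (W n) (ms s)) * (ENNReal.ofReal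
            (I.nrm (W (n + 1))ᶜ (W (n + 1) \ W n)) * ENNReal.ofReal (I.corr (W n)ᶜ (ms s)))) *
          ∫⁻ u, I.dens W n (ms s) (ms u) * H (ms s + ms u) ∂tupMeas I.ν := by ring
      _ = ∫⁻ u, ENNReal.ofReal (ind (W n) (ms s)) *
            ENNReal.ofReal (ind (W (n + 1) \ W n) (ms u)) *
            (H (ms s + ms u) * ENNReal.ofReal (I.corr (W (n + 1))ᶜ (ms s + ms u)))
            ∂tupMeas I.ν := by
        rw [← lintegral_const_mul _ hm]
        refine lintegral_congr_ae ?_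
        filter_upwards [nrm_mul_corr_mul_dens hW n (ms s)] with u hu
        rw [mul_assoc (ENNReal.ofReal (ind (W n) (ms s))) (ENNReal.ofReal _ * _),
          ← mul_assoc _ (I.dens W n (ms s) (ms u)), hu]
        ring

lemma shellConst_eq (n : ℕ) :
    I.shellConst W n = ENNReal.ofReal (I.nrm (W n)ᶜ (W n)) := by
  have h := shellConst_mul_lintegral_acc hW n (H := fun _ => 1) measurable_const
  have h2 := I.lintegral_ind_corr (hW.meas n).compl (hW.meas n) disjoint_compl_left (hW.fin n) 0
  simp only [lintegral_const, measure_univ, mul_one, zero_add] at h h2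
  rw [h, h2, Set.compl_union_self, I.corr_zero MeasurableSet.univ]
  simp

lemma nrm_mul_lintegral_acc (n : ℕ) {H : Multiset α → ℝ≥0∞}
    (hH : Measurable fun l : Tup α => H (ms l)) :
    ENNReal.ofReal (I.nrm (W n)ᶜ (W n)) * ∫⁻ ω, H (ms (acc n ω)) ∂shellLaw hW
      = ∫⁻ s, ENNReal.ofReal (ind (W n) (ms s)) * H (ms s) * ENNReal.ofReal (I.corr (W n)ᶜ (ms s))
          ∂tupMeas I.ν := by
  rw [← shellConst_eq hW, shellConst_mul_lintegral_acc hW n hH]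

lemma nrm_ne_zero (n : ℕ) : ENNReal.ofReal (I.nrm (W n)ᶜ (W n)) ≠ 0 := by
  have := I.one_le_nrm (hW.meas n).compl (hW.meas n) (hW.fin n)
  simpa using by linarith

end

variable (I W) in
/-- The sequences of shell configurations which determine a locally finite configuration. -/
def goodSet : Set (ℕ → Tup α) :=
  {ω | ∀ n, I.corr (W n)ᶜ (ms (acc n ω)) ≠ 0 ∧ ind (W (n + 1) \ W n) (ms (ω (n + 1))) ≠ 0}

lemma measurableSet_goodSet (hW : Exhaustion I.ν W) : MeasurableSet (I.goodSet W) := by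
  have h : I.goodSet W = ⋂ n, {ω | I.corr (W n)ᶜ (ms (acc n ω)) = 0}ᶜ ∩
      {ω | ind (W (n + 1) \ W n) (ms (ω (n + 1))) = 0}ᶜ := by
    ext ω
    simp [goodSet]
  rw [h]
  refine MeasurableSet.iInter fun n => MeasurableSet.inter ?_ ?_
  · exact (measurableSet_eq_fun ((I.measurable_corr (hW.meas n).compl).comp (measurable_acc n))
      measurable_const).compl
  · exact (measurableSet_eq_fun ((measurable_ind ((hW.meas (n + 1)).diff (hW.meas n))).comp
      (measurable_pi_apply (n + 1))) measurable_const).compl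

lemma ae_mem_goodSet (hW : Exhaustion I.ν W) : ∀ᵐ ω ∂shellLaw hW, ω ∈ I.goodSet W := by
  refine ae_all_iff.2 fun n => ?_
  refine Filter.Eventually.and ?_ ?_
  · have hH : Measurable fun l : Tup α =>
        (fun s => if I.corr (W n)ᶜ s = 0 then (1 : ℝ≥0∞) else 0) (ms l) :=
      Measurable.ite (measurableSet_eq_fun (I.measurable_corr (hW.meas n).compl) measurable_const)
        measurable_const measurable_const
    have h := nrm_mul_lintegral_acc hW n
      (H := fun s => if I.corr (W n)ᶜ s = 0 then (1 : ℝ≥0∞) else 0) hH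
    have h2 : ∀ s : Multiset α, ENNReal.ofReal (ind (W n) s) *
        (if I.corr (W n)ᶜ s = 0 then (1 : ℝ≥0∞) else 0) * ENNReal.ofReal (I.corr (W n)ᶜ s) = 0 := by
      intro s
      split_ifs with h0 <;> simp [h0]
    simp only [h2, lintegral_zero, mul_eq_zero, nrm_ne_zero hW, false_or] at h
    have hm : Measurable fun ω : ℕ → Tup α =>
        if I.corr (W n)ᶜ (ms (acc n ω)) = 0 then (1 : ℝ≥0∞) else 0 := hH.comp (measurable_acc n)
    rw [lintegral_eq_zero_iff hm] at h
    filter_upwards [h] with ω hω h0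
    simp [h0] at hω
  · have hG : Measurable fun p : Tup α × Tup α =>
        (fun _ u : Tup α => if ind (W (n + 1) \ W n) (ms u) = 0 then (1 : ℝ≥0∞) else 0) p.1 p.2 :=
      (Measurable.ite (measurableSet_eq_fun
        (measurable_ind ((hW.meas (n + 1)).diff (hW.meas n))) measurable_const)
        measurable_const measurable_const).comp measurable_snd
    have h := lintegral_shellLaw_step hW n (G := fun _ u : Tup α =>
      if ind (W (n + 1) \ W n) (ms u) = 0 then (1 : ℝ≥0∞) else 0) hG
    have h2 : ∀ s t : Multiset α, I.dens W n s t *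
        (if ind (W (n + 1) \ W n) t = 0 then (1 : ℝ≥0∞) else 0) = 0 := by
      intro s t
      unfold dens
      split_ifs with h0 h1 h3 <;> try simp
      · rw [Multiset.card_eq_zero] at h1
        simp [h1] at h3
      · rename_i h4
        simp [h4]
    simp only [h2, lintegral_zero] at h
    rw [lintegral_eq_zero_iff] at h
    · filter_upwards [h] with ω hω h0
      simp [h0] at hω
    · exact hG.comp ((measurable_acc n).prodMk (measurable_pi_apply (n + 1)))

section

variable (hW : Exhaustion I.ν W) {ω : ℕ → Tup α} (hω : ω ∈ I.goodSet W)
include hω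

lemma nodup_acc (n : ℕ) : (ms (acc n ω)).Nodup := by
  by_contra h
  exact (hω n).1 (I.corr_of_not_nodup h)

lemma mem_shell {n : ℕ} {x : α} (hx : x ∈ ms (ω (n + 1))) : x ∈ W (n + 1) \ W n := by
  have h := (hω n).2
  rw [ind_eq] at h
  by_contra hx'
  rw [if_neg fun h' => hx' (h' x hx)] at h
  exact h rfl

include hW

lemma mem_of_mem_acc {n : ℕ} {x : α} (hx : x ∈ ms (acc n ω)) : x ∈ W n := by
  induction n with
  | zero => simp [acc] at hx
  | succ n ih =>
    rcases mem_acc_succ.1 hx with h | h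
    · exact hW.mono n.le_succ (ih h)
    · exact (mem_shell hω h).1

lemma mem_acc_iff {n : ℕ} {x : α} : x ∈ ms (acc n ω) ↔ x ∈ pts ω ∧ x ∈ W n := by
  refine ⟨fun h => ⟨⟨n, h⟩, mem_of_mem_acc hW hω h⟩, ?_⟩
  rintro ⟨⟨m, hm⟩, hn⟩
  induction m with
  | zero => simp [acc] at hm
  | succ m ih =>
    rcases mem_acc_succ.1 hm with h | h
    · exact ih h
    · rcases Nat.lt_or_ge m n with hmn | hmn
      · exact acc_mono hmn hm
      · exact absurd (hW.mono hmn hn) (mem_shell hω h).2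

end

end Interaction

end Ruelle

/-! ### Measurability on the configuration space -/

namespace Ruelle

open ProbabilityTheory

section ConfigSpace

variable {d : ℕ} {Ω : Type*} [MeasurableSpace Ω]

lemma measurable_enat_top_iff {f : Ω → ℕ∞} :
    Measurable[_, ⊤] f ↔ Measurable fun ω => (f ω : ℝ≥0∞) := by
  constructor
  · intro h
    have h2 : Measurable[⊤] (fun n : ℕ∞ => (n : ℝ≥0∞)) := fun _ _ => trivial
    exact @Measurable.comp _ _ _ _ ⊤ _ _ _ h2 h
  · intro h
    refine @measurable_to_countable' _ _ ⊤ _ _ f fun n => ?_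
    have : f ⁻¹' {n} = (fun ω => (f ω : ℝ≥0∞)) ⁻¹' {(n : ℝ≥0∞)} := by
      ext ω
      simp [ENat.toENNReal_inj]
    rw [this]
    exact h (measurableSet_singleton _)

lemma measurable_config_iff {Φ : Ω → Config d} :
    Measurable Φ ↔ ∀ B : Set (EucSp d), MeasurableSet B →
      Measurable fun ω => (((Φ ω).1 ∩ B).encard : ℝ≥0∞) := by
  simp only [← measurable_enat_top_iff]
  rw [measurable_iff_comap_le, Config.instMS, MeasurableSpace.comap_iSup]
  simp only [MeasurableSpace.comap_iSup, iSup_le_iff, MeasurableSpace.comap_comp]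
  refine forall_congr' fun B => forall_congr' fun hB => ?_
  rw [measurable_iff_comap_le]
  rfl

lemma measurable_encard_inter {B : Set (EucSp d)} (hB : MeasurableSet B) :
    Measurable fun γ : Config d => ((γ.1 ∩ B).encard : ℝ≥0∞) :=
  measurable_config_iff.1 measurable_id B hB

/-- The counting measure of a configuration. -/
def cntM (γ : Config d) : Measure (EucSp d) := Measure.sum fun x : γ.1 => Measure.dirac x.1

lemma lintegral_cntM (γ : Config d) (f : EucSp d → ℝ≥0∞) :
    ∫⁻ x, f x ∂cntM γ = ∑' x : γ.1, f x.1 := by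
  simp [cntM, lintegral_sum_measure]

lemma cntM_apply (γ : Config d) {B : Set (EucSp d)} (hB : MeasurableSet B) :
    cntM γ B = (γ.1 ∩ B).encard := by
  rw [← ENNReal.tsum_set_one, ← lintegral_indicator_one hB, lintegral_cntM, tsum_subtype γ.1,
    tsum_subtype (γ.1 ∩ B) fun _ => (1 : ℝ≥0∞)]
  refine tsum_congr fun x => ?_
  by_cases h1 : x ∈ γ.1 <;> by_cases h2 : x ∈ B <;> simp [h1, h2]

lemma cntM_closedBall_lt_top (γ : Config d) (n : ℕ) : cntM γ (Metric.closedBall 0 n) < ⊤ := by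
  rw [cntM_apply γ Metric.isClosed_closedBall.measurableSet]
  simpa using γ.2 _ (isCompact_closedBall _ _)

/-- The counting measure as a kernel. -/
def cntK (Φ : Ω → Config d) (hΦ : Measurable Φ) : Kernel Ω (EucSp d) where
  toFun ω := cntM (Φ ω)
  measurable' := by
    refine Measure.measurable_of_measurable_coe _ fun B hB => ?_
    simp only [cntM_apply _ hB]
    exact measurable_config_iff.1 hΦ B hB

lemma measurable_cntM_section {Φ : Ω → Config d} (hΦ : Measurable Φ)
    {t : Set (Ω × EucSp d)} (ht : MeasurableSet t) :
    Measurable fun ω => cntM (Φ ω) (Prod.mk ω ⁻¹' t) := by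
  have hball : ∀ n : ℕ, MeasurableSet (Metric.closedBall (0 : EucSp d) n) := fun n =>
    Metric.isClosed_closedBall.measurableSet
  have h1 : ∀ n : ℕ, Measurable fun ω =>
      ((cntM (Φ ω)).restrict (Metric.closedBall 0 n)) (Prod.mk ω ⁻¹' t) := by
    intro n
    refine Kernel.measurable_kernel_prodMk_left_of_finite (κ := (cntK Φ hΦ).restrict (hball n)) ht
      fun ω => ⟨?_⟩
    rw [Kernel.restrict_apply, Measure.restrict_apply_univ]
    exact cntM_closedBall_lt_top _ n
  have h2 : ∀ ω, cntM (Φ ω) (Prod.mk ω ⁻¹' t)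
      = ⨆ n : ℕ, ((cntM (Φ ω)).restrict (Metric.closedBall 0 n)) (Prod.mk ω ⁻¹' t) := by
    intro ω
    have hmono : Monotone fun n : ℕ => Metric.closedBall (0 : EucSp d) n := fun m n hmn =>
      Metric.closedBall_subset_closedBall (by exact_mod_cast hmn)
    have := Measure.restrict_iUnion_apply_eq_iSup (μ := cntM (Φ ω)) (directed_of_isDirected_le hmono)
      (measurable_prodMk_left ht : MeasurableSet (Prod.mk ω ⁻¹' t))
    rwa [Metric.iUnion_closedBall_nat, Measure.restrict_univ] at this
  simp only [h2]
  exact Measurable.iSup h1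

lemma measurable_tsum_config {Φ : Ω → Config d} (hΦ : Measurable Φ)
    {F : Ω × EucSp d → ℝ≥0∞} (hF : Measurable F) :
    Measurable fun ω => ∑' x : (Φ ω).1, F (ω, x.1) := by
  have h : (fun ω => ∑' x : (Φ ω).1, F (ω, x.1)) = fun ω => ∫⁻ x, F (ω, x) ∂cntM (Φ ω) :=
    funext fun ω => (lintegral_cntM _ fun x => F (ω, x)).symm
  rw [h]
  clear h
  refine Measurable.ennreal_induction
    (motive := fun F => Measurable fun ω => ∫⁻ x, F (ω, x) ∂cntM (Φ ω)) ?_ ?_ ?_ hF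
  · intro c t ht
    have : ∀ ω, ∫⁻ x, t.indicator (fun _ => c) (ω, x) ∂cntM (Φ ω)
        = c * cntM (Φ ω) (Prod.mk ω ⁻¹' t) := by
      intro ω
      rw [← lintegral_indicator_const (measurable_prodMk_left ht)]
      rfl
    simp only [this]
    exact (measurable_cntM_section hΦ ht).const_mul c
  · intro f g _ hf hg hfm hgm
    have : ∀ ω, ∫⁻ x, (f + g) (ω, x) ∂cntM (Φ ω)
        = ∫⁻ x, f (ω, x) ∂cntM (Φ ω) + ∫⁻ x, g (ω, x) ∂cntM (Φ ω) := by
      intro ω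
      exact lintegral_add_left (hf.comp measurable_prodMk_left) _
    simp only [this]
    exact hfm.add hgm
  · intro f hf hmono hfm
    have : ∀ ω, ∫⁻ x, (⨆ n, f n (ω, x)) ∂cntM (Φ ω) = ⨆ n, ∫⁻ x, f n (ω, x) ∂cntM (Φ ω) := by
      intro ω
      exact lintegral_iSup (fun n => (hf n).comp measurable_prodMk_left)
        fun m n hmn x => hmono hmn (ω, x)
    simp only [this]
    exact Measurable.iSup hfm

lemma measurable_tsum_config_pi {n : ℕ} {Φ : Ω → Config d} (hΦ : Measurable Φ)
    {F : Ω × (Fin n → EucSp d) → ℝ≥0∞} (hF : Measurable F) :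
    Measurable fun ω => ∑' p : Fin n → (Φ ω).1, F (ω, fun i => (p i).1) := by
  induction n generalizing Ω with
  | zero =>
    have : ∀ ω, ∑' p : Fin 0 → (Φ ω).1, F (ω, fun i => (p i).1) = F (ω, Fin.elim0) := by
      intro ω
      rw [tsum_eq_single Fin.elim0 fun p hp => absurd (Subsingleton.elim _ _) hp]
      congr 2
      exact Subsingleton.elim _ _
    simp only [this]
    exact hF.comp (measurable_id.prodMk measurable_const)
  | succ n ih =>
    have h1 : ∀ ω, ∑' p : Fin (n + 1) → (Φ ω).1, F (ω, fun i => (p i).1)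
        = ∑' x : (Φ ω).1, ∑' q : Fin n → (Φ ω).1,
            F (ω, Fin.cons x.1 fun i => (q i).1) := by
      intro ω
      refine ((Fin.consEquiv fun _ => (Φ ω).1).tsum_eq
        (fun p : Fin (n + 1) → (Φ ω).1 => F (ω, fun i => (p i).1))).symm.trans ?_
      refine (ENNReal.tsum_prod' (f := fun p : (Φ ω).1 × (Fin n → (Φ ω).1) =>
        F (ω, fun i => ((Fin.consEquiv fun _ => (Φ ω).1) p i).1))).trans ?_
      refine tsum_congr fun x => tsum_congr fun q => ?_
      congr 2
      funext i
      refine Fin.cases ?_ (fun j => ?_) i <;> simp [Fin.consEquiv]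
    simp only [h1]
    have hG : Measurable fun q : (Ω × EucSp d) × (Fin n → EucSp d) =>
        F (q.1.1, Fin.cons q.1.2 q.2) := by
      refine hF.comp ((measurable_fst.comp measurable_fst).prodMk ?_)
      refine measurable_pi_iff.2 fun i => ?_
      refine Fin.cases ?_ (fun j => ?_) i
      · simp only [Fin.cons_zero]
        exact measurable_snd.comp measurable_fst
      · simp only [Fin.cons_succ]
        exact (measurable_pi_apply j).comp measurable_snd
    have h2 := ih (Φ := fun q : Ω × EucSp d => Φ q.1) (hΦ.comp measurable_fst) hG
    exact measurable_tsum_config hΦ h2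

lemma tsum_injTuples_eq {n : ℕ} (γ : Set (EucSp d)) (f : (Fin n → EucSp d) → ℝ≥0∞) :
    ∑' p : injTuples n γ, f p.1
      = ∑' p : Fin n → γ, {x | Function.Injective x}.indicator f (fun i => (p i).1) := by
  have hinj : Function.Injective (fun (p : Fin n → γ) (i : Fin n) => (p i).1) := fun p q h => by
    funext i
    exact Subtype.ext (congrFun h i)
  have hr : injTuples n γ
      = Set.range (fun (p : Fin n → γ) (i : Fin n) => (p i).1) ∩ {x | Function.Injective x} := by
    ext x
    constructor
    · rintro ⟨h1, h2⟩
      exact ⟨⟨fun i => ⟨x i, h2 i⟩, rfl⟩, h1⟩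
    · rintro ⟨⟨p, rfl⟩, h1⟩
      exact ⟨h1, fun i => (p i).2⟩
  rw [← tsum_range (g := fun (p : Fin n → γ) (i : Fin n) => (p i).1)
    (f := {x | Function.Injective x}.indicator f) hinj, tsum_subtype, tsum_subtype, hr]
  refine tsum_congr fun x => ?_
  rw [Set.indicator_indicator]

lemma measurableSet_injective {n : ℕ} :
    MeasurableSet {x : Fin n → EucSp d | Function.Injective x} := by
  have : {x : Fin n → EucSp d | Function.Injective x} = ⋂ (i : Fin n) (j : Fin n),
      {x | x i = x j → i = j} := by
    ext x
    simp [Function.Injective]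
  rw [this]
  refine MeasurableSet.iInter fun i => MeasurableSet.iInter fun j => ?_
  by_cases h : i = j
  · simp [h]
  · simp only [h, imp_false]
    exact (measurableSet_eq_fun (measurable_pi_apply i) (measurable_pi_apply j)).compl

lemma measurable_tsum_injTuples {n : ℕ} {f : (Fin n → EucSp d) → ℝ≥0∞} (hf : Measurable f) :
    Measurable fun γ : Config d => ∑' p : injTuples n γ.1, f p.1 := by
  simp only [tsum_injTuples_eq]
  exact measurable_tsum_config_pi (Φ := fun γ : Config d => γ) measurable_id
    (F := fun q => {x : Fin n → EucSp d | Function.Injective x}.indicator f q.2)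
    ((hf.indicator measurableSet_injective).comp measurable_snd)

lemma measurableSet_mem_config :
    MeasurableSet {q : Config d × EucSp d | q.2 ∈ q.1.1} := by
  have h1 : Measurable fun q : Config d × EucSp d =>
      ∑' x : q.1.1, Set.indicator {r : (Config d × EucSp d) × EucSp d | r.1.2 = r.2}
        (fun _ => (1 : ℝ≥0∞)) (q, x.1) :=
    measurable_tsum_config (Φ := fun q : Config d × EucSp d => q.1) measurable_fst
      (F := Set.indicator {r : (Config d × EucSp d) × EucSp d | r.1.2 = r.2}
        (fun _ => (1 : ℝ≥0∞)))
      (measurable_const.indicator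
        (measurableSet_eq_fun (measurable_snd.comp measurable_fst) measurable_snd))
  have h2 : {q : Config d × EucSp d | q.2 ∈ q.1.1} = {q : Config d × EucSp d |
      ∑' x : q.1.1, Set.indicator {r : (Config d × EucSp d) × EucSp d | r.1.2 = r.2}
        (fun _ => (1 : ℝ≥0∞)) (q, x.1) = 0}ᶜ := by
    ext q
    simp only [Set.mem_ofPred_eq, Set.mem_compl_iff, ENNReal.tsum_eq_zero, not_forall]
    constructor
    · intro h
      exact ⟨⟨q.2, h⟩, by simp⟩
    · rintro ⟨x, hx⟩
      have : q.2 = x.1 := by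
        by_contra hne
        exact hx (Set.indicator_of_notMem (by simpa using hne) _)
      rw [this]
      exact x.2
  rw [h2]
  exact (h1 (measurableSet_singleton 0)).compl

lemma measurable_ins : Measurable fun q : Config d × EucSp d => q.1.ins q.2 := by
  rw [measurable_config_iff]
  intro B hB
  have h : ∀ q : Config d × EucSp d, (((q.1.ins q.2).1 ∩ B).encard : ℝ≥0∞)
      = (((q.1).1 ∩ B).encard : ℝ≥0∞)
        + Set.indicator ({q : Config d × EucSp d | q.2 ∈ q.1.1}ᶜ ∩ Prod.snd ⁻¹' B)
          (fun _ => (1 : ℝ≥0∞)) q := by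
    rintro ⟨γ, x⟩
    change (((insert x γ.1 : Set (EucSp d)) ∩ B).encard : ℝ≥0∞) = _
    by_cases hB : x ∈ B
    · rw [Set.insert_inter_of_mem hB]
      by_cases hx : x ∈ γ.1
      · rw [Set.insert_eq_of_mem (show x ∈ γ.1 ∩ B from ⟨hx, hB⟩)]
        simp [hx]
      · rw [Set.encard_insert_of_notMem fun h => hx h.1]
        simp [hx, hB]
    · rw [Set.insert_inter_of_notMem hB]
      simp [hB]
  simp only [h]
  exact ((measurable_encard_inter hB).comp measurable_fst).add
    (measurable_const.indicator (measurableSet_mem_config.compl.inter (measurable_snd hB)))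

end ConfigSpace

end Ruelle

/-! ### The Gibbs measure -/

namespace Ruelle

/-- The exhausting sequence of balls. -/
def ballSeq (d n : ℕ) : Set (EucSp d) := Metric.ball 0 n

section

variable {d : ℕ}

lemma measurableSet_ballSeq (n : ℕ) : MeasurableSet (ballSeq d n) :=
  Metric.isOpen_ball.measurableSet

lemma exhaustion_volume : Exhaustion (volume : Measure (EucSp d)) (ballSeq d) where
  meas := measurableSet_ballSeq
  mono := fun m n h => Metric.ball_subset_ball (by exact_mod_cast h)
  zero := by simp [ballSeq]
  fin n := measure_ball_lt_top
  cover := Metric.iUnion_ball_nat 0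

lemma finite_inter_ballSeq (γ : Config d) (n : ℕ) : (γ.1 ∩ ballSeq d n).Finite :=
  (γ.2 _ (isCompact_closedBall 0 n)).subset
    (Set.inter_subset_inter_right _ Metric.ball_subset_closedBall)

/-- The points of a configuration in a ball. -/
def loc (γ : Config d) (n : ℕ) : Finset (EucSp d) := (finite_inter_ballSeq γ n).toFinset

lemma mem_loc {γ : Config d} {n : ℕ} {x : EucSp d} : x ∈ loc γ n ↔ x ∈ γ.1 ∧ x ∈ ballSeq d n := by
  simp [loc]

lemma tsum_loc (γ : Config d) (n : ℕ) (f : EucSp d → ℝ≥0∞) :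
    ∑' x : γ.1, (ballSeq d n).indicator f x.1 = ∑ x ∈ loc γ n, f x := by
  rw [tsum_subtype γ.1, Set.indicator_indicator, ← tsum_subtype,
    ← Finset.tsum_subtype (loc γ n) f]
  have h : (γ.1 ∩ ballSeq d n) = (loc γ n : Set (EucSp d)) := by
    ext x
    simp [mem_loc]
  rw [h]
  rfl

lemma cntM_eq_iSup (γ : Config d) {B : Set (EucSp d)} (hB : MeasurableSet B) :
    cntM γ B = ⨆ n, ∑ x ∈ loc γ n, B.indicator 1 x := by
  have h1 : B = ⋃ n, ballSeq d n ∩ B := by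
    rw [← Set.iUnion_inter, exhaustion_volume.cover, Set.univ_inter]
  have h2 : Monotone fun n => ballSeq d n ∩ B := fun m n h =>
    Set.inter_subset_inter_left _ (exhaustion_volume.mono h)
  conv_lhs => rw [h1, h2.measure_iUnion]
  refine iSup_congr fun n => ?_
  rw [← lintegral_indicator_one ((measurableSet_ballSeq n).inter hB), lintegral_cntM, ← tsum_loc]
  simp only [Set.indicator_indicator]

lemma measurable_map_sum {α : Type} [MeasurableSpace α] {w : α → ℝ≥0∞} (hw : Measurable w) :
    Measurable fun l : Tup α => ((ms l).map w).sum := by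
  refine measurable_tup fun n => ?_
  simp only [ms, Multiset.map_coe, Multiset.sum_coe, List.map_ofFn, List.sum_ofFn]
  exact Finset.measurable_sum _ fun i _ => hw.comp (measurable_pi_apply i)

end

namespace Interaction

section

variable {d : ℕ} {I : Interaction (EucSp d)} (hW : Exhaustion I.ν (ballSeq d))

/-- The configuration described by a sequence of shell configurations. -/
def configOf (ω : ℕ → Tup (EucSp d)) : Config d :=
  if h : ω ∈ I.goodSet (ballSeq d) then
    ⟨pts ω, fun Λ hΛ => by
      obtain ⟨r, hr⟩ := hΛ.isBounded.subset_ball 0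
      obtain ⟨n, hn⟩ := exists_nat_ge r
      refine ((ms (acc n ω)).toFinset.finite_toSet).subset fun x hx => ?_
      simp only [Finset.mem_coe, Multiset.mem_toFinset]
      exact (mem_acc_iff hW h).2 ⟨hx.1, Metric.ball_subset_ball hn (hr hx.2)⟩⟩
  else ⟨∅, fun _ _ => by simp⟩

lemma loc_configOf {ω : ℕ → Tup (EucSp d)} (hω : ω ∈ I.goodSet (ballSeq d)) (n : ℕ) :
    (loc (configOf hW ω) n).val = ms (acc n ω) := by
  refine (Multiset.Nodup.ext (loc _ n).nodup (nodup_acc hω n)).2 fun x => ?_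
  rw [Finset.mem_val, mem_loc, mem_acc_iff hW hω]
  simp [configOf, hω]

lemma measurable_configOf : Measurable (configOf hW) := by
  rw [measurable_config_iff]
  intro B hB
  have h : (fun ω => (((configOf hW ω).1 ∩ B).encard : ℝ≥0∞))
      = (I.goodSet (ballSeq d)).indicator fun ω => ⨆ n, ((ms (acc n ω)).map (B.indicator 1)).sum := by
    funext ω
    by_cases hω : ω ∈ I.goodSet (ballSeq d)
    · rw [Set.indicator_of_mem hω, ← cntM_apply _ hB, cntM_eq_iSup _ hB]
      refine iSup_congr fun n => ?_
      rw [← loc_configOf hW hω n]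
      rfl
    · simp [configOf, hω]
  rw [h]
  refine Measurable.indicator (Measurable.iSup fun n => ?_) (measurableSet_goodSet hW)
  exact (measurable_map_sum (measurable_one.indicator hB)).comp (measurable_acc n)

/-- The Gibbs measure. -/
def gibbs : Measure (Config d) := (shellLaw hW).map (configOf hW)

instance : IsProbabilityMeasure (gibbs hW) :=
  Measure.isProbabilityMeasure_map (measurable_configOf hW).aemeasurable

lemma lintegral_gibbs {G : Config d → ℝ≥0∞} (hG : Measurable G) :
    ∫⁻ γ, G γ ∂gibbs hW = ∫⁻ ω, G (configOf hW ω) ∂shellLaw hW :=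
  lintegral_map hG (measurable_configOf hW)

lemma nrm_mul_lintegral_gibbs (n : ℕ) {G : Config d → ℝ≥0∞} (hG : Measurable G)
    {H : Multiset (EucSp d) → ℝ≥0∞} (hH : Measurable fun l : Tup (EucSp d) => H (ms l))
    (h : ∀ γ, G γ = H (loc γ n).val) :
    ENNReal.ofReal (I.nrm (ballSeq d n)ᶜ (ballSeq d n)) * ∫⁻ γ, G γ ∂gibbs hW
      = ∫⁻ s, ENNReal.ofReal (ind (ballSeq d n) (ms s)) * H (ms s)
          * ENNReal.ofReal (I.corr (ballSeq d n)ᶜ (ms s)) ∂tupMeas I.ν := by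
  rw [← nrm_mul_lintegral_acc hW n hH, lintegral_gibbs hW hG]
  congr 1
  refine lintegral_congr_ae ?_
  filter_upwards [ae_mem_goodSet hW] with ω hω
  rw [h, loc_configOf hW hω]

end

end Interaction

end Ruelle

/-! ### Correlation functions of the Gibbs measure -/

namespace Ruelle

section

variable {d n : ℕ}

lemma exists_perm_of_range_eq {α : Type} {x y : Fin n → α} (hx : Function.Injective x)
    (hy : Function.Injective y) (h : Set.range x = Set.range y) :
    ∃ σ : Equiv.Perm (Fin n), x = y ∘ σ := by
  refine ⟨((Equiv.ofInjective x hx).trans (Equiv.setCongr h)).trans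
    (Equiv.ofInjective y hy).symm, ?_⟩
  funext i
  simp only [Function.comp_apply, Equiv.trans_apply, Equiv.apply_ofInjective_symm hy,
    Equiv.setCongr_apply, Equiv.ofInjective_apply]

lemma range_eq_of_ms_eq {α : Type} {x y : Fin n → α}
    (h : ms (⟨n, x⟩ : Tup α) = ms (⟨n, y⟩ : Tup α)) : Set.range x = Set.range y := by
  ext a
  rw [Set.mem_range, Set.mem_range, ← mem_ms, ← mem_ms, h]

/-- A symmetric function on tuples as a function on multisets (without repetitions). -/
def symFn {α : Type} (f : (Fin n → α) → ℝ≥0∞) (t : Multiset α) : ℝ≥0∞ :=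
  ⨆ (x : Fin n → α) (_ : ms (⟨n, x⟩ : Tup α) = t ∧ Function.Injective x), f x

lemma symFn_ms {α : Type} {f : (Fin n → α) → ℝ≥0∞}
    (hf : ∀ (σ : Equiv.Perm (Fin n)) (x : Fin n → α), f (x ∘ σ) = f x) (x : Fin n → α) :
    symFn f (ms (⟨n, x⟩ : Tup α)) = {x | Function.Injective x}.indicator f x := by
  by_cases hx : Function.Injective x
  · rw [Set.indicator_of_mem (by exact hx)]
    refine le_antisymm (iSup₂_le fun y hy => ?_) (le_iSup₂_of_le x ⟨rfl, hx⟩ le_rfl)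
    obtain ⟨σ, rfl⟩ := exists_perm_of_range_eq hy.2 hx (range_eq_of_ms_eq hy.1)
    exact (hf σ x).le
  · rw [Set.indicator_of_notMem (by exact hx)]
    refine le_antisymm (iSup₂_le fun y hy => absurd ?_ hx) bot_le
    rw [← nodup_ms, ← hy.1, nodup_ms]
    exact hy.2

lemma symFn_of_card_ne {α : Type} {f : (Fin n → α) → ℝ≥0∞} {t : Multiset α}
    (ht : t.card ≠ n) : symFn f t = 0 := by
  refine le_antisymm (iSup₂_le fun y hy => absurd ?_ ht) bot_le
  rw [← hy.1, card_ms]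

lemma measurable_symFn {f : (Fin n → EucSp d) → ℝ≥0∞} (hm : Measurable f)
    (hf : ∀ (σ : Equiv.Perm (Fin n)) (x : Fin n → EucSp d), f (x ∘ σ) = f x) :
    Measurable fun l : Tup (EucSp d) => symFn f (ms l) := by
  refine measurable_tup fun m => ?_
  by_cases h : m = n
  · subst h
    simp only [symFn_ms hf]
    exact hm.indicator measurableSet_injective
  · have : ∀ x : Fin m → EucSp d, symFn f (ms (⟨m, x⟩ : Tup (EucSp d))) = 0 := fun x =>
      symFn_of_card_ne (by simpa using h)
    simp only [this]
    exact measurable_const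

lemma sum_injective_image_eq {α : Type} {f : (Fin n → α) → ℝ≥0∞}
    (hf : ∀ (σ : Equiv.Perm (Fin n)) (x : Fin n → α), f (x ∘ σ) = f x) {S t : Finset α}
    (ht : t ⊆ S) :
    ∑ p ∈ ((Fintype.piFinset fun _ : Fin n => S).filter Function.Injective).filter
        (fun p => Finset.univ.image p = t), f p = n.factorial * symFn f t.val := by
  obtain ⟨⟨m, x⟩, hx⟩ := exists_ms_eq t.val
  have hxi : Function.Injective x := by
    rw [← nodup_ms, hx]
    exact t.nodup
  have hxt : ∀ a, a ∈ t ↔ ∃ i, x i = a := fun a => by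
    rw [← mem_ms, hx, Finset.mem_val]
  have hm : t.card = m := by
    rw [Finset.card_def, ← hx, card_ms]
  by_cases h : m = n
  · subst h
    have himg : ((Fintype.piFinset fun _ : Fin m => S).filter Function.Injective).filter
        (fun p => Finset.univ.image p = t)
        = Finset.univ.image fun σ : Equiv.Perm (Fin m) => x ∘ σ := by
      ext p
      simp only [Finset.mem_filter, Fintype.mem_piFinset, Finset.mem_image, Finset.mem_univ,
        true_and]
      constructor
      · rintro ⟨⟨-, hp⟩, hpt⟩
        obtain ⟨σ, hσ⟩ := exists_perm_of_range_eq hp hxi (by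
          ext a
          rw [Set.mem_range, Set.mem_range, ← hxt, ← hpt]
          simp)
        exact ⟨σ, hσ.symm⟩
      · rintro ⟨σ, rfl⟩
        refine ⟨⟨fun i => ht ((hxt _).2 ⟨σ i, rfl⟩), hxi.comp σ.injective⟩, ?_⟩
        ext a
        simp only [Finset.mem_image, Finset.mem_univ, true_and, hxt, Function.comp_apply]
        exact ⟨fun ⟨i, hi⟩ => ⟨σ i, hi⟩, fun ⟨i, hi⟩ => ⟨σ.symm i, by simpa using hi⟩⟩
    have hinj : Function.Injective fun σ : Equiv.Perm (Fin m) => x ∘ σ := fun σ τ h =>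
      Equiv.ext fun i => hxi (congrFun h i)
    rw [himg, Finset.sum_image hinj.injOn]
    simp only [hf, ← hx, symFn_ms hf, Finset.sum_const, Finset.card_univ, Fintype.card_perm,
      Fintype.card_fin, nsmul_eq_mul]
    rw [Set.indicator_of_mem (by exact hxi)]
  · rw [symFn_of_card_ne (by rw [← Finset.card_def, hm]; exact h), mul_zero]
    refine Finset.sum_eq_zero fun p hp => absurd ?_ h
    simp only [Finset.mem_filter] at hp
    rw [← hm, ← hp.2, Finset.card_image_of_injective _ hp.1.2]
    simp

lemma exists_sum_injective_eq {α : Type} {f : (Fin n → α) → ℝ≥0∞}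
    (hf : ∀ (σ : Equiv.Perm (Fin n)) (x : Fin n → α), f (x ∘ σ) = f x) (S : Finset α) :
    ∃ A : Finset (Fin n → α), (∀ p, p ∈ A ↔ Function.Injective p ∧ ∀ i, p i ∈ S) ∧
      ∑ p ∈ A, f p = n.factorial * splitSum (fun t _ => symFn f t) S.val := by
  refine ⟨(Fintype.piFinset fun _ : Fin n => S).filter Function.Injective, fun p => ?_, ?_⟩
  · simp only [Finset.mem_filter, Fintype.mem_piFinset, and_comm]
  rw [splitSum_val, Finset.mul_sum,
    ← Finset.sum_fiberwise_of_maps_to (g := fun p => Finset.univ.image p) (t := S.powerset)]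
  · exact Finset.sum_congr rfl fun t ht => sum_injective_image_eq hf (Finset.mem_powerset.1 ht)
  · intro p hp
    simp only [Finset.mem_filter, Fintype.mem_piFinset] at hp
    rw [Finset.mem_powerset]
    intro a ha
    simp only [Finset.mem_image, Finset.mem_univ, true_and] at ha
    obtain ⟨i, rfl⟩ := ha
    exact hp.1 i

lemma tsum_injTuples_loc {f : (Fin n → EucSp d) → ℝ≥0∞}
    (hf : ∀ (σ : Equiv.Perm (Fin n)) (x : Fin n → EucSp d), f (x ∘ σ) = f x) (γ : Config d)
    (N : ℕ) :
    ∑' p : injTuples n γ.1, {x | ∀ i, x i ∈ ballSeq d N}.indicator f p.1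
      = n.factorial * splitSum (fun t _ => symFn f t) (loc γ N).val := by
  obtain ⟨A, hA, hsum⟩ := exists_sum_injective_eq hf (loc γ N)
  have hset : injTuples n γ.1 ∩ {x | ∀ i, x i ∈ ballSeq d N} = (A : Set (Fin n → EucSp d)) := by
    ext p
    rw [Finset.mem_coe, hA]
    simp only [mem_loc]
    exact ⟨fun h => ⟨h.1.1, fun i => ⟨h.1.2 i, h.2 i⟩⟩,
      fun h => ⟨⟨h.1, fun i => (h.2 i).1⟩, fun i => (h.2 i).2⟩⟩
  rw [tsum_subtype (injTuples n γ.1), Set.indicator_indicator, hset, ← tsum_subtype,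
    Finset.tsum_subtype', hsum]

lemma measurableSet_forall_mem_ballSeq (N : ℕ) :
    MeasurableSet {x : Fin n → EucSp d | ∀ i, x i ∈ ballSeq d N} := by
  have : {x : Fin n → EucSp d | ∀ i, x i ∈ ballSeq d N}
      = ⋂ i, (fun x : Fin n → EucSp d => x i) ⁻¹' ballSeq d N := by
    ext x
    simp
  rw [this]
  exact MeasurableSet.iInter fun i => measurable_pi_apply i (measurableSet_ballSeq N)

lemma tsum_iSup_of_monotone {ι : Type*} {f : ℕ → ι → ℝ≥0∞} (h : Monotone f) :
    ∑' i, ⨆ n, f n i = ⨆ n, ∑' i, f n i := by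
  let _ : MeasurableSpace ι := ⊤
  simp only [← lintegral_count]
  exact lintegral_iSup (fun n => measurable_from_top) h

/-- Truncation of a function on tuples to the tuples with entries in a ball. -/
def cut (N : ℕ) (f : (Fin n → EucSp d) → ℝ≥0∞) : (Fin n → EucSp d) → ℝ≥0∞ :=
  {x | ∀ i, x i ∈ ballSeq d N}.indicator f

lemma iSup_cut (f : (Fin n → EucSp d) → ℝ≥0∞) (x : Fin n → EucSp d) :
    ⨆ N, cut N f x = f x := by
  refine le_antisymm (iSup_le fun N => Set.indicator_le_self _ _ _) ?_
  obtain ⟨r, hr⟩ := (Set.finite_range x).isBounded.subset_ball 0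
  obtain ⟨N, hN⟩ := exists_nat_ge r
  refine le_iSup_of_le N ?_
  rw [cut, Set.indicator_of_mem]
  exact fun i => Metric.ball_subset_ball hN (hr ⟨i, rfl⟩)

lemma monotone_cut (f : (Fin n → EucSp d) → ℝ≥0∞) : Monotone fun N => cut N f := by
  intro M N h
  refine Set.indicator_le_indicator_of_subset ?_ fun _ => bot_le
  intro x hx
  have hx' : ∀ i, x i ∈ ballSeq d M := hx
  exact fun i => exhaustion_volume.mono h (hx' i)

lemma measurable_cut {f : (Fin n → EucSp d) → ℝ≥0∞} (hf : Measurable f) (N : ℕ) :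
    Measurable (cut N f) := hf.indicator (measurableSet_forall_mem_ballSeq N)

end

namespace Interaction

variable {d n : ℕ} {I : Interaction (EucSp d)} (hW : Exhaustion I.ν (ballSeq d))

lemma lintegral_tsum_injTuples_loc {f : (Fin n → EucSp d) → ℝ≥0∞} (hm : Measurable f)
    (hf : ∀ (σ : Equiv.Perm (Fin n)) (x : Fin n → EucSp d), f (x ∘ σ) = f x) (N : ℕ) :
    ∫⁻ γ, ∑' p : injTuples n γ.1, {x | ∀ i, x i ∈ ballSeq d N}.indicator f p.1 ∂gibbs hW
      = ∫⁻ x, {x | ∀ i, x i ∈ ballSeq d N}.indicator f x * ENNReal.ofReal (I.corr univ (ms ⟨n, x⟩))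
          ∂Measure.pi fun _ : Fin n => I.ν := by
  have hB := measurableSet_forall_mem_ballSeq (d := d) (n := n) N
  have hs := measurable_symFn hm hf
  have hfac : (n.factorial : ℝ≥0∞) ≠ 0 := by exact_mod_cast n.factorial_ne_zero
  have hsp : Measurable fun l : Tup (EucSp d) => splitSum (fun t _ => symFn f t) (ms l) :=
    measurable_splitSum' (K := fun t _ => symFn f t) (hs.comp measurable_fst)
  have h1 := nrm_mul_lintegral_gibbs hW N (measurable_tsum_injTuples (hm.indicator hB))
    (H := fun s => n.factorial * splitSum (fun t _ => symFn f t) s) (hsp.const_mul _)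
    fun γ => tsum_injTuples_loc hf γ N
  have h2 := I.lintegral_ind_splitSum_corr (measurableSet_ballSeq N) (hW.fin N) hs
  have h3 : ∀ s : Tup (EucSp d), ENNReal.ofReal (ind (ballSeq d N) (ms s)) *
      (n.factorial * splitSum (fun t _ => symFn f t) (ms s)) *
        ENNReal.ofReal (I.corr (ballSeq d N)ᶜ (ms s))
      = n.factorial * (ENNReal.ofReal (ind (ballSeq d N) (ms s)) *
        splitSum (fun t _ => symFn f t) (ms s) *
        ENNReal.ofReal (I.corr (ballSeq d N)ᶜ (ms s))) := fun s => by ring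
  simp only [h3] at h1
  rw [lintegral_const_mul' _ _ (ENNReal.natCast_ne_top _), h2, mul_left_comm,
    ENNReal.mul_right_inj (nrm_ne_zero hW N) ENNReal.ofReal_ne_top] at h1
  rw [h1, lintegral_tup, tsum_eq_single n]
  · rw [← mul_assoc, ENNReal.mul_inv_cancel hfac (ENNReal.natCast_ne_top _), one_mul]
    refine lintegral_congr fun x => ?_
    by_cases hx : Function.Injective x
    · rw [symFn_ms hf, Set.indicator_of_mem (by exact hx), ind_eq]
      simp only [mem_ms, forall_exists_index, forall_apply_eq_imp_iff]
      by_cases hb : ∀ i, x i ∈ ballSeq d N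
      · rw [if_pos hb, Set.indicator_of_mem (by exact hb)]
        simp
      · rw [if_neg hb, Set.indicator_of_notMem (by exact hb)]
        simp
    · rw [I.corr_of_not_nodup (by rwa [nodup_ms])]
      simp
  · intro m hmn
    have : ∀ x : Fin m → EucSp d, symFn f (ms (⟨m, x⟩ : Tup (EucSp d))) = 0 := fun x =>
      symFn_of_card_ne (by simpa using hmn)
    simp [this]

lemma lintegral_tsum_injTuples {f : (Fin n → EucSp d) → ℝ≥0∞} (hm : Measurable f)
    (hf : ∀ (σ : Equiv.Perm (Fin n)) (x : Fin n → EucSp d), f (x ∘ σ) = f x) :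
    ∫⁻ γ, ∑' p : injTuples n γ.1, f p.1 ∂gibbs hW
      = ∫⁻ x, f x * ENNReal.ofReal (I.corr univ (ms ⟨n, x⟩)) ∂Measure.pi fun _ : Fin n => I.ν := by
  have hB := measurable_cut hm
  have hmono := monotone_cut f
  have hk : Measurable fun x : Fin n → EucSp d => ENNReal.ofReal (I.corr univ (ms ⟨n, x⟩)) :=
    ((I.measurable_corr MeasurableSet.univ).comp (measurable_sigmaMk n)).ennreal_ofReal
  have h1 : ∀ γ : Config d, ∑' p : injTuples n γ.1, f p.1
      = ⨆ N, ∑' p : injTuples n γ.1, cut N f p.1 := by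
    intro γ
    refine Eq.trans ?_ (tsum_iSup_of_monotone
      (f := fun N (p : injTuples n γ.1) => cut N f p.1)
      fun M N h p => hmono h p.1)
    exact tsum_congr fun p => (iSup_cut f p.1).symm
  have h2 : ∀ x : Fin n → EucSp d, f x * ENNReal.ofReal (I.corr univ (ms ⟨n, x⟩))
      = ⨆ N, cut N f x
        * ENNReal.ofReal (I.corr univ (ms ⟨n, x⟩)) := by
    intro x
    rw [← ENNReal.iSup_mul, iSup_cut]
  simp only [h1, h2]
  rw [lintegral_iSup (fun N => measurable_tsum_injTuples (hB N)) fun M N h γ =>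
      ENNReal.tsum_le_tsum fun p => hmono h p.1,
    lintegral_iSup
      (f := fun N (x : Fin n → EucSp d) => cut N f x * ENNReal.ofReal (I.corr univ (ms ⟨n, x⟩)))
      (fun N => (hB N).mul hk) fun M N h x => mul_le_mul_left (hmono h x) _]
  exact iSup_congr fun N => lintegral_tsum_injTuples_loc hW hm hf N

end Interaction

end Ruelle

/-! ### Void events generate the σ-algebra of the configuration space -/

namespace Ruelle

section

variable {d : ℕ}

/-- The event that a configuration has no points in a given set. -/
def voidSet (B : Set (EucSp d)) : Set (Config d) := {γ | γ.1 ∩ B = ∅}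

lemma measurableSet_voidSet {B : Set (EucSp d)} (hB : MeasurableSet B) :
    MeasurableSet (voidSet B) := by
  have h : voidSet B = (fun γ : Config d => ((γ.1 ∩ B).encard : ℝ≥0∞)) ⁻¹' {0} := by
    ext γ
    simp [voidSet]
  rw [h]
  exact measurable_encard_inter hB (measurableSet_singleton _)

/-- Bounded measurable sets. -/
def bddSets (d : ℕ) : Set (Set (EucSp d)) := {B | MeasurableSet B ∧ ∃ N, B ⊆ ballSeq d N}

lemma inter_ballSeq_mem_bddSets {B : Set (EucSp d)} (hB : MeasurableSet B) (N : ℕ) :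
    B ∩ ballSeq d N ∈ bddSets d :=
  ⟨hB.inter (measurableSet_ballSeq N), N, Set.inter_subset_right⟩

lemma ballSeq_mem_bddSets (N : ℕ) : ballSeq d N ∈ bddSets d :=
  ⟨measurableSet_ballSeq N, N, le_rfl⟩

/-- Void events of bounded sets. -/
def voidEvents (d : ℕ) : Set (Set (Config d)) := voidSet '' bddSets d

lemma measurableSet_generateFrom_voidSet {B : Set (EucSp d)} (hB : MeasurableSet B) :
    MeasurableSet[MeasurableSpace.generateFrom (voidEvents d)] (voidSet B) := by
  have h : voidSet B = ⋂ N, voidSet (B ∩ ballSeq d N) := by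
    ext γ
    simp only [voidSet, Set.mem_iInter, Set.mem_ofPred_eq]
    rw [← Set.iUnion_eq_empty, ← Set.inter_iUnion, ← Set.inter_iUnion,
      exhaustion_volume.cover, Set.inter_univ]
  rw [h]
  exact MeasurableSet.iInter fun N =>
    MeasurableSpace.measurableSet_generateFrom ⟨_, inter_ballSeq_mem_bddSets hB N, rfl⟩

lemma natCast_le_encard_iff (γ : Config d) (B : Set (EucSp d)) (k : ℕ) :
    (k : ℕ∞) ≤ (γ.1 ∩ B).encard ↔ ∃ U : Fin k → TopologicalSpace.countableBasis (EucSp d),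
      (Pairwise fun i j => Disjoint (U i).1 (U j).1) ∧ ∀ i, γ ∉ voidSet (B ∩ (U i).1) := by
  constructor
  · intro h
    obtain ⟨t, ht, htk⟩ := Set.exists_subset_encard_eq h
    have hfin : t.Finite := Set.finite_of_encard_eq_coe htk
    obtain ⟨V, hV, hdisj⟩ := hfin.t2_separation
    have hcard : hfin.toFinset.card = k := by
      rw [hfin.encard_eq_coe_toFinset_card] at htk
      exact_mod_cast htk
    let e := hfin.toFinset.equivFinOfCardEq hcard
    have hmem : ∀ i, (e.symm i).1 ∈ t := fun i => hfin.mem_toFinset.1 (e.symm i).2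
    choose U hU hxU hUV using fun i =>
      (TopologicalSpace.isBasis_countableBasis (EucSp d)).exists_subset_of_mem_open
        (hV (e.symm i).1).1 (hV (e.symm i).1).2
    refine ⟨fun i => ⟨U i, hU i⟩, fun i j hij => ?_, fun i hi => ?_⟩
    · refine (hdisj (hmem i) (hmem j) fun h => hij ?_).mono (hUV i) (hUV j)
      exact e.symm.injective (Subtype.ext h)
    · have : (e.symm i).1 ∈ γ.1 ∩ (B ∩ U i) := ⟨(ht (hmem i)).1, (ht (hmem i)).2, hxU i⟩
      rw [show γ.1 ∩ (B ∩ U i) = ∅ from hi] at this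
      exact this
  · rintro ⟨U, hdisj, hU⟩
    choose x hx using fun i => Set.nonempty_iff_ne_empty.2 (hU i)
    have hinj : Function.Injective x := by
      intro i j hij
      by_contra hne
      exact Set.disjoint_left.1 (hdisj hne) (hx i).2.2 (hij ▸ (hx j).2.2)
    calc (k : ℕ∞) = (Set.range x).encard := by
          rw [← Set.image_univ, hinj.encard_image, Set.encard_univ]
          simp
      _ ≤ _ := Set.encard_le_encard (by
          rintro _ ⟨i, rfl⟩
          exact ⟨(hx i).1, (hx i).2.1⟩)

lemma enat_toENNReal_eq_iSup (n : ℕ∞) :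
    (n : ℝ≥0∞) = ⨆ k : ℕ, if (k : ℕ∞) ≤ n then (k : ℝ≥0∞) else 0 := by
  refine le_antisymm ?_ (iSup_le fun k => ?_)
  · cases n with
    | top => simp [ENNReal.iSup_natCast]
    | coe m => exact le_iSup_of_le m (by simp)
  · split_ifs with h
    · exact_mod_cast h
    · exact bot_le

lemma measurable_toENNReal_of_le {Ω : Type*} [MeasurableSpace Ω] {f : Ω → ℕ∞}
    (h : ∀ k : ℕ, MeasurableSet {ω | (k : ℕ∞) ≤ f ω}) :
    Measurable fun ω => (f ω : ℝ≥0∞) := by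
  simp only [enat_toENNReal_eq_iSup]
  exact Measurable.iSup fun k => Measurable.ite (h k) measurable_const measurable_const

lemma generateFrom_voidEvents :
    MeasurableSpace.generateFrom (voidEvents d) = Config.instMS d := by
  refine le_antisymm (MeasurableSpace.generateFrom_le ?_) ?_
  · rintro _ ⟨B, hB, rfl⟩
    exact measurableSet_voidSet hB.1
  · have h : @Measurable _ _ (MeasurableSpace.generateFrom (voidEvents d)) _
        (id : Config d → Config d) := by
      refine (@measurable_config_iff d _ (MeasurableSpace.generateFrom (voidEvents d)) id).2
        fun B hB => ?_
      refine @measurable_toENNReal_of_le _ (MeasurableSpace.generateFrom (voidEvents d)) _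
        fun k => ?_
      have hset : {γ : Config d | (k : ℕ∞) ≤ ((id γ : Config d).1 ∩ B).encard}
          = ⋃ (U : Fin k → TopologicalSpace.countableBasis (EucSp d))
            (_ : Pairwise fun i j => Disjoint (U i).1 (U j).1),
              ⋂ i, (voidSet (B ∩ (U i).1))ᶜ := by
        ext γ
        simp only [Set.mem_iUnion, Set.mem_iInter, Set.mem_compl_iff]
        refine (natCast_le_encard_iff γ B k).trans ?_
        simp only [exists_prop]
      rw [hset]
      have : Countable (TopologicalSpace.countableBasis (EucSp d)) :=
        (TopologicalSpace.countable_countableBasis _).to_subtype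
      refine MeasurableSet.iUnion fun U => MeasurableSet.iUnion fun _ => MeasurableSet.iInter
        fun i => ?_
      exact (measurableSet_generateFrom_voidSet (hB.inter
        (TopologicalSpace.isOpen_of_mem_countableBasis (U i).2).measurableSet)).compl
    exact fun s hs => h hs

lemma generateFrom_bddSets :
    MeasurableSpace.generateFrom (bddSets d) = (inferInstance : MeasurableSpace (EucSp d)) := by
  refine le_antisymm (MeasurableSpace.generateFrom_le fun B hB => hB.1) fun B hB => ?_
  have h : B = ⋃ N, B ∩ ballSeq d N := by
    rw [← Set.inter_iUnion, exhaustion_volume.cover, Set.inter_univ]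
  rw [h]
  exact MeasurableSet.iUnion fun N =>
    MeasurableSpace.measurableSet_generateFrom (inter_ballSeq_mem_bddSets hB N)

lemma voidSet_empty : voidSet (∅ : Set (EucSp d)) = univ := by
  ext γ
  simp [voidSet]

lemma univ_mem_voidEvents : univ ∈ voidEvents d :=
  ⟨∅, ⟨MeasurableSet.empty, 0, Set.empty_subset _⟩, voidSet_empty⟩

lemma isPiSystem_voidEvents_prod :
    IsPiSystem (Set.image2 (· ×ˢ ·) (voidEvents d) (bddSets d)) := by
  refine IsPiSystem.prod ?_ ?_
  · rintro _ ⟨B, ⟨hB, N, hN⟩, rfl⟩ _ ⟨B', ⟨hB', N', hN'⟩, rfl⟩ -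
    refine ⟨B ∪ B', ⟨hB.union hB', max N N', Set.union_subset
      (hN.trans (exhaustion_volume.mono (le_max_left _ _)))
      (hN'.trans (exhaustion_volume.mono (le_max_right _ _)))⟩, ?_⟩
    ext γ
    simp only [voidSet, Set.mem_ofPred_eq, Set.inter_union_distrib_left, Set.union_empty_iff,
      Set.mem_inter_iff]
  · rintro B ⟨hB, N, hN⟩ B' ⟨hB', -⟩ -
    exact ⟨hB.inter hB', N, Set.inter_subset_left.trans hN⟩

/-- Two measures on pairs of a configuration and a point which agree on void events times bounded
sets are equal. -/
lemma ext_of_voidSet_prod {M M' : Measure (Config d × EucSp d)}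
    (hfin : ∀ N, M (univ ×ˢ ballSeq d N) ≠ ⊤)
    (h : ∀ B D N, MeasurableSet B → MeasurableSet D → B ⊆ ballSeq d N → D ⊆ ballSeq d N →
      M (voidSet B ×ˢ D) = M' (voidSet B ×ˢ D)) : M = M' := by
  refine Measure.ext_of_generateFrom_of_iUnion
    (Set.image2 (· ×ˢ ·) (voidEvents d) (bddSets d)) (fun N => univ ×ˢ ballSeq d N) ?_
    isPiSystem_voidEvents_prod ?_ ?_ hfin ?_
  · rw [← generateFrom_prod_eq, generateFrom_voidEvents, generateFrom_bddSets]
    · exact ⟨fun _ => univ, fun _ => univ_mem_voidEvents, by simp [Set.iUnion_const]⟩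
    · exact ⟨ballSeq d, ballSeq_mem_bddSets, exhaustion_volume.cover⟩
  · rw [← Set.prod_iUnion, exhaustion_volume.cover, Set.univ_prod_univ]
  · exact fun N => ⟨univ, univ_mem_voidEvents, _, ballSeq_mem_bddSets N, rfl⟩
  · rintro _ ⟨_, ⟨B, ⟨hB, N, hN⟩, rfl⟩, D, ⟨hD, N', hN'⟩, rfl⟩
    exact h B D (max N N') hB hD (hN.trans (exhaustion_volume.mono (le_max_left _ _)))
      (hN'.trans (exhaustion_volume.mono (le_max_right _ _)))

end

end Ruelle

/-! ### Expectations of exponential functionals -/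

namespace Ruelle

section

variable {α : Type}

lemma ofReal_map_prod {f : α → ℝ} (hf : ∀ y, 0 ≤ f y) (s : Multiset α) :
    ENNReal.ofReal (s.map f).prod = (s.map fun y => ENNReal.ofReal (f y)).prod := by
  rw [← abs_of_nonneg (Multiset.prod_map_nonneg fun y _ => hf y), ofReal_abs_map_prod]
  simp only [abs_of_nonneg (hf _)]

lemma abs_map_prod_le {f : α → ℝ} {c : ℝ} (hf : ∀ y, |f y| ≤ c) (s : Multiset α) :
    |(s.map f).prod| ≤ c ^ s.card := by
  induction s using Multiset.induction with
  | empty => simp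
  | cons a s ih =>
    rw [Multiset.map_cons, Multiset.prod_cons, abs_mul, Multiset.card_cons, pow_succ']
    exact mul_le_mul (hf a) ih (abs_nonneg _) ((abs_nonneg _).trans (hf a))

lemma splitSum_card_one_mul {f g : α → ℝ≥0∞} (hfg : ∀ a, f a * g a = f a) (s : Multiset α) :
    splitSum (fun t r => (if t.card = 1 then (t.map f).prod else 0) * (r.map g).prod) s
      = (s.map f).sum * (s.map g).prod := by
  induction s using Multiset.induction with
  | empty => simp
  | cons a s ih =>
    have h1 : splitSum (fun t r => (if t.card = 1 then (t.map f).prod else 0) *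
        ((a ::ₘ r).map g).prod) s = g a * ((s.map f).sum * (s.map g).prod) := by
      rw [← ih, ← splitSum_const_mul_ennreal]
      refine splitSum_congr fun t r _ => ?_
      rw [Multiset.map_cons, Multiset.prod_cons]
      ring
    have h2 : splitSum (fun t r => (if (a ::ₘ t).card = 1 then ((a ::ₘ t).map f).prod else 0) *
        (r.map g).prod) s = f a * (s.map g).prod := by
      rw [splitSum_single_left]
      · simp
      · intro t r ht
        simp [ht]
    rw [splitSum_cons, h1, h2]
    simp only [Multiset.map_cons, Multiset.sum_cons, Multiset.prod_cons]
    rw [add_mul, ← mul_assoc (f a), hfg]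
    ring

variable [MeasurableSpace α]

lemma lintegral_tup_of_card_one (ν : Measure α) [SigmaFinite ν] {F : Tup α → ℝ≥0∞}
    (hF : Measurable F) (h : ∀ l, l.1 ≠ 1 → F l = 0) :
    ∫⁻ l, F l ∂tupMeas ν = ∫⁻ x, F (tcons x tnil) ∂ν := by
  rw [lintegral_tup, tsum_eq_single 1]
  · rw [lintegral_pi_succ ν (F := fun x => F ⟨1, x⟩) (hF.comp (measurable_sigmaMk 1))]
    simp only [lintegral_pi_zero, Nat.factorial_one, Nat.cast_one, inv_one, one_mul]
    refine lintegral_congr fun x => ?_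
    congr 2
  · intro n hn
    simp [h ⟨n, _⟩ hn]

end

namespace Interaction

variable {α : Type} [MeasurableSpace α] (I : Interaction α)

lemma abs_ind_mul_prod_mul_corr_le {W A : Set α} {h : α → ℝ} {C : ℝ} (hC0 : 1 ≤ C)
    (hC : ∀ y, |h y| ≤ C) (X s : Multiset α) :
    |ind W s * (s.map h).prod * I.corr A (X + s)|
      ≤ ind W s * (C * I.ξ) ^ (X.card + s.card) := by
  rw [abs_mul, abs_mul, abs_of_nonneg (ind_nonneg _ _), mul_assoc]
  refine mul_le_mul_of_nonneg_left ?_ (ind_nonneg _ _)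
  rw [mul_pow]
  refine mul_le_mul ((abs_map_prod_le hC s).trans (pow_le_pow_right₀ hC0 (Nat.le_add_left _ _)))
    ?_ (abs_nonneg _) (pow_nonneg (zero_le_one.trans hC0) _)
  have := I.abs_corr_le A (X + s)
  rwa [Multiset.card_add] at this

lemma measurable_ind_mul_prod_mul_corr {W A : Set α} (hW : MeasurableSet W)
    (hA : MeasurableSet A) {h : α → ℝ} (hh : Measurable h) (X : Multiset α) :
    Measurable fun u : Tup α => ind W (ms u) * ((ms u).map h).prod * I.corr A (X + ms u) :=
  ((measurable_ind hW).mul (measurable_map_prod' hh)).mul (I.measurable_corr_add hA X)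

lemma integrable_ind_mul_prod_mul_corr {W A : Set α} (hW : MeasurableSet W) (hfin : I.ν W < ⊤)
    (hA : MeasurableSet A) {h : α → ℝ} (hh : Measurable h) {C : ℝ} (hC0 : 1 ≤ C)
    (hC : ∀ y, |h y| ≤ C) (X : Multiset α) :
    Integrable (fun u : Tup α => ind W (ms u) * ((ms u).map h).prod * I.corr A (X + ms u))
      (tupMeas I.ν) :=
  I.integrable_of_ind_bound hW hfin (C * I.ξ) (mul_nonneg (zero_le_one.trans hC0) I.ξ_pos.le)
    (F := fun s => ind W s * (s.map h).prod * I.corr A (X + s)) X.card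
    (fun s => I.abs_ind_mul_prod_mul_corr_le hC0 hC X s)
    (I.measurable_ind_mul_prod_mul_corr hW hA hh X)

lemma lintegral_ind_prod_corr {W : Set α} (hW : MeasurableSet W) (hfin : I.ν W < ⊤)
    {h : α → ℝ} (hh : Measurable h) {C : ℝ} (hC0 : 0 ≤ C) (hC : ∀ y, |h y| ≤ C)
    (h1 : ∀ y, 0 ≤ h y + 1) (X : Multiset α) :
    ∫⁻ u, ENNReal.ofReal (ind W (ms u)) * ((ms u).map fun y => ENNReal.ofReal (h y + 1)).prod *
        ENNReal.ofReal (I.corr Wᶜ (X + ms u)) ∂tupMeas I.ν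
      = ENNReal.ofReal (I.nrm Wᶜ W) * ENNReal.ofReal
        (∫ t, ind W (ms t) * ((ms t).map h).prod * I.corr univ (X + ms t) ∂tupMeas I.ν) := by
  have hint := I.integrable_ind_mul_prod_mul_corr hW hfin hW.compl (hh.add_const 1)
    (C := C + 1) (by linarith) (fun y => (abs_add_le _ _).trans (by simpa using hC y)) X
  rw [← ENNReal.ofReal_mul (zero_le_one.trans (I.one_le_nrm hW.compl hW hfin)),
    ← I.integral_ind_prod_corr hW hfin hh hC X, ofReal_integral_eq_lintegral_ofReal hint]
  · refine lintegral_congr fun u => ?_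
    rw [ENNReal.ofReal_mul (mul_nonneg (ind_nonneg _ _)
      (Multiset.prod_map_nonneg fun y _ => h1 y)), ENNReal.ofReal_mul (ind_nonneg _ _),
      ofReal_map_prod h1]
  · exact Eventually.of_forall fun u => mul_nonneg (mul_nonneg (ind_nonneg _ _)
      (Multiset.prod_map_nonneg fun y _ => h1 y)) (I.corr_nonneg hW.compl _)

lemma lintegral_ind_sum_mul_prod_corr {W : Set α} (hW : MeasurableSet W) (hfin : I.ν W < ⊤)
    {h : α → ℝ} (hh : Measurable h) {C : ℝ} (hC0 : 0 ≤ C) (hC : ∀ y, |h y| ≤ C)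
    (h1 : ∀ y, 0 ≤ h y + 1) {f : α → ℝ≥0∞} (hf : Measurable f)
    (hfh : ∀ y, f y * ENNReal.ofReal (h y + 1) = f y) :
    ∫⁻ u, ENNReal.ofReal (ind W (ms u)) * (((ms u).map f).sum *
        ((ms u).map fun y => ENNReal.ofReal (h y + 1)).prod) *
        ENNReal.ofReal (I.corr Wᶜ (ms u)) ∂tupMeas I.ν
      = ENNReal.ofReal (I.nrm Wᶜ W) * ∫⁻ x, W.indicator f x * ENNReal.ofReal
        (∫ t, ind W (ms t) * ((ms t).map h).prod * I.corr univ ({x} + ms t) ∂tupMeas I.ν) ∂I.ν := by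
  have hg : Measurable fun y => ENNReal.ofReal (h y + 1) := (hh.add_const 1).ennreal_ofReal
  set K : Multiset α → Multiset α → ℝ≥0∞ := fun t r =>
    (ENNReal.ofReal (ind W t) * if t.card = 1 then (t.map f).prod else 0) *
      (ENNReal.ofReal (ind W r) * (r.map fun y => ENNReal.ofReal (h y + 1)).prod *
        ENNReal.ofReal (I.corr Wᶜ (t + r))) with hK
  have hcm : Measurable fun p : Tup α × Tup α => I.corr Wᶜ (ms p.1 + ms p.2) := by
    have h := I.measurable_corr_add_add hW.compl 0
    simpa using h
  have hone : Measurable fun t : Tup α => if (ms t).card = 1 then ((ms t).map f).prod else 0 := by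
    simp only [card_ms]
    exact Measurable.ite (measurable_tup_fst (measurableSet_singleton 1))
      (measurable_map_prod_ennreal' hf) measurable_const
  have hKm : Measurable fun p : Tup α × Tup α => K (ms p.1) (ms p.2) :=
    (((measurable_ind hW).ennreal_ofReal.mul hone).comp measurable_fst).mul
      ((((measurable_ind hW).ennreal_ofReal.mul
        (measurable_map_prod_ennreal' hg)).comp measurable_snd).mul hcm.ennreal_ofReal)
  have hsplit : ∀ u : Tup α, ENNReal.ofReal (ind W (ms u)) * (((ms u).map f).sum *
        ((ms u).map fun y => ENNReal.ofReal (h y + 1)).prod) *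
        ENNReal.ofReal (I.corr Wᶜ (ms u)) = splitSum K (ms u) := by
    intro u
    rw [mul_right_comm, ← splitSum_card_one_mul hfh, ← splitSum_const_mul_ennreal]
    refine splitSum_congr (R := ℝ≥0∞) fun t r h => ?_
    rw [hK, ← h, ind_add, ENNReal.ofReal_mul (ind_nonneg _ _)]
    dsimp only
    ring
  rw [lintegral_congr hsplit, lintegral_splitSum I.ν hKm,
    lintegral_tup_of_card_one I.ν (F := fun t => ∫⁻ r, K (ms t) (ms r) ∂tupMeas I.ν)
      hKm.lintegral_prod_right' fun l hl => by simp [hK, card_ms, hl]]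
  rw [← lintegral_const_mul' _ _ ENNReal.ofReal_ne_top]
  refine lintegral_congr fun x => ?_
  have hm : Measurable fun r : Tup α => ENNReal.ofReal (ind W (ms r)) *
      ((ms r).map fun y => ENNReal.ofReal (h y + 1)).prod *
      ENNReal.ofReal (I.corr Wᶜ ({x} + ms r)) :=
    ((measurable_ind hW).ennreal_ofReal.mul (measurable_map_prod_ennreal' hg)).mul
      (I.measurable_corr_add hW.compl {x}).ennreal_ofReal
  have hx : ms (tcons x tnil) = {x} := by simp
  simp only [hK, hx]
  rw [lintegral_const_mul _ hm, I.lintegral_ind_prod_corr hW hfin hh hC0 hC h1]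
  by_cases hxW : x ∈ W
  · simp [ind_eq, hxW]
    ring
  · simp [ind_eq, hxW]

end Interaction

end Ruelle

/-! ### The reduced Campbell measure on void events -/

namespace Ruelle

namespace Interaction

section

variable {α : Type} [MeasurableSpace α] (I : Interaction α)

/-- The expected Boltzmann factor of a point `x` on the void event of `B`. -/
def voidVal (x : α) (B : Set α) : ℝ :=
  ∫ u, ((ms u).map (I.voidF x B)).prod * I.corr univ (ms u) ∂tupMeas I.ν

end

variable {d : ℕ} {I : Interaction (EucSp d)} (hW : Exhaustion I.ν (ballSeq d))

lemma lintegral_tsum_voidSet {B D : Set (EucSp d)} {N : ℕ} (hB : MeasurableSet B)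
    (hD : MeasurableSet D) (hBN : B ⊆ ballSeq d N) (hDN : D ⊆ ballSeq d N) :
    ∫⁻ γ, (voidSet B).indicator (fun γ => ∑' x : γ.1, D.indicator 1 x.1) γ ∂gibbs hW
      = ∫⁻ x, (D \ B).indicator 1 x * ENNReal.ofReal (I.z * I.voidVal x B) ∂I.ν := by
  have hh : Measurable fun y : EucSp d => -B.indicator (1 : EucSp d → ℝ) y :=
    (measurable_one.indicator hB).neg
  have hC : ∀ y : EucSp d, |-B.indicator (1 : EucSp d → ℝ) y| ≤ 1 := by
    intro y
    by_cases hy : y ∈ B <;> simp [hy]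
  have h1 : ∀ y : EucSp d, 0 ≤ -B.indicator (1 : EucSp d → ℝ) y + 1 := by
    intro y
    by_cases hy : y ∈ B <;> simp [hy]
  have hf : Measurable ((D \ B).indicator (1 : EucSp d → ℝ≥0∞)) :=
    measurable_one.indicator (hD.diff hB)
  have hfh : ∀ y : EucSp d, (D \ B).indicator (1 : EucSp d → ℝ≥0∞) y *
      ENNReal.ofReal (-B.indicator (1 : EucSp d → ℝ) y + 1) = (D \ B).indicator 1 y := by
    intro y
    by_cases hy : y ∈ B <;> simp [hy]
  have hG : Measurable fun γ : Config d =>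
      (voidSet B).indicator (fun γ => ∑' x : γ.1, D.indicator (1 : EucSp d → ℝ≥0∞) x.1) γ :=
    (measurable_tsum_config (Φ := id) measurable_id
      (F := fun p : Config d × EucSp d => D.indicator (1 : EucSp d → ℝ≥0∞) p.2)
      ((measurable_one.indicator hD).comp measurable_snd)).indicator (measurableSet_voidSet hB)
  have hH : Measurable fun l : Tup (EucSp d) =>
      ((ms l).map ((D \ B).indicator (1 : EucSp d → ℝ≥0∞))).sum *
        ((ms l).map fun y => ENNReal.ofReal (-B.indicator (1 : EucSp d → ℝ) y + 1)).prod :=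
    (measurable_map_sum hf).mul
      (measurable_map_prod_ennreal' (hh.add_const 1).ennreal_ofReal)
  have hGH : ∀ γ : Config d,
      (voidSet B).indicator (fun γ => ∑' x : γ.1, D.indicator (1 : EucSp d → ℝ≥0∞) x.1) γ
        = ((loc γ N).val.map ((D \ B).indicator (1 : EucSp d → ℝ≥0∞))).sum *
          ((loc γ N).val.map fun y =>
            ENNReal.ofReal (-B.indicator (1 : EucSp d → ℝ) y + 1)).prod := by
    intro γ
    by_cases hγ : γ ∈ voidSet B
    · have hnB : ∀ y ∈ γ.1, y ∉ B := fun y hy hyB => by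
        have : y ∈ γ.1 ∩ B := ⟨hy, hyB⟩
        rw [show γ.1 ∩ B = ∅ from hγ] at this
        exact this
      have hprod : ((loc γ N).val.map fun y =>
          ENNReal.ofReal (-B.indicator (1 : EucSp d → ℝ) y + 1)).prod = 1 :=
        Finset.prod_eq_one fun y hy => by simp [hnB y (mem_loc.1 hy).1]
      rw [Set.indicator_of_mem hγ, hprod, mul_one]
      refine Eq.trans (tsum_congr fun y => ?_) (tsum_loc γ N _)
      by_cases hyD : y.1 ∈ D
      · simp [hyD, hnB y.1 y.2, hDN hyD]
      · by_cases hyN : y.1 ∈ ballSeq d N <;> simp [hyD, hyN]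
    · obtain ⟨y, hyγ, hyB⟩ : (γ.1 ∩ B).Nonempty := Set.nonempty_iff_ne_empty.2 hγ
      rw [Set.indicator_of_notMem hγ, Multiset.prod_eq_zero, mul_zero]
      exact Multiset.mem_map.2 ⟨y, mem_loc.2 ⟨hyγ, hBN hyB⟩, by simp [hyB]⟩
  have key := nrm_mul_lintegral_gibbs hW N hG (H := fun s =>
    (s.map ((D \ B).indicator (1 : EucSp d → ℝ≥0∞))).sum *
      (s.map fun y => ENNReal.ofReal (-B.indicator (1 : EucSp d → ℝ) y + 1)).prod) hH hGH
  rw [I.lintegral_ind_sum_mul_prod_corr (measurableSet_ballSeq N) (hW.fin N) hh zero_le_one hC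
    h1 hf hfh] at key
  refine (ENNReal.mul_right_inj (nrm_ne_zero hW N) ENNReal.ofReal_ne_top).1
    (key.trans ?_)
  congr 1
  refine lintegral_congr fun x => ?_
  have hind : ∀ s : Multiset (EucSp d), ind (ballSeq d N) s *
      (s.map fun y => -B.indicator (1 : EucSp d → ℝ) y).prod
        = (s.map fun y => -B.indicator (1 : EucSp d → ℝ) y).prod := by
    intro s
    rw [ind_mul_map_prod]
    congr 2
    funext y
    by_cases hy : y ∈ B
    · simp [hy, hBN hy]
    · simp [hy]
  simp only [hind]
  rw [I.integral_void_corr x hB ((measure_mono hBN).trans_lt (hW.fin N)), voidVal]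
  congr 1
  by_cases hx : x ∈ ballSeq d N
  · simp [hx]
  · have : x ∉ D := fun h => hx (hDN h)
    simp [hx, this]

lemma lintegral_tsum_le {w : EucSp d → ℝ≥0∞} (hw : Measurable w) :
    ∫⁻ γ, ∑' y : γ.1, w y.1 ∂gibbs hW ≤ ENNReal.ofReal I.ξ * ∫⁻ y, w y ∂I.ν := by
  have hsym : ∀ (σ : Equiv.Perm (Fin 1)) (x : Fin 1 → EucSp d), w ((x ∘ σ) 0) = w (x 0) := by
    intro σ x
    rw [Subsingleton.elim σ 1]
    rfl
  have hw0 : Measurable fun x : Fin 1 → EucSp d => w (x 0) := hw.comp (measurable_pi_apply 0)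
  have h := lintegral_tsum_injTuples hW (n := 1) (f := fun x => w (x 0)) hw0 hsym
  have hL : ∀ γ : Config d, ∑' p : injTuples 1 γ.1, w (p.1 0) = ∑' y : γ.1, w y.1 := by
    intro γ
    refine Equiv.tsum_eq (⟨fun p => ⟨p.1 0, p.2.2 0⟩,
      fun y => ⟨fun _ => y.1, Function.injective_of_subsingleton _, fun _ => y.2⟩,
      fun p => ?_, fun y => rfl⟩ : injTuples 1 γ.1 ≃ γ.1) (fun y => w y.1)
    apply Subtype.ext
    funext i
    rw [Subsingleton.elim i 0]
  simp only [hL] at h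
  rw [h, lintegral_pi_succ I.ν (F := fun x : Fin 1 → EucSp d =>
    w (x 0) * ENNReal.ofReal (I.corr univ (ms ⟨1, x⟩)))
    (hw0.mul
      ((I.measurable_corr MeasurableSet.univ).comp (measurable_sigmaMk 1)).ennreal_ofReal)]
  simp only [lintegral_pi_zero, Fin.cons_zero]
  rw [← lintegral_const_mul _ hw]
  refine lintegral_mono fun y => ?_
  rw [mul_comm]
  gcongr
  refine (I.corr_le _).trans_eq ?_
  rw [card_ms, pow_one]

end Interaction

end Ruelle

/-! ### The Boltzmann factor of a point given an infinite configuration -/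

namespace Ruelle

section

lemma one_le_map_prod {α : Type} {w : α → ℝ≥0∞} (hw : ∀ y, 1 ≤ w y) (s : Multiset α) :
    1 ≤ (s.map w).prod := by
  induction s using Multiset.induction with
  | empty => simp
  | cons a s ih =>
    rw [Multiset.map_cons, Multiset.prod_cons]
    exact one_le_mul (hw a) ih

lemma monotone_prod_acc {α : Type} {w : α → ℝ≥0∞} (hw : ∀ y, 1 ≤ w y) (ω : ℕ → Tup α) :
    Monotone fun n => ((ms (acc n ω)).map w).prod := by
  refine monotone_nat_of_le_succ fun n => ?_
  rw [acc, ms_tapp, Multiset.map_add, Multiset.prod_add]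
  exact le_mul_of_one_le_right' (one_le_map_prod hw _)

lemma tsum_eq_toReal_sub_toReal {ι : Type*} {f : ι → ℝ} (hf : Summable f) :
    ∑' i, f i = (∑' i, ENNReal.ofReal (f i)).toReal - (∑' i, ENNReal.ofReal (-f i)).toReal := by
  have hp : Summable fun i => max (f i) 0 :=
    Summable.of_nonneg_of_le (fun i => le_max_right _ _)
      (fun i => max_le (le_abs_self _) (abs_nonneg _)) hf.abs
  have hn : Summable fun i => max (-f i) 0 :=
    Summable.of_nonneg_of_le (fun i => le_max_right _ _)
      (fun i => max_le (neg_le_abs _) (abs_nonneg _)) hf.abs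
  have key : ∀ {g : ι → ℝ}, Summable (fun i => max (g i) 0) →
      (∑' i, ENNReal.ofReal (g i)).toReal = ∑' i, max (g i) 0 := by
    intro g hg
    have h0 : ∀ i, ENNReal.ofReal (g i) = ENNReal.ofReal (max (g i) 0) := by
      intro i
      rcases le_total (g i) 0 with h | h
      · simp [h]
      · rw [max_eq_left h]
    simp only [h0]
    rw [← ENNReal.ofReal_tsum_of_nonneg (fun i => le_max_right _ _) hg,
      ENNReal.toReal_ofReal (tsum_nonneg fun i => le_max_right _ _)]
  rw [key hp, key hn, ← hp.tsum_sub hn]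
  refine tsum_congr fun i => ?_
  rcases le_total (f i) 0 with h | h
  · rw [max_eq_right h, max_eq_left (by linarith)]
    ring
  · rw [max_eq_left h, max_eq_right (by linarith)]
    ring

variable {d : ℕ}

lemma tendsto_prod_loc (γ : Config d) {f : EucSp d → ℝ} {a : ℝ}
    (h : HasProd (fun y : γ.1 => f y.1) a) :
    Tendsto (fun n => ∏ y ∈ loc γ n, f y) atTop (𝓝 a) := by
  have hsub : ∀ n, ∏ y ∈ loc γ n, f y = ∏ y ∈ (loc γ n).subtype (· ∈ γ.1), f y.1 := by
    intro n
    rw [Finset.prod_subtype_of_mem f fun y hy => (mem_loc.1 hy).1]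
  simp only [hsub]
  refine h.comp (tendsto_atTop_finset_of_monotone (fun m n hmn y hy => ?_) fun y => ?_)
  · rw [Finset.mem_subtype, mem_loc] at hy ⊢
    exact ⟨hy.1, exhaustion_volume.mono hmn hy.2⟩
  · have : y.1 ∈ ⋃ n, ballSeq d n := by rw [exhaustion_volume.cover]; trivial
    obtain ⟨n, hn⟩ := Set.mem_iUnion.1 this
    exact ⟨n, Finset.mem_subtype.2 (mem_loc.2 ⟨y.2, hn⟩)⟩

end

namespace Interaction

section

variable {α : Type} [MeasurableSpace α] {I : Interaction α} {W : ℕ → Set α}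
  (hW : Exhaustion I.ν W)

lemma lintegral_prod_acc_le {w : α → ℝ≥0∞} (hw : Measurable w) {c : ℝ} (hc0 : 0 ≤ c)
    (hc : ENNReal.ofReal I.ξ * ∫⁻ y, w y ∂I.ν ≤ ENNReal.ofReal c) (n : ℕ) :
    ∫⁻ ω, ((ms (acc n ω)).map fun y => w y + 1).prod ∂shellLaw hW
      ≤ ENNReal.ofReal (Real.exp c) := by
  have key := nrm_mul_lintegral_acc hW n (H := fun s => (s.map fun y => w y + 1).prod)
    (measurable_map_prod_ennreal' (hw.add_const 1))
  have hsplit : ∀ s : Multiset α, (s.map fun y => w y + 1).prod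
      = splitSum (fun t _ => (t.map w).prod) s := by
    intro s
    rw [prod_add_eq_splitSum]
    refine splitSum_congr fun t r _ => ?_
    simp
  simp only [hsplit] at key ⊢
  rw [I.lintegral_ind_splitSum_corr (hW.meas n) (hW.fin n) (measurable_map_prod_ennreal' hw)]
    at key
  rw [(ENNReal.mul_right_inj (nrm_ne_zero hW n) ENNReal.ofReal_ne_top).1 key]
  refine le_trans (lintegral_mono fun t => ?_)
    (lintegral_tup_prod_le I.ν (hw.const_mul (ENNReal.ofReal I.ξ)) hc0
      (by rwa [lintegral_const_mul _ hw]))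
  rw [← pow_card_mul_map_prod, mul_comm (ENNReal.ofReal I.ξ ^ _)]
  refine mul_le_mul' ?_ ?_
  · exact mul_le_of_le_one_left' (ENNReal.ofReal_le_one.2 (ind_le_one _ _))
  · rw [← ENNReal.ofReal_pow I.ξ_pos.le]
    exact ENNReal.ofReal_le_ofReal (I.corr_le _)

/-- The values of the local void approximants. -/
lemma lintegral_prod_voidF_acc (x : α) {B : Set α} (hB : MeasurableSet B) (n : ℕ) :
    ∫⁻ ω, ((ms (acc n ω)).map fun y => ENNReal.ofReal (I.voidF x B y + 1)).prod ∂shellLaw hW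
      = ENNReal.ofReal (∫ t, ind (W n) (ms t) * ((ms t).map (I.voidF x B)).prod *
          I.corr univ (ms t) ∂tupMeas I.ν) := by
  have h1 : ∀ y, 0 ≤ I.voidF x B y + 1 := fun y => by
    rw [voidF, sub_add_cancel]
    exact Set.indicator_nonneg (fun _ _ => I.nonneg _ _) _
  have hh := I.measurable_voidF x hB
  have key := nrm_mul_lintegral_acc hW n
    (H := fun s => (s.map fun y => ENNReal.ofReal (I.voidF x B y + 1)).prod)
    (measurable_map_prod_ennreal' (hh.add_const 1).ennreal_ofReal)
  have h2 := I.lintegral_ind_prod_corr (hW.meas n) (hW.fin n) hh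
    (add_nonneg I.b_pos.le zero_le_one) (I.voidF_abs_le x B) h1 0
  simp only [zero_add] at h2
  rw [h2] at key
  exact (ENNReal.mul_right_inj (nrm_ne_zero hW n) ENNReal.ofReal_ne_top).1 key

lemma tendsto_lintegral_prod_voidF_acc (x : α) {B : Set α} (hB : MeasurableSet B)
    (hfin : I.ν B < ⊤) :
    Tendsto (fun n => ∫⁻ ω, ((ms (acc n ω)).map fun y =>
        ENNReal.ofReal (I.voidF x B y + 1)).prod ∂shellLaw hW) atTop
      (𝓝 (ENNReal.ofReal (I.voidVal x B))) := by
  simp only [lintegral_prod_voidF_acc hW x hB]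
  exact ENNReal.tendsto_ofReal (I.tendsto_integral_ind_prod_corr (I.measurable_voidF x hB)
    (I.lintegral_abs_voidF_lt_top x hB hfin) hW.mono hW.meas hW.cover)

end

variable {d : ℕ} (I : Interaction (EucSp d))

/-- The Boltzmann factor `∏_{y ∈ γ} g(x,y)`, written as the exponential of an absolutely
convergent sum. -/
def boltz (q : Config d × EucSp d) : ℝ≥0∞ :=
  ENNReal.ofReal (Real.exp
    ((∑' y : q.1.1, ENNReal.ofReal (Real.log (I.g q.2 y.1))).toReal
      - (∑' y : q.1.1, ENNReal.ofReal (-Real.log (I.g q.2 y.1))).toReal))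

lemma measurable_boltz : Measurable I.boltz := by
  have hg : Measurable fun p : (Config d × EucSp d) × EucSp d => Real.log (I.g p.1.2 p.2) :=
    Real.measurable_log.comp (I.meas.comp
      ((measurable_snd.comp measurable_fst).prodMk measurable_snd))
  have h1 := measurable_tsum_config (Φ := fun q : Config d × EucSp d => q.1) measurable_fst
    (F := fun p => ENNReal.ofReal (Real.log (I.g p.1.2 p.2))) hg.ennreal_ofReal
  have h2 := measurable_tsum_config (Φ := fun q : Config d × EucSp d => q.1) measurable_fst
    (F := fun p => ENNReal.ofReal (-Real.log (I.g p.1.2 p.2))) hg.neg.ennreal_ofReal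
  exact (Real.measurable_exp.comp (h1.ennreal_toReal.sub h2.ennreal_toReal)).ennreal_ofReal

/-- Pairs `(γ, x)` for which `∏_{y ∈ γ} g(x,y)` converges absolutely. -/
def regSet : Set (Config d × EucSp d) :=
  {q | ∑' y : q.1.1, ENNReal.ofReal |I.g q.2 y.1 - 1| ≠ ⊤ ∧ q.2 ∉ q.1.1}

lemma measurableSet_regSet : MeasurableSet I.regSet := by
  have hg : Measurable fun p : (Config d × EucSp d) × EucSp d => |I.g p.1.2 p.2 - 1| :=
    ((I.meas.comp ((measurable_snd.comp measurable_fst).prodMk measurable_snd)).sub_const 1).abs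
  have h1 := measurable_tsum_config (Φ := fun q : Config d × EucSp d => q.1) measurable_fst
    (F := fun p => ENNReal.ofReal |I.g p.1.2 p.2 - 1|) hg.ennreal_ofReal
  exact (h1 (measurableSet_singleton ⊤).compl).inter measurableSet_mem_config.compl

variable {I}

section

variable {γ : Config d} {x : EucSp d} (h : (γ, x) ∈ I.regSet)

include h

lemma summable_log_of_mem_regSet : Summable fun y : γ.1 => Real.log (I.g x y.1) := by
  have h1 : Summable fun y : γ.1 => I.g x y.1 - 1 := by
    refine Summable.of_abs ?_
    have h2 := ENNReal.summable_toReal h.1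
    refine h2.congr fun y => ?_
    rw [ENNReal.toReal_ofReal (abs_nonneg _)]
  have h2 := Real.summable_log_one_add_of_summable h1
  refine h2.congr fun y => ?_
  rw [add_sub_cancel]

lemma boltz_of_mem_regSet :
    I.boltz (γ, x) = ENNReal.ofReal (Real.exp (∑' y : γ.1, Real.log (I.g x y.1))) := by
  rw [tsum_eq_toReal_sub_toReal (summable_log_of_mem_regSet h)]
  rfl

variable (hpos : ∀ x y, x ≠ y → 0 < I.g x y)

include hpos

lemma g_pos_of_mem_regSet (y : γ.1) : 0 < I.g x y.1 :=
  hpos x y.1 fun hxy => h.2 (hxy ▸ y.2)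

lemma tendsto_prod_loc_boltz :
    Tendsto (fun n => ENNReal.ofReal (∏ y ∈ loc γ n, I.g x y)) atTop (𝓝 (I.boltz (γ, x))) := by
  rw [boltz_of_mem_regSet h]
  refine ENNReal.tendsto_ofReal (tendsto_prod_loc γ (f := I.g x) ?_)
  exact Real.hasProd_of_hasSum_log (g_pos_of_mem_regSet h hpos)
    (summable_log_of_mem_regSet h).hasSum

end

variable (hW : Exhaustion I.ν (ballSeq d))

lemma ae_mem_regSet (hν : ∀ x, I.ν {x} = 0) (x : EucSp d) :
    ∀ᵐ γ ∂gibbs hW, (γ, x) ∈ I.regSet := by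
  have hg : Measurable fun y => ENNReal.ofReal |I.g x y - 1| :=
    ((I.meas.comp measurable_prodMk_left).sub_const 1).abs.ennreal_ofReal
  have hind : Measurable (({x} : Set (EucSp d)).indicator (1 : EucSp d → ℝ≥0∞)) :=
    measurable_one.indicator (measurableSet_singleton x)
  have hmeas : ∀ {w : EucSp d → ℝ≥0∞}, Measurable w →
      Measurable fun γ : Config d => ∑' y : γ.1, w y.1 := fun {w} hw =>
    measurable_tsum_config (Φ := id) measurable_id (F := fun p : Config d × EucSp d => w p.2)
      (hw.comp measurable_snd)
  have h1 : ∀ᵐ γ ∂gibbs hW, ∑' y : γ.1, ENNReal.ofReal |I.g x y.1 - 1| < ⊤ :=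
    ae_lt_top (hmeas hg) ((lintegral_tsum_le hW hg).trans_lt
      (ENNReal.mul_lt_top ENNReal.ofReal_lt_top (I.lintegral_abs_f_lt_top x))).ne
  have h2 : ∫⁻ γ, ∑' y : γ.1, ({x} : Set (EucSp d)).indicator 1 y.1 ∂gibbs hW = 0 := by
    refine le_antisymm ((lintegral_tsum_le hW hind).trans_eq ?_) bot_le
    rw [lintegral_indicator_one (measurableSet_singleton x), hν, mul_zero]
  filter_upwards [h1, (lintegral_eq_zero_iff (hmeas hind)).1 h2] with γ hγ1 hγ2
  refine ⟨hγ1.ne, fun hx => ?_⟩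
  have := ENNReal.tsum_eq_zero.1 hγ2 ⟨x, hx⟩
  simp at this

/-- The expected Boltzmann factor on a void event. -/
lemma lintegral_boltz_voidSet (hpos : ∀ x y, x ≠ y → 0 < I.g x y) (hν : ∀ x, I.ν {x} = 0)
    (x : EucSp d) {B : Set (EucSp d)} {N : ℕ} (hB : MeasurableSet B) (hBN : B ⊆ ballSeq d N) :
    ∫⁻ γ, (voidSet B).indicator (fun γ => I.boltz (γ, x)) γ ∂gibbs hW
      = ENNReal.ofReal (I.voidVal x B) := by
  have hbm : Measurable fun γ => I.boltz (γ, x) :=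
    I.measurable_boltz.comp measurable_prodMk_right
  rw [lintegral_gibbs hW (hbm.indicator (measurableSet_voidSet hB))]
  have hfinB : I.ν B < ⊤ := (measure_mono hBN).trans_lt (hW.fin N)
  have hvm := I.measurable_voidF x hB
  have hvw := I.lintegral_abs_voidF_lt_top x hB hfinB
  have hwm : Measurable fun y => ENNReal.ofReal |I.voidF x B y| := hvm.abs.ennreal_ofReal
  refine (tendsto_nhds_unique (tendsto_lintegral_prod_voidF_acc hW x hB hfinB) ?_).symm
  refine tendsto_lintegral_of_dominated_convergence
    (fun ω => ⨆ n, ((ms (acc n ω)).map fun y => ENNReal.ofReal |I.voidF x B y| + 1).prod)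
    (fun n => (measurable_map_prod_ennreal' (hvm.add_const 1).ennreal_ofReal).comp
      (measurable_acc n)) (fun n => ?_) ?_ ?_
  · refine Eventually.of_forall fun ω => le_iSup_of_le n ?_
    refine Multiset.prod_map_le_prod_map₀ _ _ (fun _ _ => bot_le) fun y _ => ?_
    rw [← ENNReal.ofReal_one, ← ENNReal.ofReal_add (abs_nonneg _) zero_le_one]
    exact ENNReal.ofReal_le_ofReal (by gcongr; exact le_abs_self _)
  · rw [lintegral_iSup (f := fun n ω =>
        ((ms (acc n ω)).map fun y => ENNReal.ofReal |I.voidF x B y| + 1).prod) (fun n => (measurable_map_prod_ennreal' (hwm.add_const 1)).comp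
      (measurable_acc n)) fun m n hmn ω => monotone_prod_acc (fun y => le_add_self) ω hmn]
    have hfin := ENNReal.mul_lt_top (ENNReal.ofReal_lt_top (r := I.ξ)) hvw
    refine ((iSup_le fun n => lintegral_prod_acc_le hW hwm ENNReal.toReal_nonneg
      (ENNReal.ofReal_toReal hfin.ne).ge n).trans_lt ENNReal.ofReal_lt_top).ne
  · have hreg : ∀ᵐ ω ∂shellLaw hW, (configOf hW ω, x) ∈ I.regSet :=
      ae_of_ae_map (measurable_configOf hW).aemeasurable (ae_mem_regSet hW hν x)
    filter_upwards [I.ae_mem_goodSet hW, hreg] with ω hω hr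
    simp only [← loc_configOf hW hω]
    have h1 : ∀ y, 0 ≤ I.voidF x B y + 1 := fun y => by
      rw [voidF, sub_add_cancel]
      exact Set.indicator_nonneg (fun _ _ => I.nonneg _ _) _
    by_cases hv : configOf hW ω ∈ voidSet B
    · rw [Set.indicator_of_mem hv]
      refine (tendsto_prod_loc_boltz hr hpos).congr fun n => ?_
      rw [← ofReal_map_prod h1]
      congr 1
      refine Finset.prod_congr rfl fun y hy => ?_
      have hyB : y ∉ B := fun hyB => by
        have : y ∈ (configOf hW ω).1 ∩ B := ⟨(mem_loc.1 hy).1, hyB⟩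
        rw [show (configOf hW ω).1 ∩ B = ∅ from hv] at this
        exact this
      simp [voidF, hyB]
    · rw [Set.indicator_of_notMem hv]
      obtain ⟨y, hyγ, hyB⟩ : ((configOf hW ω).1 ∩ B).Nonempty := Set.nonempty_iff_ne_empty.2 hv
      refine tendsto_const_nhds.congr' ?_
      filter_upwards [eventually_ge_atTop N] with n hn
      refine (Multiset.prod_eq_zero (Multiset.mem_map.2 ⟨y, mem_loc.2 ⟨hyγ, ?_⟩, ?_⟩)).symm
      · exact exhaustion_volume.mono hn (hBN hyB)
      · simp [voidF, hyB]

end Interaction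

end Ruelle

/-! ### The Georgii–Nguyen–Zessin identity -/

namespace Ruelle

namespace Interaction

variable {d : ℕ} {I : Interaction (EucSp d)} (hW : Exhaustion I.ν (ballSeq d))

lemma measurable_map_cntM :
    Measurable fun γ : Config d => (cntM γ).map (Prod.mk γ) := by
  refine Measure.measurable_of_measurable_coe _ fun s hs => ?_
  have h : ∀ γ : Config d, (cntM γ).map (Prod.mk γ) s = cntM γ (Prod.mk γ ⁻¹' s) :=
    fun γ => Measure.map_apply measurable_prodMk_left hs
  simp only [h]
  exact measurable_cntM_section (Φ := id) measurable_id hs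

/-- The reduced Campbell measure. -/
def campbell : Measure (Config d × EucSp d) :=
  (gibbs hW).bind fun γ => (cntM γ).map (Prod.mk γ)

lemma lintegral_campbell {F : Config d × EucSp d → ℝ≥0∞} (hF : Measurable F) :
    ∫⁻ p, F p ∂campbell hW = ∫⁻ γ, ∑' x : γ.1, F (γ, x.1) ∂gibbs hW := by
  rw [campbell, Measure.lintegral_bind measurable_map_cntM.aemeasurable hF.aemeasurable]
  refine lintegral_congr fun γ => ?_
  rw [lintegral_map hF measurable_prodMk_left, lintegral_cntM]

/-- The measure obtained by inserting a point weighted with its Boltzmann factor. -/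
def insertion : Measure (Config d × EucSp d) :=
  (((gibbs hW).prod I.ν).withDensity fun q => ENNReal.ofReal I.z * I.boltz q).map
    fun q => (q.1.ins q.2, q.2)

lemma lintegral_insertion {F : Config d × EucSp d → ℝ≥0∞} (hF : Measurable F) :
    ∫⁻ p, F p ∂insertion hW
      = ∫⁻ γ, ∫⁻ x, ENNReal.ofReal I.z * I.boltz (γ, x) * F (γ.ins x, x) ∂I.ν ∂gibbs hW := by
  have hins : Measurable fun q : Config d × EucSp d => (q.1.ins q.2, q.2) :=
    measurable_ins.prodMk measurable_snd
  have hb : Measurable fun q => ENNReal.ofReal I.z * I.boltz q := I.measurable_boltz.const_mul _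
  have hFi : Measurable fun q : Config d × EucSp d => F (q.1.ins q.2, q.2) := hF.comp hins
  rw [insertion, lintegral_map hF hins, lintegral_withDensity_eq_lintegral_mul _ hb hFi]
  exact lintegral_prod _ (hb.mul hFi).aemeasurable

lemma insertion_voidSet_prod (hpos : ∀ x y, x ≠ y → 0 < I.g x y) (hν : ∀ x, I.ν {x} = 0)
    {B D : Set (EucSp d)} {N : ℕ} (hB : MeasurableSet B) (hD : MeasurableSet D)
    (hBN : B ⊆ ballSeq d N) :
    insertion hW (voidSet B ×ˢ D)
      = ∫⁻ x, (D \ B).indicator 1 x * ENNReal.ofReal (I.z * I.voidVal x B) ∂I.ν := by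
  have hvB := measurableSet_voidSet hB
  have hpt : ∀ (γ : Config d) (x : EucSp d), ENNReal.ofReal I.z * I.boltz (γ, x) *
      (voidSet B ×ˢ D).indicator 1 (γ.ins x, x)
        = ENNReal.ofReal I.z * (D \ B).indicator 1 x *
          (voidSet B).indicator (fun γ => I.boltz (γ, x)) γ := by
    intro γ x
    have hiff : γ.ins x ∈ voidSet B ↔ x ∉ B ∧ γ ∈ voidSet B := by
      change insert x γ.1 ∩ B = ∅ ↔ x ∉ B ∧ γ.1 ∩ B = ∅
      by_cases hx : x ∈ B
      · rw [Set.insert_inter_of_mem hx]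
        exact ⟨fun h => absurd h (Set.insert_nonempty _ _).ne_empty, fun h => absurd hx h.1⟩
      · simp [Set.insert_inter_of_notMem hx, hx]
    by_cases hx : x ∈ B <;> by_cases hxD : x ∈ D <;> by_cases hγ : γ ∈ voidSet B <;>
      simp [hiff, hx, hxD, hγ]
  have hm : Measurable (Function.uncurry fun (γ : Config d) (x : EucSp d) =>
      ENNReal.ofReal I.z * (D \ B).indicator 1 x *
        (voidSet B).indicator (fun γ => I.boltz (γ, x)) γ) := by
    refine (((measurable_one.indicator (hD.diff hB)).comp measurable_snd).const_mul _).mul ?_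
    exact I.measurable_boltz.indicator (measurable_fst hvB)
  rw [← lintegral_indicator_one (hvB.prod hD),
    lintegral_insertion hW (measurable_one.indicator (hvB.prod hD))]
  simp only [hpt]
  rw [lintegral_lintegral_swap hm.aemeasurable]
  refine lintegral_congr fun x => ?_
  have hbx : Measurable fun γ => I.boltz (γ, x) :=
    I.measurable_boltz.comp measurable_prodMk_right
  rw [lintegral_const_mul _ (hbx.indicator hvB),
    lintegral_boltz_voidSet hW hpos hν x hB hBN, ENNReal.ofReal_mul I.z_pos.le]
  ring

lemma campbell_voidSet_prod {B D : Set (EucSp d)} {N : ℕ} (hB : MeasurableSet B)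
    (hD : MeasurableSet D) (hBN : B ⊆ ballSeq d N) (hDN : D ⊆ ballSeq d N) :
    campbell hW (voidSet B ×ˢ D)
      = ∫⁻ x, (D \ B).indicator 1 x * ENNReal.ofReal (I.z * I.voidVal x B) ∂I.ν := by
  have hS := (measurableSet_voidSet hB).prod hD
  rw [← lintegral_indicator_one hS, lintegral_campbell hW (measurable_one.indicator hS),
    ← lintegral_tsum_voidSet hW hB hD hBN hDN]
  refine lintegral_congr fun γ => ?_
  by_cases hγ : γ ∈ voidSet B
  · rw [Set.indicator_of_mem hγ]
    refine tsum_congr fun x => ?_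
    by_cases hx : x.1 ∈ D <;> simp [hγ, hx]
  · rw [Set.indicator_of_notMem hγ]
    simp [hγ]

lemma campbell_eq_insertion (hpos : ∀ x y, x ≠ y → 0 < I.g x y) (hν : ∀ x, I.ν {x} = 0) :
    campbell hW = insertion hW := by
  refine ext_of_voidSet_prod (fun N => ?_) fun B D N hB hD hBN hDN => ?_
  · have hS : MeasurableSet ((univ : Set (Config d)) ×ˢ ballSeq d N) :=
      MeasurableSet.univ.prod (measurableSet_ballSeq N)
    have hm : Measurable ((ballSeq d N).indicator (1 : EucSp d → ℝ≥0∞)) :=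
      measurable_one.indicator (measurableSet_ballSeq N)
    rw [← lintegral_indicator_one hS, lintegral_campbell hW (measurable_one.indicator hS)]
    refine ((lintegral_mono fun γ => (tsum_congr fun x => ?_).le).trans_lt
      ((lintegral_tsum_le hW hm).trans_lt ?_)).ne
    · by_cases hx : x.1 ∈ ballSeq d N <;> simp [hx]
    · rw [lintegral_indicator_one (measurableSet_ballSeq N)]
      exact ENNReal.mul_lt_top ENNReal.ofReal_lt_top (hW.fin N)
  · rw [campbell_voidSet_prod hW hB hD hBN hDN, insertion_voidSet_prod hW hpos hν hB hD hBN]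

/-- The Georgii–Nguyen–Zessin identity for a positive interaction. -/
theorem lintegral_tsum_eq (hpos : ∀ x y, x ≠ y → 0 < I.g x y) (hν : ∀ x, I.ν {x} = 0)
    {F : Config d × EucSp d → ℝ≥0∞} (hF : Measurable F) :
    ∫⁻ γ, ∑' x : γ.1, F (γ, x.1) ∂gibbs hW
      = ∫⁻ γ, ∫⁻ x, ENNReal.ofReal I.z * I.boltz (γ, x) * F (γ.ins x, x) ∂I.ν ∂gibbs hW := by
  rw [← lintegral_campbell hW hF, campbell_eq_insertion hW hpos hν, lintegral_insertion hW hF]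

lemma ae_ae_mem_regSet (hν : ∀ x, I.ν {x} = 0) :
    ∀ᵐ γ ∂gibbs hW, ∀ᵐ x ∂I.ν, (γ, x) ∈ I.regSet := by
  have h : ∀ᵐ x ∂I.ν, ∀ᵐ γ ∂gibbs hW, (γ, x) ∈ I.regSet :=
    Eventually.of_forall (ae_mem_regSet hW hν)
  exact (Measure.ae_ae_comm (p := fun x γ => (γ, x) ∈ I.regSet)
    (measurable_swap I.measurableSet_regSet)).1 h

end Interaction

end Ruelle

/-! ### Ruelle's theorem -/

namespace Ruelle

namespace Interaction

variable {d : ℕ} (I : Interaction (EucSp d))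

lemma hasCorrFns_gibbs (hW : Exhaustion I.ν (ballSeq d)) (hν : I.ν = volume) :
    HasCorrFns (gibbs hW) fun n x => I.corr univ (ms ⟨n, x⟩) := by
  refine ⟨fun n => ⟨(I.measurable_corr MeasurableSet.univ).comp (measurable_sigmaMk n),
    fun x => I.corr_nonneg MeasurableSet.univ _, fun σ x => congrArg (I.corr univ) (ms_comp_perm σ x)⟩,
    fun n _ f hm hf => ?_⟩
  rw [lintegral_tsum_injTuples hW hm hf, hν, volume_pi]

lemma ruelleBound_corr : RuelleBound (fun n (x : Fin n → EucSp d) => I.corr univ (ms ⟨n, x⟩)) I.ξ :=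
  fun n _ x => (I.corr_le _).trans_eq (by rw [card_ms])

lemma isUrsell_corr :
    IsUrsell (fun n (x : Fin n → EucSp d) => I.corr univ (ms ⟨n, x⟩)) (tupleFn I.urs) :=
  fun _ _ x => eq_sum_isPartOfUniv (I.corr_zero MeasurableSet.univ) I.corr_cons_eq_urs x

lemma transInvFns_corr (hν : I.ν = volume) (hg : ∀ a x y, I.g (x + a) (y + a) = I.g x y) :
    TransInvFns fun n (x : Fin n → EucSp d) => I.corr univ (ms ⟨n, x⟩) := by
  intro n a x
  have hτ : MeasurePreserving (fun y : EucSp d => y + a) I.ν I.ν := by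
    rw [hν]
    exact measurePreserving_add_right volume a
  have h := I.corr_map hτ (hg a) (ms ⟨n, x⟩)
  rwa [← ms_tmap] at h

lemma integrable_tupleFn_urs (hν : I.ν = volume) (m : ℕ) :
    Integrable (fun y : Fin (m + 1) → EucSp d => tupleFn I.urs (m + 2) (Fin.cons 0 y)) volume := by
  have h := I.integrable_urs 0 (m + 1)
  rw [hν, ← volume_pi] at h
  simpa [tupleFn] using h

end Interaction

section Potential

variable {d : ℕ} {φ : EucSp d → EReal}

lemma bweight_pos {x y : EucSp d} (h : x ≠ y) : 0 < bweight φ x y := by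
  rw [bweight, if_neg h]
  exact Real.exp_pos _

lemma bweight_add_right (a x y : EucSp d) : bweight φ (x + a) (y + a) = bweight φ x y := by
  simp [bweight]

lemma eexp_neg_energy (hφ : IsPairPotential φ) {x : EucSp d} {γ : Set (EucSp d)} (hx : x ∉ γ)
    (hs : Summable fun y : γ => Real.log (bweight φ x y.1)) :
    eexp (-(energy φ x γ)) = ENNReal.ofReal (Real.exp (∑' y : γ, Real.log (bweight φ x y.1))) := by
  have hne : ∀ y ∈ γ, x ≠ y := fun y hy h => hx (h ▸ hy)
  have hlog : (fun y : γ => Real.log (bweight φ x y.1)) = fun y : γ => -(φ (x - y.1)).toReal := by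
    funext y
    rw [bweight, if_neg (hne y y.2), Real.log_exp]
  rw [hlog] at hs ⊢
  rw [energy, if_pos ⟨fun y hy => hφ.finite_off _ (sub_ne_zero.2 (hne y hy)), summable_neg_iff.1 hs⟩,
    tsum_neg, ← EReal.coe_neg, eexp, if_neg (EReal.coe_ne_top _), if_neg (EReal.coe_ne_bot _),
    EReal.toReal_coe]

lemma gnz_gibbs (hd : 0 < d) (hφ : IsPairPotential φ) {B : ℝ} (hS : Stable φ B) {z : ℝ}
    (hz : 0 < z) (hL : LAHT φ z B) :
    GNZ z φ (Interaction.gibbs (I := potInteraction hd hφ hS hz hL) exhaustion_volume) := by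
  set I := potInteraction hd hφ hS hz hL
  intro F hF
  have hν : ∀ x, I.ν {x} = 0 := volume_singleton_eq_zero hd
  have h := Interaction.lintegral_tsum_eq (I := I) exhaustion_volume
    (fun x y h => bweight_pos h) hν hF
  refine h.trans (lintegral_congr_ae ?_)
  filter_upwards [Interaction.ae_ae_mem_regSet (I := I) exhaustion_volume hν] with γ hγ
  refine lintegral_congr_ae ?_
  filter_upwards [hγ] with x hx
  rw [I.boltz_of_mem_regSet hx, eexp_neg_energy hφ hx.2 (I.summable_log_of_mem_regSet hx)]
  rfl

end Potential

end Ruelle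

/-- Ruelle's theorem: under (S) and (LA-HT) there exists a Gibbs measure
`μ ∈ G(z,φ)` with translation invariant correlation functions satisfying the Ruelle
bound, whose Ursell functions satisfy `u^{(n)}(0,·) ∈ L¹(ℝ^{d(n-1)})` for `n ≥ 2`. -/
theorem statement1 (d : ℕ) (hd : 0 < d) (φ : EucSp d → EReal) (hφ : IsPairPotential φ)
    (B : ℝ) (hB : 0 ≤ B) (hS : Stable φ B) (z : ℝ) (hz : 0 < z) (hL : LAHT φ z B) :
    ∃ (μ : Measure (Config d)) (k u : ∀ n : ℕ, (Fin n → EucSp d) → ℝ) (ξ : ℝ),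
      IsProbabilityMeasure μ ∧ GNZ z φ μ ∧ HasCorrFns μ k ∧ TransInvFns k ∧
      0 < ξ ∧ RuelleBound k ξ ∧ IsUrsell k u ∧
      ∀ m : ℕ, Integrable (fun y : Fin (m + 1) → EucSp d => u (m + 2) (Fin.cons 0 y))
        volume := by
  set I := Ruelle.potInteraction hd hφ hS hz hL
  have hν : I.ν = volume := rfl
  have hW : Ruelle.Exhaustion I.ν (Ruelle.ballSeq d) := Ruelle.exhaustion_volume
  exact ⟨Ruelle.Interaction.gibbs hW,
    fun n x => I.corr univ (Ruelle.ms ⟨n, x⟩), Ruelle.tupleFn I.urs, I.ξ, inferInstance,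
    Ruelle.gnz_gibbs hd hφ hS hz hL, I.hasCorrFns_gibbs hW hν,
    I.transInvFns_corr hν Ruelle.bweight_add_right, I.ξ_pos, I.ruelleBound_corr, I.isUrsell_corr,
    I.integrable_tupleFn_urs hν⟩

end
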